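/- arXiv:1106.0839 — 5 statements merged into one kernel-verified Lean document; each statement's English description precedes it below -/
import Mathlib

section
/- Let R be a Noetherian local ring that is equidimensional and catenary, let x be an element of R not contained in any minimal prime of R, and let P be a prime ideal of R with P + xR ≠ R. Then the height of the ideal P(R/xR) in R/xR is at most the height of P. -/
set_option synthInstance.maxHeartbeats 1000000
set_option maxHeartbeats 1000000

/-- The height of an ideal: the infimum of the heights of the prime ideals containing it. -/
noncomputable def IdealHeight {R : Type*} [CommRing R] (I : Ideal R) : ℕ∞ :=
  sInf (Order.height '' {p : PrimeSpectrum R | I ≤ p.asIdeal})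

/-- A ring is catenary if any two saturated chains of primes with the same endpoints have the
same length. -/
def IsCatenaryRing (R : Type*) [CommRing R] : Prop :=
  ∀ c d : LTSeries (PrimeSpectrum R),
    (∀ i : Fin c.length, c.toFun i.castSucc ⋖ c.toFun i.succ) →
    (∀ i : Fin d.length, d.toFun i.castSucc ⋖ d.toFun i.succ) →
    c.head = d.head → c.last = d.last → c.length = d.length

/-- `CovByChain n a b` says that there is a saturated chain of length `n` from `a` to `b`. -/
inductive CovByChain {α : Type*} [Preorder α] : ℕ → α → α → Prop
  | refl (a : α) : CovByChain 0 a a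
  | tail {n : ℕ} {a b c : α} : CovByChain n a b → b ⋖ c → CovByChain (n + 1) a c

namespace CovByChain

variable {α : Type*}

theorem trans [Preorder α] {m n : ℕ} {a b c : α} (h : CovByChain m a b) (h' : CovByChain n b c) :
    CovByChain (m + n) a c := by
  induction h' with
  | refl => exact h
  | tail _ hc ih => exact (ih h).tail hc

theorem head [Preorder α] {n : ℕ} {a b c : α} (h : a ⋖ b) (h' : CovByChain n b c) :
    CovByChain (n + 1) a c := by
  simpa [add_comm] using ((refl a).tail h).trans h'

theorem exists_ltSeries [Preorder α] {n : ℕ} {a b : α} (h : CovByChain n a b) :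
    ∃ s : LTSeries α, (∀ i : Fin s.length, s.toFun i.castSucc ⋖ s.toFun i.succ) ∧
      s.head = a ∧ s.last = b ∧ s.length = n := by
  induction h with
  | refl a => exact ⟨RelSeries.singleton _ a, fun i => i.elim0, rfl, rfl, rfl⟩
  | @tail n a b c _ hc ih =>
    obtain ⟨s, hs, rfl, rfl, rfl⟩ := ih
    refine ⟨s.snoc c hc.lt, fun i => ?_, by simp, by simp, by simp⟩
    change Fin (s.length + 1) at i
    induction i using Fin.lastCases with
    | last =>
      have h₁ : (s.snoc c hc.lt).toFun (Fin.last s.length).castSucc = s.last :=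
        s.snoc_castSucc c hc.lt (Fin.last _)
      have h₂ : (s.snoc c hc.lt).toFun (Fin.last s.length).succ = c := s.last_snoc c hc.lt
      exact (congrArg₂ (· ⋖ ·) h₁ h₂).mpr hc
    | cast i =>
      have h₁ : (s.snoc c hc.lt).toFun i.castSucc.castSucc = s i.castSucc :=
        s.snoc_castSucc c hc.lt i.castSucc
      have h₂ : (s.snoc c hc.lt).toFun i.castSucc.succ = s i.succ :=
        s.snoc_castSucc c hc.lt i.succ
      exact (congrArg₂ (· ⋖ ·) h₁ h₂).mpr (hs i)

theorem exists_of_height_eq [PartialOrder α] {n : ℕ} {b : α} (h : Order.height b = n) :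
    ∃ a, IsMin a ∧ CovByChain n a b := by
  induction n generalizing b with
  | zero => exact ⟨b, by simpa using h, refl b⟩
  | succ n ih =>
    obtain ⟨-, ⟨c, hcb, hc⟩, hn⟩ := Order.height_eq_coe_add_one_iff.mp (by exact_mod_cast h)
    obtain ⟨a, ha, hac⟩ := ih hc
    refine ⟨a, ha, hac.tail ⟨hcb, fun d hcd hdb => ?_⟩⟩
    have := Order.height_add_one_le hcd
    rw [hc] at this
    exact absurd (this.trans (hn d hdb)) (by exact_mod_cast Nat.not_succ_le_self n)

theorem exists_of_coheight_eq [PartialOrder α] {n : ℕ} {a : α} (h : Order.coheight a = n) :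
    ∃ b, IsMax b ∧ CovByChain n a b := by
  induction n generalizing a with
  | zero => exact ⟨a, by simpa using h, refl a⟩
  | succ n ih =>
    obtain ⟨-, ⟨c, hac, hc⟩, hn⟩ := Order.coheight_eq_coe_add_one_iff.mp (by exact_mod_cast h)
    obtain ⟨b, hb, hcb⟩ := ih hc
    refine ⟨b, hb, hcb.head ⟨hac, fun d had hdc => ?_⟩⟩
    have := Order.coheight_add_one_le hdc
    rw [hc] at this
    exact absurd (this.trans (hn d had)) (by exact_mod_cast Nat.not_succ_le_self n)

end CovByChain

/-- In a finite-dimensional order with a top element in which saturated chains with the same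
endpoints have the same length and all minimal elements have the same coheight, height increases
by at most one along a covering relation. -/
theorem CovBy.height_le_height_add_one {α : Type*} [PartialOrder α] [OrderTop α]
    [FiniteDimensionalOrder α]
    (hcat : ∀ {m n : ℕ} {a b : α}, CovByChain m a b → CovByChain n a b → m = n)
    (hequi : ∀ p : α, IsMin p → (Order.coheight p : WithBot ℕ∞) = Order.krullDim α)
    {a b : α} (hab : a ⋖ b) : Order.height b ≤ Order.height a + 1 := by
  have hfin (c : α) : ∃ n : ℕ, Order.height c = n :=
    ENat.ne_top_iff_exists.mp (fun h => Order.krullDim_ne_top_of_finiteDimensionalOrder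
      (top_le_iff.mp (h ▸ Order.height_le_krullDim c))) |>.imp fun _ => Eq.symm
  have hcofin (c : α) : ∃ n : ℕ, Order.coheight c = n :=
    ENat.ne_top_iff_exists.mp (Order.coheight_lt_top c).ne |>.imp fun _ => Eq.symm
  obtain ⟨m, hm⟩ := hfin a
  obtain ⟨n, hn⟩ := hfin b
  obtain ⟨k, hk⟩ := hcofin b
  obtain ⟨p, hp, hpa⟩ := CovByChain.exists_of_height_eq hm
  obtain ⟨q, hq, hqb⟩ := CovByChain.exists_of_height_eq hn
  obtain ⟨t, ht, hbt⟩ := CovByChain.exists_of_coheight_eq hk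
  obtain ⟨d, hd⟩ := hcofin p
  obtain ⟨e, he⟩ := hcofin q
  obtain ⟨u, hu, hpu⟩ := CovByChain.exists_of_coheight_eq hd
  obtain ⟨v, hv, hqv⟩ := CovByChain.exists_of_coheight_eq he
  obtain rfl := hu.eq_top
  obtain rfl := hv.eq_top
  obtain rfl := ht.eq_top
  have h₁ := hcat hpu ((hpa.tail hab).trans hbt)
  have h₂ := hcat hqv (hqb.trans hbt)
  have h₃ : d = e := by
    have := (hequi p hp).trans (hequi q hq).symm
    rw [hd, he] at this
    exact_mod_cast this
  rw [hm, hn]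
  exact_mod_cast (by omega : n ≤ m + 1)

/-- A strictly monotone map which avoids the minimal elements raises heights by at least one. -/
theorem StrictMono.height_add_one_le {α β : Type*} [PartialOrder α] [Preorder β] {f : β → α}
    (hf : StrictMono f) (hmin : ∀ y, ¬ IsMin (f y)) (y : β) :
    Order.height y + 1 ≤ Order.height (f y) := by
  rcases eq_or_ne (Order.height (f y)) ⊤ with h | h
  · simp [h]
  obtain ⟨n, hn⟩ := ENat.ne_top_iff_exists.mp h
  have hpos : n ≠ 0 := by
    rintro rfl
    exact hmin y (Order.height_eq_zero.mp hn.symm)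
  obtain ⟨m, rfl⟩ := Nat.exists_eq_succ_of_ne_zero hpos
  rw [← hn, Nat.succ_eq_add_one, Nat.cast_add, Nat.cast_one]
  gcongr
  refine Order.height_le fun s hs => ?_
  obtain ⟨z, hz⟩ := not_isMin_iff.mp (hmin s.head)
  have := Order.length_le_height_last (p := (s.map f hf).cons z (by simpa using hz))
  rw [RelSeries.last_cons, LTSeries.last_map, hs, ← hn] at this
  simp only [RelSeries.cons_length, LTSeries.map_length] at this
  exact_mod_cast Nat.le_of_succ_le_succ (by exact_mod_cast this)

/-- In a Noetherian ring, a prime minimal over `P + xR`, with `P` a prime not containing `x`,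
covers `P`. -/
theorem PrimeSpectrum.covBy_of_mem_minimalPrimes_sup_span {R : Type*} [CommRing R]
    [IsNoetherianRing R] {P Q : PrimeSpectrum R} {x : R} (hx : x ∉ P.asIdeal)
    (hQ : Q.asIdeal ∈ (P.asIdeal ⊔ Ideal.span {x}).minimalPrimes) : P ⋖ Q := by
  have hxQ : x ∈ Q.asIdeal :=
    hQ.1.2 (Ideal.mem_sup_right (Ideal.mem_span_singleton_self x))
  have hPQ : P ≤ Q := le_sup_left.trans hQ.1.2
  refine ⟨lt_of_le_of_ne hPQ fun h => hx (h ▸ hxQ), fun L hPL hLQ => ?_⟩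
  let e := P.asIdeal.primeSpectrumQuotientOrderIsoZeroLocus
  let P' : PrimeSpectrum.zeroLocus (P.asIdeal : Set R) := ⟨P, le_refl P.asIdeal⟩
  let L' : PrimeSpectrum.zeroLocus (P.asIdeal : Set R) := ⟨L, hPL.le⟩
  let Q' : PrimeSpectrum.zeroLocus (P.asIdeal : Set R) := ⟨Q, hPQ⟩
  have h := Ideal.map_height_le_one_of_mem_minimalPrimes hQ
  change (e.symm Q').asIdeal.height ≤ 1 at h
  rw [PrimeSpectrum.height_eq_orderHeight, Order.height_orderIso] at h
  exact h.not_gt (Order.one_lt_height_iff.mpr ⟨L', P', hPL, hLQ⟩)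

theorem IdealHeight_le_height {R : Type*} [CommRing R] {I : Ideal R} {p : PrimeSpectrum R}
    (h : I ≤ p.asIdeal) : IdealHeight I ≤ Order.height p :=
  sInf_le ⟨p, h, rfl⟩

theorem height_le_IdealHeight {R : Type*} [CommRing R] (p : PrimeSpectrum R) :
    Order.height p ≤ IdealHeight p.asIdeal := by
  refine le_sInf ?_
  rintro _ ⟨q, hq, rfl⟩
  exact Order.height_mono hq

/-- **Height does not rise.** Let `R` be a Noetherian local ring that is equidimensional and
catenary, let `x ∈ R` avoid every minimal prime of `R`, and let `P` be a prime ideal with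
`P + xR ≠ R`. Then the height of `P(R/xR)` is at most the height of `P`. -/
theorem height_map_le_of_equidimensional_catenary
    (R : Type*) [CommRing R] [IsNoetherianRing R] [IsLocalRing R]
    (hequi : ∀ p ∈ minimalPrimes R, ringKrullDim (R ⧸ p) = ringKrullDim R)
    (hcat : IsCatenaryRing R)
    (x : R) (hx : ∀ p ∈ minimalPrimes R, x ∉ p)
    (P : Ideal R) (hP : P.IsPrime) (hPx : P ⊔ Ideal.span {x} ≠ ⊤) :
    IdealHeight (P.map (Ideal.Quotient.mk (Ideal.span {x}))) ≤ IdealHeight P := by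
  let p : PrimeSpectrum R := ⟨P, hP⟩
  refine le_trans ?_ (height_le_IdealHeight p)
  obtain ⟨Q, hQ⟩ := Ideal.nonempty_minimalPrimes hPx
  let q : PrimeSpectrum R := ⟨Q, hQ.1.1⟩
  have hPQ : P ≤ Q := le_sup_left.trans hQ.1.2
  let e := (Ideal.span {x}).primeSpectrumQuotientOrderIsoZeroLocus
  let f : PrimeSpectrum (R ⧸ Ideal.span {x}) → PrimeSpectrum R := fun y => (e y).1
  have hf : StrictMono f := fun _ _ h => e.strictMono h
  let q' := e.symm ⟨q, le_sup_right.trans hQ.1.2⟩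
  have hfq : f q' = q := congrArg Subtype.val (e.apply_symm_apply _)
  have hmap : P.map (Ideal.Quotient.mk (Ideal.span {x})) ≤ q'.asIdeal := Ideal.map_mono hPQ
  refine (IdealHeight_le_height hmap).trans ?_
  by_cases hxP : x ∈ P
  · have hle : Q ≤ P := hQ.2 ⟨hP, sup_le le_rfl (by simpa [Ideal.span_le] using hxP)⟩ hPQ
    exact (Order.height_le_height_apply_of_strictMono f hf q').trans
      (Order.height_mono (hfq.trans_le hle))
  · have hmin (y) : ¬ IsMin (f y) := fun h =>
      hx _ (PrimeSpectrum.isMin_iff.mp h) ((e y).2 (Ideal.mem_span_singleton_self x))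
    have h₁ := hf.height_add_one_le hmin q'
    rw [hfq] at h₁
    have hcov : p ⋖ q := PrimeSpectrum.covBy_of_mem_minimalPrimes_sup_span hxP hQ
    have h₂ : Order.height q ≤ Order.height p + 1 := by
      refine hcov.height_le_height_add_one ?_ ?_
      · intro m n a b hm hn
        obtain ⟨c, hc, rfl, rfl, rfl⟩ := hm.exists_ltSeries
        obtain ⟨d, hd, hd₁, hd₂, rfl⟩ := hn.exists_ltSeries
        exact hcat c d hc hd hd₁.symm hd₂.symm
      · intro r hr
        rw [Order.coheight_eq_krullDim_Ici]
        exact (ringKrullDim_quotient r.asIdeal).symm.trans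
          (hequi _ (PrimeSpectrum.isMin_iff.mp hr))
    exact (ENat.add_le_add_iff_right ENat.one_ne_top).mp (h₁.trans h₂)
end

section
/- Let F_1,...,F_t be a regular sequence of homogeneous forms of positive degree in a polynomial ring R over a field K, and let A = K[F_1,...,F_t] be the K-subalgebra they generate. Then R is a free A-module. -/
set_option synthInstance.maxHeartbeats 1000000
set_option maxHeartbeats 1000000

open scoped Pointwise in
/-- If `r` is regular on `M` and the `b j` satisfy no relation over `S` modulo `r M`, then they
satisfy no relation over `S[X]`, where `X` acts as `r`. -/
theorem Polynomial.coeff_eq_zero_of_sum_eval₂_smul_eq_zero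
    {S R M ι : Type*} [CommRing S] [CommRing R] [AddCommGroup M] [Module R M]
    (φ : S →+* R) (r : R) (hr : IsSMulRegular M r) (b : ι → M) (s : Finset ι)
    (hb : ∀ c : ι → S, ∑ j ∈ s, φ (c j) • b j ∈ r • (⊤ : Submodule R M) → ∀ j ∈ s, c j = 0)
    (k : ℕ) (q : ι → Polynomial S) (hq : ∑ j ∈ s, (q j).eval₂ φ r • b j = 0) :
    ∀ j ∈ s, (q j).coeff k = 0 := by
  have key (q : ι → Polynomial S) : ∑ j ∈ s, (q j).eval₂ φ r • b j =
      r • ∑ j ∈ s, (q j).divX.eval₂ φ r • b j + ∑ j ∈ s, φ ((q j).coeff 0) • b j := by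
    rw [Finset.smul_sum, ← Finset.sum_add_distrib]
    refine Finset.sum_congr rfl fun j _ => ?_
    conv_lhs => rw [← (q j).divX_mul_X_add]
    rw [Polynomial.eval₂_add, Polynomial.eval₂_mul_X, Polynomial.eval₂_C, add_smul, smul_smul,
      mul_comm]
  have h0 (q : ι → Polynomial S) (hq : ∑ j ∈ s, (q j).eval₂ φ r • b j = 0) :
      ∀ j ∈ s, (q j).coeff 0 = 0 := by
    refine hb _ ?_
    rw [key, add_comm] at hq
    rw [eq_neg_of_add_eq_zero_left hq]
    exact neg_mem (Submodule.smul_mem_pointwise_smul _ _ ⊤ trivial)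
  induction k generalizing q with
  | zero => exact h0 q hq
  | succ k ih =>
    intro j hj
    rw [← Polynomial.coeff_divX]
    refine ih (fun j => (q j).divX) (hr ?_) j hj
    have h := key q
    rw [hq, Finset.sum_eq_zero (f := fun j => φ ((q j).coeff 0) • b j)
      (fun j hj => by rw [h0 q hq j hj, map_zero, zero_smul]), add_zero] at h
    simp [← h]

open scoped Pointwise in
open RingTheory.Sequence in
/-- If `F` is weakly regular on `M` and the `b j` are linearly independent over `K` modulo `(F) M`,
then they are linearly independent over the polynomial ring acting through `F`. -/
theorem MvPolynomial.eq_zero_of_sum_aeval_smul_eq_zero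
    {K R ι : Type*} [CommRing K] [CommRing R] [Algebra K R] (s : Finset ι) {t : ℕ} (F : Fin t → R)
    {M : Type*} [AddCommGroup M] [Module R M] (hF : IsWeaklyRegular M (List.ofFn F)) (b : ι → M)
    (hb : ∀ c : ι → K, ∑ j ∈ s, algebraMap K R (c j) • b j ∈
      Ideal.ofList (List.ofFn F) • (⊤ : Submodule R M) → ∀ j ∈ s, c j = 0)
    (p : ι → MvPolynomial (Fin t) K) (hp : ∑ j ∈ s, aeval F (p j) • b j = 0) :
    ∀ j ∈ s, p j = 0 := by
  induction t generalizing M with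
  | zero =>
    have hC (j : ι) : p j = C (constantCoeff (p j)) :=
      (MvPolynomial.eq_C_of_isEmpty (p j)).trans rfl
    intro j hj
    rw [hC, hb (fun j => constantCoeff (p j)) ?_ j hj, map_zero]
    rw [show ∑ j ∈ s, algebraMap K R (constantCoeff (p j)) • b j = 0 from ?_]
    · exact zero_mem _
    rw [← hp]
    refine Finset.sum_congr rfl fun j _ => ?_
    conv_rhs => rw [hC, aeval_C]
  | succ n ih =>
    rw [List.ofFn_succ] at hF hb
    rw [isWeaklyRegular_cons_iff] at hF
    have haeval (q : MvPolynomial (Fin (n + 1)) K) : aeval F q =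
        (finSuccEquiv K n q).eval₂ (aeval (R := K) fun i => F i.succ).toRingHom (F 0) := by
      induction q using MvPolynomial.induction_on with
      | C a => simp [finSuccEquiv_apply]
      | add p q hp hq => simp [hp, hq, Polynomial.eval₂_add]
      | mul_X p i hp =>
        simp only [map_mul, Polynomial.eval₂_mul, hp, aeval_X]
        cases i using Fin.cases <;> simp [finSuccEquiv_X_zero, finSuccEquiv_X_succ]
    simp_rw [haeval] at hp
    intro j hj
    rw [← (finSuccEquiv K n).map_eq_zero_iff]
    ext1 k
    rw [Polynomial.coeff_zero]
    refine Polynomial.coeff_eq_zero_of_sum_eval₂_smul_eq_zero _ _ hF.1 b s (fun c hc => ?_) k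
      (fun j => finSuccEquiv K n (p j)) hp j hj
    have hmk (c : ι → R) : ∑ j ∈ s, c j • (Submodule.Quotient.mk (b j) : QuotSMulTop (F 0) M) =
        Submodule.Quotient.mk (∑ j ∈ s, c j • b j) :=
      (map_sum (Submodule.mkQ (F 0 • (⊤ : Submodule R M))) (fun j => c j • b j) s).symm
    refine ih _ hF.2 (fun j => Submodule.Quotient.mk (b j)) (fun c hc => hb c ?_) c ?_
    · have hmap : Ideal.ofList (List.ofFn fun i => F i.succ) • (⊤ : Submodule R (QuotSMulTop (F 0) M))
          = (Ideal.ofList (List.ofFn fun i => F i.succ) • (⊤ : Submodule R M)).map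
            (Submodule.mkQ (F 0 • (⊤ : Submodule R M))) := by
        rw [Submodule.map_smul'', Submodule.map_top, Submodule.range_mkQ]
      rw [hmap, hmk] at hc
      obtain ⟨y, hy, hyc⟩ := hc
      rw [Ideal.ofList_cons_smul, ← sub_add_cancel (∑ j ∈ s, _) y]
      refine Submodule.add_mem_sup ?_ hy
      rw [← Submodule.Quotient.mk_eq_zero, Submodule.Quotient.mk_sub, sub_eq_zero]
      exact hyc.symm
    · exact (hmk _).trans ((Submodule.Quotient.mk_eq_zero _).mpr hc)

theorem MvPolynomial.IsHomogeneous.homogeneousComponent_mul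
    {σ K : Type*} [CommSemiring K] {f : MvPolynomial σ K} {d : ℕ} (hf : f.IsHomogeneous d)
    (g : MvPolynomial σ K) (n : ℕ) :
    homogeneousComponent n (f * g) =
      if d ≤ n then f * homogeneousComponent (n - d) g else 0 := by
  classical
  let : GradedAlgebra (homogeneousSubmodule σ K) := gradedAlgebra
  have hdec (p : MvPolynomial σ K) (m : ℕ) :
      (DirectSum.decompose (homogeneousSubmodule σ K) p m : MvPolynomial σ K) =
        homogeneousComponent m p := decomposition.decompose'_apply p m
  simpa only [hdec] using
    DirectSum.coe_decompose_mul_of_left_mem (homogeneousSubmodule σ K) (b := g) n hf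

open MvPolynomial in
/-- Graded Nakayama: homogeneous elements that span modulo `(F)` over `K` span over `K[F]`. -/
theorem MvPolynomial.span_adjoin_eq_top_of_isHomogeneous
    {σ K τ ι : Type*} [Fintype τ] [Field K] (F : τ → MvPolynomial σ K) (d : τ → ℕ)
    (hdeg : ∀ i, (F i).IsHomogeneous (d i)) (hpos : ∀ i, 0 < d i)
    (b : ι → MvPolynomial σ K) (e : ι → ℕ) (hb : ∀ j, (b j).IsHomogeneous (e j))
    (hspan : ∀ f, ∃ v ∈ Submodule.span K (Set.range b), f - v ∈ Ideal.span (Set.range F)) :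
    Submodule.span (Algebra.adjoin K (Set.range F)) (Set.range b) = ⊤ := by
  set N := Submodule.span (Algebra.adjoin K (Set.range F)) (Set.range b)
  have hcomp (n : ℕ) : ∀ g, homogeneousComponent n g ∈ N := by
    induction n using Nat.strong_induction_on with
    | _ n ih =>
    intro g
    obtain ⟨v, hv, hgv⟩ := hspan g
    rw [← sub_add_cancel g v, map_add]
    refine add_mem ?_ ?_
    · obtain ⟨c, hc⟩ := Ideal.mem_span_range_iff_exists_fun.mp hgv
      rw [← hc, map_sum]
      refine sum_mem fun i _ => ?_
      rw [mul_comm, (hdeg i).homogeneousComponent_mul]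
      split_ifs with h
      · exact N.smul_mem ⟨F i, Algebra.subset_adjoin ⟨i, rfl⟩⟩ (ih _ (by have := hpos i; omega) _)
      · exact zero_mem _
    · have hle : Submodule.span K (Set.range b) ≤
          (N.restrictScalars K).comap (homogeneousComponent n) := by
        rw [Submodule.span_le]
        rintro _ ⟨j, rfl⟩
        change homogeneousComponent n (b j) ∈ N
        rw [homogeneousComponent_of_mem (hb j)]
        split_ifs
        · exact Submodule.subset_span ⟨j, rfl⟩
        · exact zero_mem _
      exact hle hv
  rw [eq_top_iff]
  intro f _
  rw [← sum_homogeneousComponent f]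
  exact sum_mem fun n _ => hcomp n f

/-- If `F_1,…,F_t` is a regular sequence of forms of positive degree in a polynomial ring `R`
over a field `K`, then `R` is free as a module over the subalgebra `A = K[F_1,…,F_t]`. -/
theorem free_over_subalgebra_of_regular_sequence
    (K : Type*) [Field K] (N t : ℕ)
    (F : Fin t → MvPolynomial (Fin N) K) (d : Fin t → ℕ)
    (hdeg : ∀ i, (F i).IsHomogeneous (d i)) (hpos : ∀ i, 0 < d i)
    (hreg : RingTheory.Sequence.IsRegular (MvPolynomial (Fin N) K) (List.ofFn F)) :
    Module.Free (Algebra.adjoin K (Set.range F)) (MvPolynomial (Fin N) K) := by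
  let I : Ideal (MvPolynomial (Fin N) K) := Ideal.span (Set.range F)
  have hI : Ideal.ofList (List.ofFn F) • (⊤ : Submodule (MvPolynomial (Fin N) K) _) = I := by
    simp only [Ideal.ofList, List.mem_ofFn, smul_eq_mul, Ideal.mul_top, I]
    rfl
  let π : MvPolynomial (Fin N) K →ₗ[K] MvPolynomial (Fin N) K ⧸ I := (Ideal.Quotient.mkₐ K I).toLinearMap
  have hπ (f) : π f = 0 ↔ f ∈ I := Ideal.Quotient.eq_zero_iff_mem
  obtain ⟨κ, a, -, hspan, hli⟩ :=
    exists_linearIndependent' K fun m : Fin N →₀ ℕ => π (MvPolynomial.monomial m 1)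
  let b (j : κ) : MvPolynomial (Fin N) K := MvPolynomial.monomial (a j) 1
  have hb : LinearIndependent (Algebra.adjoin K (Set.range F)) b := by
    rw [linearIndependent_iff']
    intro s g hg
    have hg' (j : κ) : ∃ p, MvPolynomial.aeval (R := K) F p = (g j : MvPolynomial (Fin N) K) := by
      have hle := (Algebra.adjoin_range_eq_range_aeval K F).le
      exact hle (g j).2
    choose p hp using hg'
    have hp0 := MvPolynomial.eq_zero_of_sum_aeval_smul_eq_zero (K := K) s F hreg.toIsWeaklyRegular b ?_ p
      (by simp only [hp]; exact hg)
    · intro j hj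
      ext1
      rw [← hp, hp0 j hj, map_zero, ZeroMemClass.coe_zero]
    · intro c hc
      rw [hI, ← hπ, map_sum] at hc
      refine linearIndependent_iff'.mp hli s c ?_
      rw [← hc]
      refine Finset.sum_congr rfl fun j _ => ?_
      rw [smul_eq_mul, ← Algebra.smul_def, map_smul]
      rfl
  refine Module.Free.of_basis (Module.Basis.mk hb (ge_of_eq ?_))
  refine MvPolynomial.span_adjoin_eq_top_of_isHomogeneous F d hdeg hpos b (fun j => (a j).degree)
    (fun j => MvPolynomial.isHomogeneous_monomial _ rfl) fun f => ?_
  have hf : π f ∈ (Submodule.span K (Set.range b)).map π := by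
    have hmon : Submodule.span K (Set.range fun m : Fin N →₀ ℕ => MvPolynomial.monomial m (1 : K)) = ⊤ :=
      (MvPolynomial.basisMonomials (Fin N) K).span_eq
    have h1 : Set.range ((fun m : Fin N →₀ ℕ => π (MvPolynomial.monomial m 1)) ∘ a) = π '' Set.range b := by
      rw [← Set.range_comp]; rfl
    rw [Submodule.map_span, ← h1, hspan]
    change _ ∈ Submodule.span K (Set.range (π ∘ fun m : Fin N →₀ ℕ => MvPolynomial.monomial m (1 : K)))
    rw [Set.range_comp, ← Submodule.map_span, hmon]
    exact Submodule.mem_map_of_mem trivial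
  obtain ⟨v, hv, hvf⟩ := hf
  exact ⟨v, hv, (hπ _).mp (by rw [map_sub, hvf, sub_self])⟩
end

section
/- Let R be a polynomial ring over a field K, let F_1,...,F_t be a regular sequence of forms of positive degree in R, and let J be an ideal of R generated by elements of the subring A = K[F_1,...,F_t]. Then the projective dimension of R/J as an R-module is at most t. -/
set_option synthInstance.maxHeartbeats 1000000
set_option maxHeartbeats 1000000

open CategoryTheory

/-- The projective dimension of a module, defined as the least length of a projective
resolution (`⊤` if there is no finite projective resolution). -/
noncomputable def ProjDim (R : Type*) [CommRing R] (M : Type*) [AddCommGroup M] [Module R M] :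
    ℕ∞ :=
  sInf {n : ℕ∞ | ∃ k : ℕ, n = k ∧ ∃ P : ProjectiveResolution (ModuleCat.of R M),
    ∀ i, k < i → Limits.IsZero (P.complex.X i)}

universe u v

namespace CategoryTheory.ProjectiveResolution

variable {C : Type u} [Category.{v} C] [Abelian C]

/-- The augmentation map of a projective resolution. -/
noncomputable def augmentation {Z : C} (Q : ProjectiveResolution Z) : Q.complex.X 0 ⟶ Z :=
  Q.π.f 0

theorem d_comp_augmentation {Z : C} (Q : ProjectiveResolution Z) :
    Q.complex.d 1 0 ≫ Q.augmentation = 0 :=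
  Q.complex_d_comp_π_f_zero

theorem d_comp_augmentation_comp {Z Y : C} (Q : ProjectiveResolution Z) (f : Z ⟶ Y) :
    Q.complex.d 1 0 ≫ Q.augmentation ≫ f = 0 := by
  rw [← Category.assoc, d_comp_augmentation, Limits.zero_comp]

theorem augmentation_comp_zero (S : ShortComplex C) (Q : ProjectiveResolution S.X₁) :
    (Q.augmentation ≫ S.f) ≫ S.g = 0 := by
  rw [Category.assoc, S.zero, Limits.comp_zero]

/-- Splice a short exact sequence with projective middle term with a projective resolution of
its left term. -/
noncomputable def splice {S : ShortComplex C} (hS : S.ShortExact) [Projective S.X₂]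
    (Q : ProjectiveResolution S.X₁) : ProjectiveResolution S.X₃ where
  complex := Q.complex.augment (X := S.X₂) (Q.augmentation ≫ S.f) (Q.d_comp_augmentation_comp S.f)
  projective n := by
    cases n
    · exact inferInstanceAs (Projective S.X₂)
    · exact Q.projective _
  π := (ChainComplex.toSingle₀Equiv _ _).symm ⟨S.g, by
    rw [ChainComplex.augment_d_one_zero]
    exact Q.augmentation_comp_zero S⟩
  quasiIso := by
    have := hS.mono_f
    have := hS.epi_g
    have h0 := ChainComplex.toSingle₀Equiv_symm_apply_f_zero
      (C := Q.complex.augment (X := S.X₂) (Q.augmentation ≫ S.f) (Q.d_comp_augmentation_comp S.f))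
      S.g (by rw [ChainComplex.augment_d_one_zero]; exact Q.augmentation_comp_zero S)
    refine ⟨fun n => ?_⟩
    obtain _ | n := n
    · rw [ChainComplex.quasiIsoAt₀_iff, ShortComplex.quasiIso_iff_of_zeros']
      · refine (ShortComplex.exact_and_epi_g_iff_of_iso
          (S₂ := ShortComplex.mk (Q.augmentation ≫ S.f) S.g (Q.augmentation_comp_zero S)) ?_).2
            ⟨?_, by dsimp; infer_instance⟩
        · exact ShortComplex.isoMk (Iso.refl _) (Iso.refl _) (Iso.refl _)
            ((Category.id_comp _).trans (Category.comp_id _).symm)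
            ((Category.id_comp _).trans (Eq.trans (Eq.symm h0) (Category.comp_id _).symm))
        let φ : ShortComplex.mk (Q.augmentation ≫ S.f) S.g
            (Q.augmentation_comp_zero S) ⟶ S :=
          { τ₁ := Q.augmentation
            τ₂ := 𝟙 _
            τ₃ := 𝟙 _ }
        have : Epi φ.τ₁ := inferInstanceAs (Epi (Q.π.f 0))
        have : IsIso φ.τ₂ := inferInstanceAs (IsIso (𝟙 _))
        have : Mono φ.τ₃ := inferInstanceAs (Mono (𝟙 _))
        exact (ShortComplex.exact_iff_of_epi_of_isIso_of_mono φ).2 hS.exact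
      all_goals rfl
    · rw [quasiIsoAt_iff_exactAt' _ _ (ChainComplex.exactAt_succ_single_obj _ _)]
      obtain _ | n := n
      · rw [HomologicalComplex.exactAt_iff' _ 2 1 0 (by simp) (by simp)]
        let φ : ShortComplex.mk _ _ Q.d_comp_augmentation ⟶
            ShortComplex.mk (Q.complex.d 1 0) (Q.augmentation ≫ S.f)
              (Q.d_comp_augmentation_comp S.f) :=
          { τ₁ := 𝟙 _
            τ₂ := 𝟙 _
            τ₃ := S.f }
        have : Epi φ.τ₁ := inferInstanceAs (Epi (𝟙 _))
        have : IsIso φ.τ₂ := inferInstanceAs (IsIso (𝟙 _))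
        have : Mono φ.τ₃ := inferInstanceAs (Mono S.f)
        exact (ShortComplex.exact_iff_of_epi_of_isIso_of_mono φ).1 Q.exact₀
      · rw [HomologicalComplex.exactAt_iff' _ (n + 3) (n + 2) (n + 1) (by simp) (by simp)]
        exact Q.exact_succ n

/-- An object of projective dimension at most `n` has a projective resolution of length `n`. -/
theorem exists_isZero_of_hasProjectiveDimensionLE [EnoughProjectives C] (n : ℕ) (Z : C)
    [HasProjectiveDimensionLE Z n] :
    ∃ P : ProjectiveResolution Z, ∀ i, n < i → Limits.IsZero (P.complex.X i) := by
  induction n generalizing Z with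
  | zero =>
    have : Projective Z := (projective_iff_hasProjectiveDimensionLE_zero Z).2 ‹_›
    exact ⟨self Z, fun i hi ↦ HomologicalComplex.isZero_single_obj_X _ _ _ _ hi.ne'⟩
  | succ n ih =>
    let S := ShortComplex.mk _ _ (Limits.kernel.condition (Projective.π Z))
    have hS : S.ShortExact :=
      { exact := ShortComplex.exact_kernel _
        mono_f := inferInstanceAs (Mono (Limits.kernel.ι _))
        epi_g := inferInstanceAs (Epi (Projective.π Z)) }
    have : Projective S.X₂ := Projective.projective_over Z
    have : HasProjectiveDimensionLE S.X₁ n :=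
      (hS.hasProjectiveDimensionLT_X₃_iff n this).1 ‹_›
    obtain ⟨Q, hQ⟩ := ih S.X₁
    refine ⟨splice hS Q, fun i hi ↦ ?_⟩
    obtain _ | i := i
    · simp at hi
    · exact hQ i (by simpa using hi)

end CategoryTheory.ProjectiveResolution

open TensorProduct

theorem ModuleCat.shortExact_shortComplexOfCompEqZero {R : Type*} [Ring R] {M N P : Type u}
    [AddCommGroup M] [AddCommGroup N] [AddCommGroup P] [Module R M] [Module R N] [Module R P]
    {f : M →ₗ[R] N} {g : N →ₗ[R] P} (hf : Function.Injective f) (h : Function.Exact f g)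
    (hg : Function.Surjective g) :
    (ModuleCat.shortComplexOfCompEqZero f g h.linearMap_comp_eq_zero).ShortExact :=
  ModuleCat.shortComplex_shortExact _ h hf hg

/-- Flat base change does not increase the projective dimension. -/
theorem ModuleCat.hasProjectiveDimensionLT_tensorProduct_of_flat {A B : Type u} [CommRing A]
    [CommRing B] [Algebra A B] [Module.Flat A B] (n : ℕ) (M : Type u) [AddCommGroup M] [Module A M]
    [h : HasProjectiveDimensionLT (ModuleCat.of A M) n] :
    HasProjectiveDimensionLT (ModuleCat.of B (B ⊗[A] M)) n := by
  induction n using Nat.twoStepInduction generalizing M with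
  | zero =>
    rw [hasProjectiveDimensionLT_zero_iff_isZero, ModuleCat.isZero_iff_subsingleton] at h ⊢
    have : Subsingleton M := h
    exact inferInstanceAs (Subsingleton (B ⊗[A] M))
  | one =>
    rw [← projective_iff_hasProjectiveDimensionLT_one, ← IsProjective.iff_projective] at h ⊢
    have : Module.Projective A M := h
    exact inferInstanceAs (Module.Projective B (B ⊗[A] M))
  | more n _ ih =>
    let f : (M →₀ A) →ₗ[A] M := Finsupp.linearCombination A id
    have hf : Function.Surjective f := Finsupp.linearCombination_id_surjective A M
    have hK : HasProjectiveDimensionLT (ModuleCat.of A (LinearMap.ker f)) (n + 1) :=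
      ((LinearMap.shortExact_shortComplexKer hf).hasProjectiveDimensionLT_X₃_iff n
        (ModuleCat.projective_of_free (M := ModuleCat.of A (M →₀ A)) Finsupp.basisSingleOne)).1 h
    have hE : Function.Exact ((LinearMap.ker f).subtype.baseChange B) (f.baseChange B) :=
      Module.Flat.lTensor_exact (N := LinearMap.ker f) (N' := M →₀ A) (N'' := M) B
        (LinearMap.exact_subtype_ker_map f)
    have hS := ModuleCat.shortExact_shortComplexOfCompEqZero
      (Module.Flat.lTensor_preserves_injective_linearMap _ (LinearMap.ker f).injective_subtype)
      hE (LinearMap.lTensor_surjective B hf)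
    have hP : Projective (ModuleCat.of B (B ⊗[A] (M →₀ A))) :=
      (IsProjective.iff_projective _).1 inferInstance
    exact (hS.hasProjectiveDimensionLT_X₃_iff n hP).2 (ih (LinearMap.ker f))

namespace Polynomial

section

variable (A M : Type*) [CommRing A] [AddCommGroup M] [Module A M]

/-- The `i`-th coefficient of an element of `A[X] ⊗[A] M`. -/
noncomputable def tensorCoeff (i : ℕ) : A[X] ⊗[A] M →ₗ[A] M :=
  TensorProduct.lid A M ∘ₗ (lcoeff A i).rTensor M

theorem tensorCoeff_eventually_zero (z : A[X] ⊗[A] M) :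
    ∃ n, ∀ i, n ≤ i → tensorCoeff A M i z = 0 := by
  induction z with
  | zero => simp
  | add x y hx hy =>
    obtain ⟨a, ha⟩ := hx
    obtain ⟨b, hb⟩ := hy
    exact ⟨max a b, fun i hi ↦ by
      rw [map_add, ha i (le_of_max_le_left hi), hb i (le_of_max_le_right hi), add_zero]⟩
  | tmul p m =>
    refine ⟨p.natDegree + 1, fun i hi ↦ ?_⟩
    simp [tensorCoeff, coeff_eq_zero_of_natDegree_lt (Nat.lt_of_succ_le hi)]

theorem eq_zero_of_tensorCoeff_eq_zero (z : A[X] ⊗[A] M) (h : ∀ i, tensorCoeff A M i z = 0) :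
    z = 0 := by
  refine (TensorProduct.equivFinsuppOfBasisLeft (basisMonomials A)).injective ?_
  ext i
  rw [map_zero, Finsupp.zero_apply, ← h i]
  clear h
  induction z with
  | zero => simp
  | add x y hx hy => simp [hx, hy]
  | tmul p m =>
    simp [tensorCoeff, basisMonomials]
    rfl

variable [Module A[X] M] [IsScalarTower A A[X] M]

/-- The scalar multiplication `p ⊗ m ↦ p • m` of an `A[X]`-module. -/
noncomputable def tensorAction : A[X] ⊗[A] M →ₗ[A[X]] M :=
  (LinearMap.id : M →ₗ[A] M).liftBaseChange A[X]

@[simp]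
theorem tensorAction_tmul (p : A[X]) (m : M) : tensorAction A M (p ⊗ₜ m) = p • m := by
  simp [tensorAction]

theorem tensorAction_surjective : Function.Surjective (tensorAction A M) := fun m ↦
  ⟨1 ⊗ₜ m, by simp⟩

/-- The endomorphism `p ⊗ m ↦ X * p ⊗ m - p ⊗ X • m` of `A[X] ⊗[A] M`. -/
noncomputable def tensorXSub : A[X] ⊗[A] M →ₗ[A[X]] A[X] ⊗[A] M :=
  LinearMap.lsmul A[X] (A[X] ⊗[A] M) (X : A[X]) -
    (((LinearMap.lsmul A[X] M (X : A[X])).restrictScalars A).baseChange A[X])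

@[simp]
theorem tensorXSub_tmul (p : A[X]) (m : M) :
    tensorXSub A M (p ⊗ₜ m) = (X * p) ⊗ₜ m - p ⊗ₜ ((X : A[X]) • m) := by
  simp only [tensorXSub, LinearMap.sub_apply, LinearMap.lsmul_apply, LinearMap.baseChange_tmul,
    LinearMap.restrictScalars_apply, smul_tmul', smul_eq_mul]

theorem tensorCoeff_succ_tensorXSub (i : ℕ) (z : A[X] ⊗[A] M) :
    tensorCoeff A M (i + 1) (tensorXSub A M z) =
      tensorCoeff A M i z - (X : A[X]) • tensorCoeff A M (i + 1) z := by
  induction z with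
  | zero => simp
  | add x y hx hy => simp only [map_add, hx, hy, smul_add]; abel
  | tmul p m =>
    simp only [tensorXSub_tmul, tensorCoeff, map_sub, LinearMap.comp_apply,
      LinearMap.rTensor_tmul, lcoeff_apply, coeff_X_mul, LinearEquiv.coe_coe, lid_tmul,
      smul_comm (X : A[X])]

theorem tensorXSub_injective : Function.Injective (tensorXSub A M) := by
  refine (injective_iff_map_eq_zero _).2 fun z hz ↦ ?_
  have hs (i : ℕ) : tensorCoeff A M i z = (X : A[X]) • tensorCoeff A M (i + 1) z := by
    rw [← sub_eq_zero, ← tensorCoeff_succ_tensorXSub, hz, map_zero]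
  obtain ⟨n, hn⟩ := tensorCoeff_eventually_zero A M z
  have hd (k i : ℕ) : n ≤ i + k → tensorCoeff A M i z = 0 := by
    induction k generalizing i with
    | zero => exact hn i
    | succ k ih => exact fun h ↦ by rw [hs, ih (i + 1) (by omega), smul_zero]
  exact eq_zero_of_tensorCoeff_eq_zero A M z fun i ↦ hd n i (by omega)

theorem sub_one_tmul_tensorAction_mem_range (z : A[X] ⊗[A] M) :
    z - 1 ⊗ₜ tensorAction A M z ∈ LinearMap.range (tensorXSub A M) := by
  induction z with
  | zero => simp
  | add x y hx hy =>
    rw [map_add, tmul_add, add_sub_add_comm]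
    exact add_mem hx hy
  | tmul p m =>
    rw [tensorAction_tmul]
    induction p using Polynomial.induction_on generalizing m with
    | C a =>
      convert Submodule.zero_mem _
      rw [sub_eq_zero, ← algebraMap_eq, Algebra.algebraMap_eq_smul_one, smul_assoc, one_smul,
        smul_tmul]
    | add p q hp hq =>
      rw [add_tmul, add_smul, tmul_add, add_sub_add_comm]
      exact add_mem (hp m) (hq m)
    | monomial n a ih =>
      have h := add_mem (LinearMap.mem_range_self (tensorXSub A M) ((C a * X ^ n) ⊗ₜ m))
        (ih ((X : A[X]) • m))
      rw [tensorXSub_tmul, sub_add_sub_cancel, smul_smul, mul_comm (C a * X ^ n) X,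
        show X * (C a * X ^ n) = C a * X ^ (n + 1) by ring] at h
      exact h

theorem exact_tensorXSub_tensorAction :
    Function.Exact (tensorXSub A M) (tensorAction A M) := by
  intro z
  constructor
  · intro hz
    simpa [hz] using sub_one_tmul_tensorAction_mem_range A M z
  · rintro ⟨w, rfl⟩
    induction w with
    | zero => simp
    | add x y hx hy => rw [map_add, map_add, hx, hy, add_zero]
    | tmul p m => simp [smul_smul, mul_comm]

end

/-- Passing from `A` to `A[X]` raises the global dimension by at most one. -/
theorem hasProjectiveDimensionLT_succ {A : Type u} [CommRing A] {n : ℕ}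
    (hA : ∀ M : ModuleCat.{u} A, HasProjectiveDimensionLT M n) (M : ModuleCat.{u} A[X]) :
    HasProjectiveDimensionLT M (n + 1) := by
  let _ : Module A M := Module.compHom M (C : A →+* A[X])
  have : IsScalarTower A A[X] M := ⟨fun a p m ↦ by
    rw [smul_eq_C_mul, mul_smul]; rfl⟩
  have hS := ModuleCat.shortExact_shortComplexOfCompEqZero (tensorXSub_injective A M)
    (exact_tensorXSub_tensorAction A M) (tensorAction_surjective A M)
  have := hA (ModuleCat.of A M)
  have h : HasProjectiveDimensionLT (ModuleCat.of A[X] (A[X] ⊗[A] M)) n :=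
    ModuleCat.hasProjectiveDimensionLT_tensorProduct_of_flat n M
  exact hS.hasProjectiveDimensionLT_X₃ n h (hasProjectiveDimensionLT_of_ge _ n (n + 1) n.le_succ)

end Polynomial

theorem ModuleCat.hasProjectiveDimensionLE_of_ringEquiv {A B : Type u} [CommRing A] [CommRing B]
    (e : A ≃+* B) {n : ℕ} (hA : ∀ M : ModuleCat.{u} A, HasProjectiveDimensionLE M n)
    (M : ModuleCat.{u} B) : HasProjectiveDimensionLE M n := by
  have := RingHomInvPair.of_ringEquiv e
  have := RingHomInvPair.symm (e : A →+* B) (e.symm : B →+* A)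
  have := hA ((ModuleCat.restrictScalars (e : A →+* B)).obj M)
  exact ModuleCat.hasProjectiveDimensionLE_of_semiLinearEquiv e
    (M := (ModuleCat.restrictScalars (e : A →+* B)).obj M) (N := M)
    { AddEquiv.refl M with map_smul' := fun _ _ ↦ rfl } n

/-- **Hilbert's syzygy theorem** -/
theorem MvPolynomial.hasProjectiveDimensionLE {K : Type u} [Field K] (t : ℕ)
    (M : ModuleCat.{u} (MvPolynomial (Fin t) K)) : HasProjectiveDimensionLE M t := by
  induction t with
  | zero =>
    refine ModuleCat.hasProjectiveDimensionLE_of_ringEquiv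
      (MvPolynomial.isEmptyRingEquiv K (Fin 0)).symm (fun M ↦ ?_) M
    exact (projective_iff_hasProjectiveDimensionLE_zero M).1
      ((IsProjective.iff_projective M).1 (Module.Projective.of_free (R := K)))
  | succ t ih =>
    exact ModuleCat.hasProjectiveDimensionLE_of_ringEquiv
      (MvPolynomial.finSuccEquiv K t).symm.toRingEquiv
      (Polynomial.hasProjectiveDimensionLT_succ ih) M

open Polynomial
open scoped Pointwise

theorem Polynomial.eq_zero_of_sum_eval₂_smul_eq_zero {A R M ι : Type*} [CommRing A]
    [CommRing R] [AddCommGroup M] [Module R M] (φ : A →+* R) {x : R}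
    (hx : IsSMulRegular M x) (v : ι → M)
    (hv : ∀ (s : Finset ι) (c : ι → A),
      ∑ i ∈ s, φ (c i) • v i ∈ x • (⊤ : Submodule R M) → ∀ i ∈ s, c i = 0)
    (s : Finset ι) (c : ι → A[X]) (hc : ∑ i ∈ s, (c i).eval₂ φ x • v i = 0) :
    ∀ i ∈ s, c i = 0 := by
  have key (n : ℕ) : ∀ c : ι → A[X], (∀ i ∈ s, (c i).degree < n) →
      ∑ i ∈ s, (c i).eval₂ φ x • v i = 0 → ∀ i ∈ s, c i = 0 := by
    induction n with
    | zero => exact fun c hd _ i hi ↦ by simpa using hd i hi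
    | succ n ih =>
      intro c hd hc
      have h : ∑ i ∈ s, (c i).eval₂ φ x • v i =
          x • ∑ i ∈ s, (c i).divX.eval₂ φ x • v i + ∑ i ∈ s, φ ((c i).coeff 0) • v i := by
        rw [Finset.smul_sum, ← Finset.sum_add_distrib]
        refine Finset.sum_congr rfl fun i _ ↦ ?_
        conv_lhs => rw [← divX_mul_X_add (c i)]
        rw [eval₂_add, eval₂_mul, eval₂_X, eval₂_C, add_smul, smul_smul, mul_comm x]
      rw [hc] at h
      have h0 : ∀ i ∈ s, (c i).coeff 0 = 0 := by
        refine hv s (fun i ↦ (c i).coeff 0) ?_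
        rw [← neg_eq_of_add_eq_zero_right h.symm]
        exact neg_mem (Submodule.smul_mem_pointwise_smul _ x ⊤ trivial)
      have h1 : ∑ i ∈ s, (c i).divX.eval₂ φ x • v i = 0 := by
        refine hx ?_
        rw [Finset.sum_eq_zero (s := s) (f := fun i ↦ φ ((c i).coeff 0) • v i)
          fun i hi ↦ by rw [h0 i hi, map_zero, zero_smul], add_zero] at h
        exact h.symm.trans (smul_zero x).symm
      have h2 := ih (fun i ↦ (c i).divX) (fun i hi ↦ ?_) h1
      · intro i hi
        rw [← divX_mul_X_add (c i), h2 i hi, h0 i hi, zero_mul, map_zero, add_zero]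
      · rw [degree_lt_iff_coeff_zero]
        intro m hm
        rw [coeff_divX]
        exact (degree_lt_iff_coeff_zero _ _).1 (hd i hi) _ (by omega)
  refine key (s.sup fun i ↦ (c i).natDegree + 1) c (fun i hi ↦ ?_) hc
  refine degree_le_natDegree.trans_lt ?_
  exact_mod_cast Finset.le_sup (f := fun i ↦ (c i).natDegree + 1) hi

namespace MvPolynomial

theorem aeval_eq_eval₂_finSuccEquiv {K R : Type*} [CommRing K] [CommRing R] [Algebra K R] {t : ℕ}
    (F : Fin (t + 1) → R) (p : MvPolynomial (Fin (t + 1)) K) :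
    aeval F p = (finSuccEquiv K t p).eval₂
      (aeval (Fin.tail F) : MvPolynomial (Fin t) K →ₐ[K] R).toRingHom (F 0) := by
  induction p using MvPolynomial.induction_on with
  | C a => simp [finSuccEquiv_apply]
  | add p q hp hq => rw [map_add, hp, hq, map_add, Polynomial.eval₂_add]
  | mul_X p i hp =>
    rw [map_mul, hp, map_mul, Polynomial.eval₂_mul, aeval_X]
    refine i.cases ?_ fun j ↦ ?_
    · rw [finSuccEquiv_X_zero, Polynomial.eval₂_X]
    · rw [finSuccEquiv_X_succ, Polynomial.eval₂_C]; simp [Fin.tail]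

theorem eq_zero_of_sum_aeval_smul_eq_zero_s5 {K R M ι : Type*} [CommRing K] [CommRing R]
    [Algebra K R] {t : ℕ} (F : Fin t → R) [AddCommGroup M] [Module R M]
    (hF : RingTheory.Sequence.IsWeaklyRegular M (List.ofFn F)) (v : ι → M)
    (hv : ∀ (s : Finset ι) (c : ι → K), ∑ i ∈ s, algebraMap K R (c i) • v i ∈
      (Ideal.ofList (List.ofFn F) • ⊤ : Submodule R M) → ∀ i ∈ s, c i = 0)
    (s : Finset ι) (c : ι → MvPolynomial (Fin t) K) (hc : ∑ i ∈ s, aeval F (c i) • v i = 0) :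
    ∀ i ∈ s, c i = 0 := by
  induction t generalizing M s with
  | zero =>
    have h (i : ι) : c i = C ((c i).coeff 0) := eq_C_of_isEmpty _
    intro i hi
    rw [h, hv s (fun i ↦ (c i).coeff 0) ?_ i hi, map_zero]
    convert Submodule.zero_mem _
    rw [← hc]
    refine Finset.sum_congr rfl fun i _ ↦ ?_
    conv_rhs => rw [h, aeval_C]
  | succ t ih =>
    rw [List.ofFn_succ, RingTheory.Sequence.isWeaklyRegular_cons_iff] at hF
    have := Polynomial.eq_zero_of_sum_eval₂_smul_eq_zero
      (aeval (Fin.tail F) : MvPolynomial (Fin t) K →ₐ[K] R).toRingHom hF.1 v (fun s c hc ↦ ?_)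
      s (fun i ↦ finSuccEquiv K t (c i)) (by simpa only [aeval_eq_eval₂_finSuccEquiv] using hc)
    · exact fun i hi ↦ (map_eq_zero_iff _ (finSuccEquiv K t).injective).1 (this i hi)
    · refine ih (M := QuotSMulTop (F 0) M) (Fin.tail F) hF.2
        (fun i ↦ Submodule.Quotient.mk (v i)) (fun s c hc ↦ ?_) s c ?_
      · refine hv s c ?_
        rw [List.ofFn_succ, Ideal.ofList_cons_smul]
        have h : (Ideal.ofList (List.ofFn (Fin.tail F)) • ⊤ : Submodule R (QuotSMulTop (F 0) M)) =
            (Ideal.ofList (List.ofFn (Fin.tail F)) • ⊤ : Submodule R M).map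
              ((F 0 • ⊤ : Submodule R M).mkQ) := by
          rw [Submodule.map_smul'', Submodule.map_top, Submodule.range_mkQ]
        rw [h, show (∑ i ∈ s, algebraMap K R (c i) • Submodule.Quotient.mk (v i) :
          QuotSMulTop (F 0) M) = (F 0 • ⊤ : Submodule R M).mkQ
            (∑ i ∈ s, algebraMap K R (c i) • v i) by simp,
          ← Submodule.mem_comap, Submodule.comap_map_mkQ] at hc
        exact hc
      · rw [← Submodule.Quotient.mk_eq_zero] at hc
        rw [← hc, ← Submodule.mkQ_apply, map_sum]
        rfl

end MvPolynomial

namespace MvPolynomial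

theorem homogeneousComponent_mul_of_isHomogeneous_of_le {σ R : Type*} [CommSemiring R] {m n : ℕ}
    (p : MvPolynomial σ R) {q : MvPolynomial σ R} (hq : q.IsHomogeneous m) (h : m ≤ n) :
    homogeneousComponent n (p * q) = homogeneousComponent (n - m) p * q := by
  rw [← decomposition.decompose'_apply, ← decomposition.decompose'_apply]
  let _ := gradedAlgebra (σ := σ) (R := R)
  exact DirectSum.coe_decompose_mul_of_right_mem_of_le (homogeneousSubmodule σ R) hq h

theorem homogeneousComponent_mul_of_isHomogeneous_of_not_le {σ R : Type*} [CommSemiring R]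
    {m n : ℕ} (p : MvPolynomial σ R) {q : MvPolynomial σ R} (hq : q.IsHomogeneous m)
    (h : ¬m ≤ n) : homogeneousComponent n (p * q) = 0 := by
  rw [← decomposition.decompose'_apply]
  let _ := gradedAlgebra (σ := σ) (R := R)
  exact DirectSum.coe_decompose_mul_of_right_mem_of_not_le (homogeneousSubmodule σ R) hq h

theorem span_range_eq_top_of_quotient {σ K ι τ : Type*} [Finite τ] [Field K]
    (F : τ → MvPolynomial σ K) (d : τ → ℕ) (hdeg : ∀ i, (F i).IsHomogeneous (d i))
    (hpos : ∀ i, 0 < d i) [Algebra (MvPolynomial τ K) (MvPolynomial σ K)]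
    (hA : ∀ p, algebraMap (MvPolynomial τ K) (MvPolynomial σ K) p = aeval F p)
    (v : ι → MvPolynomial σ K) (hv : ∀ i, ∃ n, (v i).IsHomogeneous n)
    (hspan : Submodule.span K
      (Set.range fun i ↦ Ideal.Quotient.mkₐ K (Ideal.span (Set.range F)) (v i)) = ⊤) :
    Submodule.span (MvPolynomial τ K) (Set.range v) = ⊤ := by
  have := Fintype.ofFinite τ
  have hle {w} (hw : w ∈ Submodule.span K (Set.range v)) :
      w ∈ Submodule.span (MvPolynomial τ K) (Set.range v) := by
    induction hw using Submodule.span_induction with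
    | mem x hx => exact Submodule.subset_span hx
    | zero => exact zero_mem _
    | add x y _ _ hx hy => exact add_mem hx hy
    | smul a x _ hx =>
      have := Submodule.smul_mem _ (C a : MvPolynomial τ K) hx
      rwa [Algebra.smul_def, hA, aeval_C, algebraMap_eq, ← smul_eq_C_mul] at this
  have hcomp (n : ℕ) {w} (hw : w ∈ Submodule.span K (Set.range v)) :
      homogeneousComponent n w ∈ Submodule.span K (Set.range v) := by
    refine (Submodule.span_le (p := (Submodule.span K (Set.range v)).comap
      (homogeneousComponent n))).2 ?_ hw
    rintro _ ⟨i, rfl⟩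
    obtain ⟨m, hm⟩ := hv i
    rw [SetLike.mem_coe, Submodule.mem_comap, homogeneousComponent_of_mem hm]
    split_ifs
    · exact Submodule.subset_span ⟨i, rfl⟩
    · exact zero_mem _
  have key (n : ℕ) : ∀ f : MvPolynomial σ K, f.IsHomogeneous n →
      f ∈ Submodule.span (MvPolynomial τ K) (Set.range v) := by
    induction n using Nat.strong_induction_on with
    | _ n ih =>
      intro f hf
      obtain ⟨w, hw, hwf⟩ : ∃ w ∈ Submodule.span K (Set.range v),
          f - w ∈ Ideal.span (Set.range F) := by
        have h : Ideal.Quotient.mkₐ K (Ideal.span (Set.range F)) f ∈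
            (Submodule.span K (Set.range v)).map
            (Ideal.Quotient.mkₐ K (Ideal.span (Set.range F))).toLinearMap := by
          rw [Submodule.map_span, ← Set.range_comp]
          exact hspan ▸ trivial
        obtain ⟨w, hw, h⟩ := h
        exact ⟨w, hw, Ideal.Quotient.eq.1 h.symm⟩
      obtain ⟨c, hc⟩ := Ideal.mem_span_range_iff_exists_fun.1 hwf
      have h := congrArg (homogeneousComponent n) (eq_add_of_sub_eq' hc.symm)
      rw [homogeneousComponent_of_mem hf, if_pos rfl, map_add, map_sum] at h
      rw [h]
      refine add_mem (hle (hcomp n hw)) (sum_mem fun i _ ↦ ?_)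
      by_cases hi : d i ≤ n
      · rw [homogeneousComponent_mul_of_isHomogeneous_of_le _ (hdeg i) hi]
        have := Submodule.smul_mem _ (X i : MvPolynomial τ K) (ih (n - d i)
          (Nat.sub_lt ((hpos i).trans_le hi) (hpos i)) _
          (homogeneousComponent_isHomogeneous _ (c i)))
        rwa [Algebra.smul_def, hA, aeval_X, mul_comm] at this
      · rw [homogeneousComponent_mul_of_isHomogeneous_of_not_le _ (hdeg i) hi]
        exact zero_mem _
  refine eq_top_iff.2 fun f _ ↦ ?_
  rw [← sum_homogeneousComponent f]
  exact sum_mem fun n _ ↦ key n _ (homogeneousComponent_isHomogeneous _ f)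

theorem exists_homogeneous_basis_quotient {σ : Type u} {K : Type v} [Field K]
    (I : Ideal (MvPolynomial σ K)) :
    ∃ (ι : Type max u v) (v : ι → MvPolynomial σ K), (∀ i, ∃ n, (v i).IsHomogeneous n) ∧
      LinearIndependent K (fun i ↦ Ideal.Quotient.mkₐ K I (v i)) ∧
      Submodule.span K (Set.range fun i ↦ Ideal.Quotient.mkₐ K I (v i)) = ⊤ := by
  obtain ⟨b, hb, hs, hl⟩ := exists_linearIndependent K
    (Ideal.Quotient.mkₐ K I '' {f | ∃ n, f.IsHomogeneous n})
  choose v hv hvb using fun i : b ↦ hb i.2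
  refine ⟨b, v, hv, by simpa only [hvb] using hl, ?_⟩
  simp only [hvb, Subtype.range_coe_subtype, Set.ofPred_mem_eq]
  rw [hs, eq_top_iff]
  intro x _
  obtain ⟨f, rfl⟩ := Ideal.Quotient.mkₐ_surjective K I x
  rw [← sum_homogeneousComponent f, map_sum]
  exact sum_mem fun n _ ↦ Submodule.subset_span
    ⟨_, ⟨n, homogeneousComponent_isHomogeneous n f⟩, rfl⟩

end MvPolynomial

namespace MvPolynomial

/-- A polynomial ring over a field is free over the subalgebra generated by a regular sequence of
forms of positive degree. -/
theorem free_of_isWeaklyRegular {σ K : Type*} [Field K] {t : ℕ} (F : Fin t → MvPolynomial σ K)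
    (d : Fin t → ℕ) (hdeg : ∀ i, (F i).IsHomogeneous (d i)) (hpos : ∀ i, 0 < d i)
    (hreg : RingTheory.Sequence.IsWeaklyRegular (MvPolynomial σ K) (List.ofFn F))
    [Algebra (MvPolynomial (Fin t) K) (MvPolynomial σ K)]
    (hA : ∀ p, algebraMap (MvPolynomial (Fin t) K) (MvPolynomial σ K) p = aeval F p) :
    Module.Free (MvPolynomial (Fin t) K) (MvPolynomial σ K) := by
  obtain ⟨ι, v, hv, hli, hspan⟩ :=
    exists_homogeneous_basis_quotient (Ideal.span (Set.range F))
  refine Module.Free.of_basis (Module.Basis.mk (v := v) ?_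
    (span_range_eq_top_of_quotient F d hdeg hpos hA v hv hspan).ge)
  refine linearIndependent_iff'.2 fun s c hc ↦
    eq_zero_of_sum_aeval_smul_eq_zero_s5 F hreg v (fun s c hc ↦ ?_) s c ?_
  · refine linearIndependent_iff'.1 hli s c ?_
    rw [smul_eq_mul, Ideal.mul_top, Ideal.ofList,
      show {r | r ∈ List.ofFn F} = Set.range F from Set.ext fun _ ↦ List.mem_ofFn,
      ← Ideal.Quotient.eq_zero_iff_mem] at hc
    rw [← hc, map_sum]
    exact Finset.sum_congr rfl fun i _ ↦ by rw [algebraMap_smul]; rfl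
  · rw [← hc]
    exact Finset.sum_congr rfl fun i _ ↦ by
      rw [smul_eq_mul, ← hA, ← Algebra.smul_def]

end MvPolynomial

theorem projDim_le_of_hasProjectiveDimensionLE {R M : Type u} [CommRing R] [AddCommGroup M]
    [Module R M] (n : ℕ) [HasProjectiveDimensionLE (ModuleCat.of R M) n] : ProjDim R M ≤ n :=
  sInf_le ⟨n, rfl, ProjectiveResolution.exists_isZero_of_hasProjectiveDimensionLE n _⟩

/-- If `F_1,…,F_t` is a regular sequence of forms of positive degree in a polynomial ring `R`
over a field `K` and `J` is an ideal of `R` generated by elements of the subalgebra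
`A = K[F_1,…,F_t]`, then the projective dimension of `R/J` over `R` is at most `t`. -/
theorem projDim_le_of_generators_in_subalgebra
    (K : Type*) [Field K] (N t : ℕ)
    (F : Fin t → MvPolynomial (Fin N) K) (d : Fin t → ℕ)
    (hdeg : ∀ i, (F i).IsHomogeneous (d i)) (hpos : ∀ i, 0 < d i)
    (hreg : RingTheory.Sequence.IsRegular (MvPolynomial (Fin N) K) (List.ofFn F))
    (S : Set (MvPolynomial (Fin N) K))
    (hS : S ⊆ (Algebra.adjoin K (Set.range F) : Subalgebra K (MvPolynomial (Fin N) K)))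
    (J : Ideal (MvPolynomial (Fin N) K)) (hJ : J = Ideal.span S) :
    ProjDim (MvPolynomial (Fin N) K) (MvPolynomial (Fin N) K ⧸ J) ≤ (t : ℕ∞) := by
  let _ : Algebra (MvPolynomial (Fin t) K) (MvPolynomial (Fin N) K) :=
    (MvPolynomial.aeval F).toRingHom.toAlgebra
  have hfree := MvPolynomial.free_of_isWeaklyRegular F d hdeg hpos hreg.toIsWeaklyRegular
    fun _ ↦ rfl
  have hmap : J = (J.comap (algebraMap (MvPolynomial (Fin t) K) (MvPolynomial (Fin N) K))).map
      (algebraMap (MvPolynomial (Fin t) K) (MvPolynomial (Fin N) K)) := by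
    refine le_antisymm ?_ Ideal.map_comap_le
    conv_lhs => rw [hJ]
    refine Ideal.span_le.2 fun x hx ↦ ?_
    have hxF := hS hx
    rw [Algebra.adjoin_range_eq_range_aeval] at hxF
    obtain ⟨p, rfl⟩ := hxF
    exact Ideal.mem_map_of_mem _ (hJ ▸ Ideal.subset_span hx : _ ∈ J)
  generalize J.comap (algebraMap (MvPolynomial (Fin t) K) (MvPolynomial (Fin N) K)) = I at hmap
  have := MvPolynomial.hasProjectiveDimensionLE t
    (ModuleCat.of (MvPolynomial (Fin t) K) (MvPolynomial (Fin t) K ⧸ I))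
  have := ModuleCat.hasProjectiveDimensionLT_tensorProduct_of_flat
    (A := MvPolynomial (Fin t) K) (B := MvPolynomial (Fin N) K) (t + 1) (MvPolynomial (Fin t) K ⧸ I)
  have : HasProjectiveDimensionLE (ModuleCat.of (MvPolynomial (Fin N) K)
      (MvPolynomial (Fin N) K ⧸ J)) t := by
    subst hmap
    exact hasProjectiveDimensionLT_of_iso
      (I.qoutMapEquivTensorQout (MvPolynomial (Fin N) K)).symm.toModuleIso (t + 1)
  exact projDim_le_of_hasProjectiveDimensionLE t
end

section
/- Let K be a field, let g, f_1+g_1, ..., f_h+g_h be forms in the polynomial ring K[u_1,...,u_h, z_1,...,z_t], where f_1,...,f_h ∈ K[u_1,...,u_h] form a regular sequence, g, g_1,...,g_h ∈ K[z_1,...,z_t], and g ≠ 0. Then g, f_1+g_1, ..., f_h+g_h is a regular sequence in K[u's, z's]. -/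
set_option synthInstance.maxHeartbeats 1000000
set_option maxHeartbeats 1000000

namespace MvPolynomial

variable {σ A : Type*} [CommRing A]

lemma IsHomogeneous.homogeneousComponent_mul_add {f : MvPolynomial σ A} {d : ℕ}
    (hf : f.IsHomogeneous d) (n : ℕ) (a : MvPolynomial σ A) :
    homogeneousComponent (n + d) (f * a) = f * homogeneousComponent n a := by
  conv_lhs => rw [← sum_homogeneousComponent a, Finset.mul_sum, map_sum]
  rw [Finset.sum_congr rfl fun i _ => homogeneousComponent_of_mem (m := n + d)
    ((mem_homogeneousSubmodule _ _).2 (hf.mul (homogeneousComponent_isHomogeneous i a)))]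
  simp only [add_comm d, add_left_inj, Finset.sum_ite_eq, Finset.mem_range]
  split_ifs with h
  · rfl
  · rw [homogeneousComponent_eq_zero _ _ (by omega), mul_zero]

lemma IsHomogeneous.homogeneousComponent_mul_of_lt {f : MvPolynomial σ A} {d n : ℕ}
    (hf : f.IsHomogeneous d) (hn : n < d) (a : MvPolynomial σ A) :
    homogeneousComponent n (f * a) = 0 := by
  conv_lhs => rw [← sum_homogeneousComponent a, Finset.mul_sum, map_sum]
  refine Finset.sum_eq_zero fun i _ => ?_
  rw [homogeneousComponent_of_mem
    ((mem_homogeneousSubmodule _ _).2 (hf.mul (homogeneousComponent_isHomogeneous i a))),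
    if_neg (by omega)]

lemma eq_zero_of_homogeneousComponent_eq_zero {a : MvPolynomial σ A}
    (h : ∀ n, homogeneousComponent n a = 0) : a = 0 := by
  rw [← sum_homogeneousComponent a]
  exact Finset.sum_eq_zero fun i _ => h i

lemma IsHomogeneous.constantCoeff_eq_zero {f : MvPolynomial σ A} {d : ℕ}
    (hf : f.IsHomogeneous d) (hd : 0 < d) : constantCoeff f = 0 :=
  hf.coeff_eq_zero (by simpa using hd.ne)

/-- `J` is the ideal of leading forms of elements of `I`. -/
structure IsLeadingFormIdeal (I J : Ideal (MvPolynomial σ A)) : Prop where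
  component_mem : ∀ x ∈ I, ∀ n, (∀ k, n < k → homogeneousComponent k x = 0) →
    homogeneousComponent n x ∈ J
  exists_lift : ∀ a ∈ J, ∀ n, ∃ b ∈ I, (∀ k, n < k → homogeneousComponent k b = 0) ∧
    homogeneousComponent n b = homogeneousComponent n a

lemma isLeadingFormIdeal_bot : IsLeadingFormIdeal (⊥ : Ideal (MvPolynomial σ A)) ⊥ where
  component_mem := by
    rintro x hx n -
    rw [Ideal.mem_bot] at hx
    simp [hx]
  exists_lift := by
    intro a ha n
    exact ⟨0, zero_mem _, by simp, by rw [(Ideal.mem_bot).1 ha]⟩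

section

variable {I J : Ideal (MvPolynomial σ A)} {f : MvPolynomial σ A} {d : ℕ}

lemma IsHomogeneous.homogeneousComponent_add_C_mul (hf : f.IsHomogeneous d) (g : A) (n : ℕ)
    (a : MvPolynomial σ A) : homogeneousComponent (n + d) ((f + C g) * a) =
      f * homogeneousComponent n a + C g * homogeneousComponent (n + d) a := by
  rw [add_mul, map_add, hf.homogeneousComponent_mul_add, homogeneousComponent_C_mul]

lemma IsHomogeneous.homogeneousComponent_add_C_mul_eq_zero (hf : f.IsHomogeneous d) (g : A)
    {n N : ℕ} {a : MvPolynomial σ A} (ha : ∀ k, N ≤ k → homogeneousComponent k a = 0)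
    (hn : N + d ≤ n) : homogeneousComponent n ((f + C g) * a) = 0 := by
  obtain ⟨m, rfl⟩ := Nat.exists_eq_add_of_le' (le_of_add_le_right hn)
  rw [hf.homogeneousComponent_add_C_mul, ha m (by omega), ha _ (by omega)]
  simp

lemma IsLeadingFormIdeal.exists_mem_sub (h : IsLeadingFormIdeal I J) {N : ℕ}
    {a : MvPolynomial σ A} (ha : ∀ k, N + 1 ≤ k → homogeneousComponent k a = 0)
    (haJ : homogeneousComponent N a ∈ J) :
    ∃ b ∈ I, ∀ k, N ≤ k → homogeneousComponent k (a - b) = 0 := by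
  obtain ⟨b, hb, hlt, heq⟩ := h.exists_lift _ haJ N
  rw [homogeneousComponent_eq_self (homogeneousComponent_isHomogeneous N a)] at heq
  refine ⟨b, hb, fun k hk => ?_⟩
  rw [map_sub]
  obtain rfl | hk := hk.eq_or_lt
  · rw [heq, sub_self]
  · rw [ha k hk, hlt k hk, sub_self]

lemma IsLeadingFormIdeal.mem_of_mul_mem (h : IsLeadingFormIdeal I J) (hd : 0 < d)
    (hf : f.IsHomogeneous d) (hreg : ∀ a, f * a ∈ J → a ∈ J) (g : A)
    {a : MvPolynomial σ A} (ha : (f + C g) * a ∈ I) : a ∈ I := by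
  suffices H : ∀ N a, (∀ k, N ≤ k → homogeneousComponent k a = 0) →
      (f + C g) * a ∈ I → a ∈ I from
    H (a.totalDegree + 1) a (fun k hk => homogeneousComponent_eq_zero _ _ (by omega)) ha
  intro N
  induction N with
  | zero =>
    intro a ha _
    rw [eq_zero_of_homogeneousComponent_eq_zero fun n => ha n n.zero_le]
    exact zero_mem _
  | succ N ih =>
    intro a ha haI
    have hJ := h.component_mem _ haI (N + d) fun k hk =>
      hf.homogeneousComponent_add_C_mul_eq_zero g ha (by omega)
    rw [hf.homogeneousComponent_add_C_mul, ha (N + d) (by omega), mul_zero, add_zero] at hJ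
    obtain ⟨b, hb, hab⟩ := h.exists_mem_sub ha (hreg _ hJ)
    have := ih (a - b) hab (by rw [mul_sub]; exact sub_mem haI (I.mul_mem_left _ hb))
    simpa using add_mem this hb

lemma IsLeadingFormIdeal.sup_span (h : IsLeadingFormIdeal I J) (hd : 0 < d)
    (hf : f.IsHomogeneous d) (hreg : ∀ a, f * a ∈ J → a ∈ J) (g : A) :
    IsLeadingFormIdeal (I ⊔ Ideal.span {f + C g}) (J ⊔ Ideal.span {f}) where
  component_mem := by
    intro x hx n hxn
    obtain ⟨y, hy, z, hz, rfl⟩ := Submodule.mem_sup.1 hx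
    obtain ⟨a, rfl⟩ := Ideal.mem_span_singleton'.1 hz
    rw [mul_comm a] at hxn ⊢
    clear hx hz
    suffices H : ∀ N y a, y ∈ I → (∀ k, N ≤ k → homogeneousComponent k a = 0) →
        (∀ k, n < k → homogeneousComponent k (y + (f + C g) * a) = 0) →
        homogeneousComponent n (y + (f + C g) * a) ∈ J ⊔ Ideal.span {f} from
      H (a.totalDegree + 1) y a hy
        (fun k hk => homogeneousComponent_eq_zero _ _ (by omega)) hxn
    intro N
    induction N with
    | zero =>
      intro y a hy ha hx
      rw [eq_zero_of_homogeneousComponent_eq_zero fun n => ha n n.zero_le, mul_zero,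
        add_zero] at hx ⊢
      exact Ideal.mem_sup_left (h.component_mem y hy n hx)
    | succ N ih =>
      intro y a hy ha hx
      by_cases hN : N + d ≤ n
      · rw [map_add]
        refine add_mem (Ideal.mem_sup_left (h.component_mem y hy n fun k hk => ?_)) ?_
        · have := hx k hk
          rwa [map_add, hf.homogeneousComponent_add_C_mul_eq_zero g ha (by omega),
            add_zero] at this
        · obtain ⟨m, rfl⟩ := Nat.exists_eq_add_of_le' (le_of_add_le_right hN)
          rw [hf.homogeneousComponent_add_C_mul, ha (m + d) (by omega), mul_zero, add_zero]
          exact Ideal.mem_sup_right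
            (Ideal.mul_mem_right _ _ (Ideal.mem_span_singleton_self f))
      · have hJ := h.component_mem y hy (N + d) fun k hk => by
          have := hx k (by omega)
          rwa [map_add, hf.homogeneousComponent_add_C_mul_eq_zero g ha (by omega),
            add_zero] at this
        have h0 := hx (N + d) (by omega)
        rw [map_add, hf.homogeneousComponent_add_C_mul, ha (N + d) (by omega), mul_zero,
          add_zero] at h0
        rw [eq_neg_of_add_eq_zero_left h0, neg_mem_iff] at hJ
        obtain ⟨b, hb, hab⟩ := h.exists_mem_sub ha (hreg _ hJ)
        have hsplit : y + (f + C g) * a = (y + (f + C g) * b) + (f + C g) * (a - b) := by ring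
        rw [hsplit] at hx ⊢
        exact ih _ _ (add_mem hy (I.mul_mem_left _ hb)) hab hx
  exists_lift := by
    intro x hx n
    obtain ⟨j, hj, z, hz, rfl⟩ := Submodule.mem_sup.1 hx
    obtain ⟨c, rfl⟩ := Ideal.mem_span_singleton'.1 hz
    rw [mul_comm c]
    obtain ⟨b, hb, hlt, heq⟩ := h.exists_lift j hj n
    obtain hn | hn := lt_or_ge n d
    · exact ⟨b, Ideal.mem_sup_left hb, hlt, by
        rw [map_add, heq, hf.homogeneousComponent_mul_of_lt hn, add_zero]⟩
    · obtain ⟨m, rfl⟩ := Nat.exists_eq_add_of_le' hn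
      have hc : ∀ k, m + 1 ≤ k → homogeneousComponent k (homogeneousComponent m c) = 0 :=
        fun k hk => by
          rw [homogeneousComponent_of_mem (homogeneousComponent_mem m c), if_neg (by omega)]
      refine ⟨b + (f + C g) * homogeneousComponent m c, add_mem (Ideal.mem_sup_left hb)
        (Ideal.mem_sup_right (Ideal.mul_mem_right _ _ (Ideal.mem_span_singleton_self _))),
        fun k hk => ?_, ?_⟩
      · rw [map_add, hlt k hk, hf.homogeneousComponent_add_C_mul_eq_zero g hc (by omega),
          add_zero]
      · rw [map_add, map_add, heq, hf.homogeneousComponent_add_C_mul, hc (m + d) (by omega),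
          mul_zero, add_zero, hf.homogeneousComponent_mul_add,
          homogeneousComponent_eq_self (homogeneousComponent_isHomogeneous m c)]

end

end MvPolynomial

namespace RingTheory.Sequence

open scoped Pointwise in
lemma isWeaklyRegular_quotient_cons_iff {R : Type*} [CommRing R] (I : Ideal R) (r : R)
    (rs : List R) : IsWeaklyRegular (R ⧸ I) (r :: rs) ↔
      (∀ a, r * a ∈ I → a ∈ I) ∧ IsWeaklyRegular (R ⧸ (I ⊔ Ideal.span {r})) rs := by
  rw [isWeaklyRegular_cons_iff, isSMulRegular_quotient_iff_mem_of_smul_mem]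
  refine and_congr Iff.rfl (LinearEquiv.isWeaklyRegular_congr ?_ rs)
  have hmap : r • (⊤ : Submodule R (R ⧸ I)) = Submodule.map I.mkQ (Ideal.span {r}) := by
    rw [← Submodule.ideal_span_singleton_smul, ← Submodule.range_mkQ I, ← Submodule.map_top,
      ← Submodule.map_smul'']
    simp
  exact Submodule.quotEquivOfEq _ _ hmap ≪≫ₗ
    Submodule.quotientQuotientEquivQuotientSup I (Ideal.span {r})

open MvPolynomial in
lemma IsWeaklyRegular.of_forall₂_add_C {σ A : Type*} [CommRing A]
    {I J : Ideal (MvPolynomial σ A)} (h : IsLeadingFormIdeal I J)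
    {fs Fs : List (MvPolynomial σ A)}
    (hF : List.Forall₂ (fun f F => ∃ d g, 0 < d ∧ f.IsHomogeneous d ∧ F = f + C g) fs Fs)
    (hreg : IsWeaklyRegular (MvPolynomial σ A ⧸ J) fs) :
    IsWeaklyRegular (MvPolynomial σ A ⧸ I) Fs := by
  induction hF generalizing I J with
  | nil => simp
  | cons hfF _ ih =>
    obtain ⟨d, g, hd, hf, rfl⟩ := hfF
    rw [isWeaklyRegular_quotient_cons_iff] at hreg ⊢
    exact ⟨fun a => h.mem_of_mul_mem hd hf hreg.1 g, ih (h.sup_span hd hf hreg.1 g) hreg.2⟩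

lemma isWeaklyRegular_quotient_bot_iff {R : Type*} [CommRing R] (rs : List R) :
    IsWeaklyRegular (R ⧸ (⊥ : Ideal R)) rs ↔ IsWeaklyRegular R rs :=
  (Submodule.quotEquivOfEqBot (⊥ : Ideal R) rfl).isWeaklyRegular_congr rs

lemma isWeaklyRegular_quotient_iff_map {R S : Type*} [CommRing R] [CommRing S] {φ : R →+* S}
    (hφ : Function.Surjective φ) {I : Ideal R} (hI : RingHom.ker φ = I) (rs : List R) :
    IsWeaklyRegular (R ⧸ I) rs ↔ IsWeaklyRegular S (rs.map φ) := by
  subst hI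
  refine (RingHom.quotientKerEquivOfSurjective hφ).toAddEquiv.isWeaklyRegular_congr
    (List.forall₂_map_right_iff.2 (List.forall₂_same.2 fun r _ x => ?_))
  obtain ⟨y, rfl⟩ := Ideal.Quotient.mk_surjective x
  exact map_mul φ r y

end RingTheory.Sequence

namespace MvPolynomial

/-- Polynomials in `σ ⊕ τ` viewed as polynomials in `σ`, with the coefficients reduced
modulo `I`. -/
noncomputable def sumToQuotient {K σ τ : Type*} [CommRing K] (I : Ideal (MvPolynomial τ K)) :
    MvPolynomial (σ ⊕ τ) K →+* MvPolynomial σ (MvPolynomial τ K ⧸ I) :=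
  (map (Ideal.Quotient.mk I)).comp (sumAlgEquiv K σ τ).toRingEquiv.toRingHom

section

variable {K σ τ : Type*} [CommRing K]

lemma sumToQuotient_surjective (I : Ideal (MvPolynomial τ K)) :
    Function.Surjective (sumToQuotient (σ := σ) I) :=
  (map_surjective _ Ideal.Quotient.mk_surjective).comp (sumAlgEquiv K σ τ).surjective

lemma sumToQuotient_rename_inl (I : Ideal (MvPolynomial τ K)) (p : MvPolynomial σ K) :
    sumToQuotient I (rename Sum.inl p) =
      map (algebraMap K (MvPolynomial τ K ⧸ I)) p := by
  have := DFunLike.congr_fun (sumAlgEquiv_comp_rename_inl K σ τ) p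
  simp only [AlgHom.comp_apply] at this
  simp only [sumToQuotient, RingHom.comp_apply]
  refine (congrArg _ this).trans ?_
  simp only [mapAlgHom_apply, MvPolynomial.map_map]
  rfl

lemma sumToQuotient_rename_inr (I : Ideal (MvPolynomial τ K)) (p : MvPolynomial τ K) :
    sumToQuotient (σ := σ) I (rename Sum.inr p) = C (Ideal.Quotient.mk I p) := by
  have := DFunLike.congr_fun (sumAlgEquiv_comp_rename_inr K σ τ) p
  simp only [AlgHom.comp_apply] at this
  simp only [sumToQuotient, RingHom.comp_apply]
  refine (congrArg _ this).trans ?_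
  simp

lemma ker_sumToQuotient_span_singleton (g : MvPolynomial τ K) :
    RingHom.ker (sumToQuotient (σ := σ) (Ideal.span {g})) =
      Ideal.span {rename Sum.inr g} := by
  refine le_antisymm (fun x hx => ?_) ?_
  · have hx' : sumAlgEquiv K σ τ x ∈
        RingHom.ker (map (σ := σ) (Ideal.Quotient.mk (Ideal.span {g}))) := hx
    rw [ker_map, Ideal.mk_ker, Ideal.map_span, Set.image_singleton,
      Ideal.mem_span_singleton] at hx'
    have hg : sumAlgEquiv K σ τ (rename Sum.inr g) = C g :=
      DFunLike.congr_fun (sumAlgEquiv_comp_rename_inr K σ τ) g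
    rw [← hg] at hx'
    exact Ideal.mem_span_singleton.2 ((map_dvd_iff (sumAlgEquiv K σ τ)).1 hx')
  · rw [Ideal.span_singleton_le_iff_mem, RingHom.mem_ker, sumToQuotient_rename_inr,
      Ideal.Quotient.eq_zero_iff_mem.2 (Ideal.mem_span_singleton_self g), map_zero]

lemma isWeaklyRegular_rename_inr_cons [IsDomain K] {g : MvPolynomial τ K} (hg : g ≠ 0)
    {s : List (MvPolynomial (σ ⊕ τ) K)}
    (h : RingTheory.Sequence.IsWeaklyRegular (MvPolynomial σ (MvPolynomial τ K ⧸ Ideal.span {g}))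
      (s.map (sumToQuotient (Ideal.span {g})))) :
    RingTheory.Sequence.IsWeaklyRegular (MvPolynomial (σ ⊕ τ) K) (rename Sum.inr g :: s) := by
  rw [← RingTheory.Sequence.isWeaklyRegular_quotient_bot_iff,
    RingTheory.Sequence.isWeaklyRegular_quotient_cons_iff, bot_sup_eq,
    RingTheory.Sequence.isWeaklyRegular_quotient_iff_map
      (S := MvPolynomial σ (MvPolynomial τ K ⧸ Ideal.span {g})) (sumToQuotient_surjective _)
      (ker_sumToQuotient_span_singleton g)]
  refine ⟨fun a ha => ?_, h⟩
  have hne : rename (Sum.inr : τ → σ ⊕ τ) g ≠ 0 :=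
    (map_ne_zero_iff _ (rename_injective _ Sum.inr_injective)).2 hg
  simpa [hne] using ha

end

end MvPolynomial

open MvPolynomial in
lemma RingTheory.Sequence.IsWeaklyRegular.map_mvPolynomial {σ K A : Type*} [Field K]
    [CommRing A] [Algebra K A] {fs : List (MvPolynomial σ K)}
    (h : IsWeaklyRegular (MvPolynomial σ K) fs) :
    IsWeaklyRegular (MvPolynomial σ A) (fs.map (map (algebraMap K A))) :=
  letI := MvPolynomial.algebraMvPolynomial (σ := σ) (R := K) (S := A)
  have : Module.Flat (MvPolynomial σ K) (MvPolynomial σ A) :=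
    Module.Flat.isBaseChange K (MvPolynomial σ K) A (MvPolynomial σ A)
      (Algebra.IsPushout.out (R := K) (S := MvPolynomial σ K) (R' := A))
  h.of_flat

/-- Let `f_1,…,f_h` be a regular sequence of forms in the `u`-variables, let
`g, g_1,…,g_h` be forms in the `z`-variables with `g ≠ 0` (and `deg g_i = deg f_i`).
Then `g, f_1+g_1, …, f_h+g_h` is a regular sequence in `K[u's, z's]`. -/
theorem tail_plus_front_regular_sequence
    (K : Type*) [Field K] (h t : ℕ)
    (f : Fin h → MvPolynomial (Fin h) K) (d : Fin h → ℕ) (hdpos : ∀ i, 0 < d i)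
    (hfdeg : ∀ i, (f i).IsHomogeneous (d i))
    (hfreg : RingTheory.Sequence.IsRegular (MvPolynomial (Fin h) K) (List.ofFn f))
    (g₀ : MvPolynomial (Fin t) K) (e : ℕ) (he : 0 < e) (hg₀deg : g₀.IsHomogeneous e)
    (hg₀ : g₀ ≠ 0)
    (g : Fin h → MvPolynomial (Fin t) K) (hgdeg : ∀ i, (g i).IsHomogeneous (d i)) :
    RingTheory.Sequence.IsRegular (MvPolynomial (Fin h ⊕ Fin t) K)
      (MvPolynomial.rename Sum.inr g₀ ::
        List.ofFn (fun i => MvPolynomial.rename Sum.inl (f i) +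
          MvPolynomial.rename Sum.inr (g i))) := by
  set s : List (MvPolynomial (Fin h ⊕ Fin t) K) := List.ofFn fun i =>
    MvPolynomial.rename Sum.inl (f i) + MvPolynomial.rename Sum.inr (g i) with hs
  refine ⟨?_, fun htop => ?_⟩
  · refine MvPolynomial.isWeaklyRegular_rename_inr_cons hg₀ ?_
    rw [← RingTheory.Sequence.isWeaklyRegular_quotient_bot_iff]
    refine RingTheory.Sequence.IsWeaklyRegular.of_forall₂_add_C
      MvPolynomial.isLeadingFormIdeal_bot ?_
      ((RingTheory.Sequence.isWeaklyRegular_quotient_bot_iff _).2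
        hfreg.toIsWeaklyRegular.map_mvPolynomial)
    rw [hs, List.map_ofFn, List.map_ofFn, List.forall₂_iff_get]
    refine ⟨by simp, fun i hi _ => ?_⟩
    rw [List.length_ofFn] at hi
    refine ⟨d ⟨i, hi⟩, Ideal.Quotient.mk _ (g ⟨i, hi⟩), hdpos _, ?_, ?_⟩
    · simpa using (hfdeg ⟨i, hi⟩).map _
    · simp [MvPolynomial.sumToQuotient_rename_inl, MvPolynomial.sumToQuotient_rename_inr]
  · have hle : Ideal.ofList (MvPolynomial.rename Sum.inr g₀ :: s) ≤
        RingHom.ker (MvPolynomial.constantCoeff (R := K) (σ := Fin h ⊕ Fin t)) := by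
      refine Ideal.span_le.2 fun x hx => ?_
      obtain rfl | hx := List.mem_cons.1 hx
      · simpa using hg₀deg.constantCoeff_eq_zero he
      · obtain ⟨i, rfl⟩ := (List.mem_ofFn' _ _).1 hx
        simp [(hfdeg i).constantCoeff_eq_zero (hdpos i),
          (hgdeg i).constantCoeff_eq_zero (hdpos i)]
    rw [smul_eq_mul, Ideal.mul_top] at htop
    exact RingHom.ker_ne_top _ (top_le_iff.1 (htop.le.trans hle))
end

section
/- Let K be a field and let R = K[x_1,...,x_N]. If I is an ideal of R generated by n ≥ 1 quadratic and linear forms that are contained in a K-subalgebra K[G_1,...,G_t] where G_1,...,G_t is a regular sequence of forms, then the Castelnuovo–Mumford regularity of R/I is bounded by a constant depending only on t (and not on N). -/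
set_option synthInstance.maxHeartbeats 1000000
set_option maxHeartbeats 1000000

/-- `RegLE I r` says that the Castelnuovo–Mumford regularity of `R/I` is at most `r`:
there is a finite graded free resolution `⋯ → F_2 → F_1 → F_0 = R → R/I → 0` in which the
free module `F_{i+1}` is generated in degrees `≤ r + (i+1)` (with `F_0` generated in
degree `0`).  Here `F_{i+1} = ⊕_{j < b i} R(-d i j)`, the map `F_1 → R` has image `I`,
and all maps are given by matrices with homogeneous entries of the appropriate degrees. -/
def RegLE {K : Type*} [Field K] {N : ℕ} (I : Ideal (MvPolynomial (Fin N) K)) (r : ℕ) :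
    Prop :=
  ∃ (p : ℕ) (b : ℕ → ℕ) (d : (i : ℕ) → Fin (b i) → ℕ)
    (φ₀ : (Fin (b 0) →₀ MvPolynomial (Fin N) K) →ₗ[MvPolynomial (Fin N) K]
      MvPolynomial (Fin N) K)
    (φ : (i : ℕ) → (Fin (b (i + 1)) →₀ MvPolynomial (Fin N) K) →ₗ[MvPolynomial (Fin N) K]
      (Fin (b i) →₀ MvPolynomial (Fin N) K)),
    (∀ i j, d i j ≤ r + (i + 1)) ∧
    (∀ i, p ≤ i → b i = 0) ∧
    (∀ j, (φ₀ (Finsupp.single j 1)).IsHomogeneous (d 0 j)) ∧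
    LinearMap.range φ₀ = (I : Submodule (MvPolynomial (Fin N) K) (MvPolynomial (Fin N) K)) ∧
    (∀ i (k : Fin (b (i + 1))) (j : Fin (b i)),
      (φ i) (Finsupp.single k 1) j = 0 ∨
        (d i j ≤ d (i + 1) k ∧
          ((φ i) (Finsupp.single k 1) j).IsHomogeneous (d (i + 1) k - d i j))) ∧
    LinearMap.ker φ₀ = LinearMap.range (φ 0) ∧
    (∀ i, LinearMap.ker (φ i) = LinearMap.range (φ (i + 1)))

namespace GradedResolution

universe u v

/-! ### Graded free resolutions -/



section Basic

variable {A : Type u} [CommRing A] (𝒜 : ℤ → AddSubgroup A)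

/-- The homogeneous vectors of degree `n` in the graded free module `⨁ j, A(-d j)`. -/
def freeGrading {ι : Type} (d : ι → ℕ) (n : ℤ) : AddSubgroup (ι → A) where
  carrier := {v | ∀ j, v j ∈ 𝒜 (n - d j)}
  zero_mem' _ := zero_mem _
  add_mem' hv hw j := add_mem (hv j) (hw j)
  neg_mem' hv j := neg_mem (hv j)

theorem mem_freeGrading {ι : Type} {d : ι → ℕ} {n : ℤ} {v : ι → A} :
    v ∈ freeGrading 𝒜 d n ↔ ∀ j, v j ∈ 𝒜 (n - d j) := Iff.rfl

/-- The grading induced on a submodule. -/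
def inducedGrading {M : Type u} [AddCommGroup M] [Module A M] (ℳ : ℤ → AddSubgroup M)
    (N : Submodule A M) (n : ℤ) : AddSubgroup N :=
  (ℳ n).comap N.subtype.toAddMonoidHom

theorem mem_inducedGrading {M : Type u} [AddCommGroup M] [Module A M] {ℳ : ℤ → AddSubgroup M}
    {N : Submodule A M} {n : ℤ} {x : N} : x ∈ inducedGrading ℳ N n ↔ (x : M) ∈ ℳ n := Iff.rfl

/-- `HasRes 𝒜 D n M ℳ` says that the graded module `M` has a graded resolution of length less
than `n` by finite free modules generated in degrees at most `D`. -/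
def HasRes (D : ℕ) : ℕ → ∀ (M : Type u) [AddCommGroup M] [Module A M],
    (ℤ → AddSubgroup M) → Prop
  | 0, M, _, _, _ => Subsingleton M
  | n + 1, M, _, _, ℳ => ∃ (ι : Type) (_ : Finite ι) (d : ι → ℕ) (φ : (ι → A) →ₗ[A] M),
      (∀ j, d j ≤ D) ∧ (∀ k, ∀ v ∈ freeGrading 𝒜 d k, φ v ∈ ℳ k) ∧
      (∀ x, ∃ v, φ v = x) ∧ (∀ k, ∀ x ∈ ℳ k, ∃ v ∈ freeGrading 𝒜 d k, φ v = x) ∧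
      HasRes D n (LinearMap.ker φ) (inducedGrading (freeGrading 𝒜 d) (LinearMap.ker φ))

variable {𝒜}

theorem HasRes.of_subsingleton {D : ℕ} (n : ℕ) {M : Type u} [AddCommGroup M] [Module A M]
    (ℳ : ℤ → AddSubgroup M) [Subsingleton M] : HasRes 𝒜 D n M ℳ := by
  induction n generalizing M with
  | zero => exact ‹Subsingleton M›
  | succ n ih =>
    refine ⟨Empty, inferInstance, fun j => j.elim, 0, fun j => j.elim, fun k v _ => zero_mem _,
      fun x => ⟨0, Subsingleton.elim _ _⟩,
      fun k x _ => ⟨0, zero_mem _, Subsingleton.elim _ _⟩, ih _⟩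

theorem HasRes.succ {D n : ℕ} {M : Type u} [AddCommGroup M] [Module A M]
    {ℳ : ℤ → AddSubgroup M} (h : HasRes 𝒜 D n M ℳ) : HasRes 𝒜 D (n + 1) M ℳ := by
  induction n generalizing M with
  | zero =>
    have : Subsingleton M := h
    exact .of_subsingleton 1 ℳ
  | succ n ih =>
    obtain ⟨ι, hι, d, φ, h1, h2, h3, h4, h5⟩ := h
    exact ⟨ι, hι, d, φ, h1, h2, h3, h4, ih h5⟩

theorem HasRes.mono {D D' n : ℕ} (hD : D ≤ D') {M : Type u} [AddCommGroup M] [Module A M]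
    {ℳ : ℤ → AddSubgroup M} (h : HasRes 𝒜 D n M ℳ) : HasRes 𝒜 D' n M ℳ := by
  induction n generalizing M with
  | zero => exact h
  | succ n ih =>
    obtain ⟨ι, hι, d, φ, h1, h2, h3, h4, h5⟩ := h
    exact ⟨ι, hι, d, φ, fun j => (h1 j).trans hD, h2, h3, h4, ih h5⟩

theorem HasRes.shift {D n : ℕ} (s : ℕ) {M : Type u} [AddCommGroup M] [Module A M]
    {ℳ : ℤ → AddSubgroup M} (h : HasRes 𝒜 D n M ℳ) :
    HasRes 𝒜 (D + s) n M (fun k => ℳ (k - s)) := by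
  induction n generalizing M with
  | zero => exact h
  | succ n ih =>
    obtain ⟨ι, hι, d, φ, h1, h2, h3, h4, h5⟩ := h
    have key : ∀ k, freeGrading 𝒜 (fun j => d j + s) k = freeGrading 𝒜 d (k - s) := by
      intro k
      ext v
      simp only [mem_freeGrading]
      refine forall_congr' fun j => ?_
      rw [show k - ((d j + s : ℕ) : ℤ) = k - s - d j by push_cast; ring]
    refine ⟨ι, hι, fun j => d j + s, φ, fun j => Nat.add_le_add_right (h1 j) s, ?_, h3, ?_, ?_⟩
    · intro k v hv
      exact h2 _ v (key k ▸ hv)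
    · intro k x hx
      obtain ⟨v, hv, rfl⟩ := h4 _ x hx
      exact ⟨v, key k ▸ hv, rfl⟩
    · have := ih h5
      convert this using 2 with k
      simp only [inducedGrading, key]

/-- Transport of a resolution along a semilinear graded isomorphism. -/
theorem HasRes.of_semilinearEquiv {A' : Type u} [CommRing A'] {𝒜' : ℤ → AddSubgroup A'}
    (σ : A ≃+* A') (hσ : ∀ k a, σ a ∈ 𝒜' k ↔ a ∈ 𝒜 k) {D n : ℕ}
    {M M' : Type u} [AddCommGroup M] [Module A M] [AddCommGroup M'] [Module A' M']
    {ℳ : ℤ → AddSubgroup M} {ℳ' : ℤ → AddSubgroup M'} (e : M ≃+ M')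
    (he : ∀ a m, e (a • m) = σ a • e m) (heg : ∀ k m, e m ∈ ℳ' k ↔ m ∈ ℳ k)
    (h : HasRes 𝒜 D n M ℳ) : HasRes 𝒜' D n M' ℳ' := by
  induction n generalizing M M' with
  | zero =>
    have : Subsingleton M := h
    exact e.symm.injective.subsingleton
  | succ n ih =>
    obtain ⟨ι, hι, d, φ, h1, h2, h3, h4, h5⟩ := h
    let s : (ι → A) ≃+ (ι → A') := AddEquiv.piCongrRight fun _ => σ.toAddEquiv
    have hs : ∀ v j, s v j = σ (v j) := fun v j => rfl
    have hss : ∀ (a : A) v, s (a • v) = σ a • s v := by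
      intro a v; ext j; simp [hs]
    have hs' : ∀ k v, s v ∈ freeGrading 𝒜' d k ↔ v ∈ freeGrading 𝒜 d k := by
      intro k v
      simp only [mem_freeGrading, hs, hσ]
    let φ' : (ι → A') →ₗ[A'] M' :=
      { toFun := fun v => e (φ (s.symm v))
        map_add' := by simp
        map_smul' := by
          intro a v
          obtain ⟨a, rfl⟩ := σ.surjective a
          obtain ⟨v, rfl⟩ := s.surjective v
          rw [← hss, s.symm_apply_apply, s.symm_apply_apply, map_smul, he]
          simp }
    have hφ' : ∀ v, φ' (s v) = e (φ v) := fun v => by simp [φ']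
    refine ⟨ι, hι, d, φ', h1, ?_, ?_, ?_, ?_⟩
    · intro k v hv
      obtain ⟨v, rfl⟩ := s.surjective v
      rw [hφ', heg]
      exact h2 k v ((hs' k v).1 hv)
    · intro x
      obtain ⟨x, rfl⟩ := e.surjective x
      obtain ⟨v, rfl⟩ := h3 x
      exact ⟨s v, hφ' v⟩
    · intro k x hx
      obtain ⟨x, rfl⟩ := e.surjective x
      obtain ⟨v, hv, rfl⟩ := h4 k x ((heg k x).1 hx)
      exact ⟨s v, (hs' k v).2 hv, hφ' v⟩
    · have hk : ∀ v, s v ∈ LinearMap.ker φ' ↔ v ∈ LinearMap.ker φ := by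
        intro v
        rw [LinearMap.mem_ker, LinearMap.mem_ker, hφ']
        simp
      let e' : LinearMap.ker φ ≃+ LinearMap.ker φ' :=
        { toFun := fun v => ⟨s v.1, (hk _).2 v.2⟩
          invFun := fun v => ⟨s.symm v.1, (hk _).1 (by simp)⟩
          left_inv := fun v => by simp
          right_inv := fun v => by simp
          map_add' := fun v w => by ext1; simp }
      exact ih (ℳ := inducedGrading (freeGrading 𝒜 d) (LinearMap.ker φ)) e'
        (fun a m => Subtype.ext (hss a m.1)) (fun k m => hs' k m.1) h5

theorem HasRes.of_linearEquiv {D n : ℕ}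
    {M M' : Type u} [AddCommGroup M] [Module A M] [AddCommGroup M'] [Module A M']
    {ℳ : ℤ → AddSubgroup M} {ℳ' : ℤ → AddSubgroup M'} (e : M ≃ₗ[A] M')
    (heg : ∀ k m, e m ∈ ℳ' k ↔ m ∈ ℳ k)
    (h : HasRes 𝒜 D n M ℳ) : HasRes 𝒜 D n M' ℳ' :=
  h.of_semilinearEquiv (RingEquiv.refl A) (fun _ _ => Iff.rfl) e.toAddEquiv
    (fun a m => e.map_smul a m) heg

/-- Short exact sequences of graded modules that are also exact in every degree. -/
structure IsGradedShortExact {M' M M'' : Type u} [AddCommGroup M'] [Module A M']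
    [AddCommGroup M] [Module A M] [AddCommGroup M''] [Module A M'']
    (ℳ' : ℤ → AddSubgroup M') (ℳ : ℤ → AddSubgroup M) (ℳ'' : ℤ → AddSubgroup M'')
    (f : M' →ₗ[A] M) (g : M →ₗ[A] M'') : Prop where
  inj : Function.Injective f
  comp : ∀ x, g (f x) = 0
  exact : ∀ y, g y = 0 → ∃ x, f x = y
  surj : Function.Surjective g
  f_mem : ∀ k x, f x ∈ ℳ k ↔ x ∈ ℳ' k
  g_mem : ∀ k, ∀ y ∈ ℳ k, g y ∈ ℳ'' k
  surj_mem : ∀ k, ∀ z ∈ ℳ'' k, ∃ y ∈ ℳ k, g y = z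

theorem IsGradedShortExact.hasRes_middle
    (hmul : ∀ i j a b, a ∈ 𝒜 i → b ∈ 𝒜 j → a * b ∈ 𝒜 (i + j)) (hone : 1 ∈ 𝒜 0)
    {D n : ℕ} {M' M M'' : Type u} [AddCommGroup M'] [Module A M']
    [AddCommGroup M] [Module A M] [AddCommGroup M''] [Module A M'']
    {ℳ' : ℤ → AddSubgroup M'} {ℳ : ℤ → AddSubgroup M} {ℳ'' : ℤ → AddSubgroup M''}
    (hsmul : ∀ i j (a : A) (m : M), a ∈ 𝒜 i → m ∈ ℳ j → a • m ∈ ℳ (i + j))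
    {f : M' →ₗ[A] M} {g : M →ₗ[A] M''} (h : IsGradedShortExact ℳ' ℳ ℳ'' f g)
    (h' : HasRes 𝒜 D n M' ℳ') (h'' : HasRes 𝒜 D n M'' ℳ'') : HasRes 𝒜 D n M ℳ := by
  induction n generalizing M' M M'' with
  | zero =>
    have : Subsingleton M' := h'
    have : Subsingleton M'' := h''
    refine ⟨fun a b => ?_⟩
    have key : ∀ y : M, y = 0 := fun y => by
      obtain ⟨x, rfl⟩ := h.exact y (Subsingleton.elim _ _)
      rw [Subsingleton.elim x 0, map_zero]
    rw [key a, key b]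
  | succ n ih =>
    classical
    obtain ⟨ι', _, d', φ', h1', h2', h3', h4', h5'⟩ := h'
    obtain ⟨ι'', _, d'', φ'', h1'', h2'', h3'', h4'', h5''⟩ := h''
    have := Fintype.ofFinite ι''
    have hlift : ∀ j : ι'', ∃ y ∈ ℳ (d'' j), g y = φ'' (Pi.single j 1) := by
      intro j
      refine h.surj_mem _ _ (h2'' _ _ fun i => ?_)
      by_cases hij : i = j
      · subst hij; simpa using hone
      · rw [Pi.single_eq_of_ne hij]; exact zero_mem _
    choose y hy hgy using hlift
    let ψ : (ι'' → A) →ₗ[A] M := Fintype.linearCombination A y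
    have hψ : ∀ v, ψ v = ∑ j, v j • y j := fun v => rfl
    have hgψ : ∀ v, g (ψ v) = φ'' v := by
      intro v
      rw [hψ, map_sum]
      conv_rhs => rw [pi_eq_sum_univ' v]
      simp [hgy, map_sum]
    have hψmem : ∀ k, ∀ v ∈ freeGrading 𝒜 d'' k, ψ v ∈ ℳ k := by
      intro k v hv
      rw [hψ]
      refine sum_mem fun j _ => ?_
      have := hsmul _ _ _ _ (hv j) (hy j)
      rwa [sub_add_cancel] at this
    let φ : (ι' ⊕ ι'' → A) →ₗ[A] M :=
      f ∘ₗ φ' ∘ₗ LinearMap.funLeft A A Sum.inl + ψ ∘ₗ LinearMap.funLeft A A Sum.inr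
    have hφ : ∀ v, φ v = f (φ' (v ∘ Sum.inl)) + ψ (v ∘ Sum.inr) := fun v => rfl
    have hgφ : ∀ v, g (φ v) = φ'' (v ∘ Sum.inr) := by
      intro v
      rw [hφ, map_add, h.comp, zero_add, hgψ]
    refine ⟨ι' ⊕ ι'', inferInstance, Sum.elim d' d'', φ, ?_, ?_, ?_, ?_, ?_⟩
    · rintro (j | j)
      exacts [h1' j, h1'' j]
    · intro k v hv
      exact add_mem ((h.f_mem k _).2 (h2' k _ fun j => hv (Sum.inl j)))
        (hψmem k _ fun j => hv (Sum.inr j))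
    · intro x
      obtain ⟨v'', hv''⟩ := h3'' (g x)
      obtain ⟨x', hx'⟩ := h.exact (x - ψ v'') (by rw [map_sub, hgψ, hv'', sub_self])
      obtain ⟨v', rfl⟩ := h3' x'
      refine ⟨Sum.elim v' v'', ?_⟩
      rw [hφ, Sum.elim_comp_inl, Sum.elim_comp_inr, hx', sub_add_cancel]
    · intro k x hx
      obtain ⟨v'', hvm'', hv''⟩ := h4'' k (g x) (h.g_mem k x hx)
      obtain ⟨x', hx'⟩ := h.exact (x - ψ v'') (by rw [map_sub, hgψ, hv'', sub_self])
      obtain ⟨v', hvm', rfl⟩ := h4' k x' ((h.f_mem k x').1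
        (hx' ▸ sub_mem hx (hψmem k _ hvm'')))
      refine ⟨Sum.elim v' v'', ?_, ?_⟩
      · rintro (j | j)
        exacts [hvm' j, hvm'' j]
      · rw [hφ, Sum.elim_comp_inl, Sum.elim_comp_inr, hx', sub_add_cancel]
    · let f₁ : LinearMap.ker φ' →ₗ[A] LinearMap.ker φ :=
        { toFun := fun v => ⟨Sum.elim v.1 0, by
            rw [LinearMap.mem_ker, hφ, Sum.elim_comp_inl, Sum.elim_comp_inr,
              LinearMap.mem_ker.1 v.2, map_zero, map_zero, add_zero]⟩
          map_add' := fun v w => by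
            ext (j | j) <;> simp
          map_smul' := fun a v => by
            ext (j | j) <;> simp }
      let g₁ : LinearMap.ker φ →ₗ[A] LinearMap.ker φ'' :=
        { toFun := fun v => ⟨v.1 ∘ Sum.inr, by
            rw [LinearMap.mem_ker, ← hgφ, LinearMap.mem_ker.1 v.2, map_zero]⟩
          map_add' := fun v w => rfl
          map_smul' := fun a v => rfl }
      refine ih (f := f₁) (g := g₁) ?_ ?_ h5' h5''
      · intro i j a m ha hm l
        have := hmul _ _ _ _ ha (hm l)
        rw [add_sub_assoc]
        exact this
      · refine ⟨?_, ?_, ?_, ?_, ?_, ?_, ?_⟩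
        · intro v w hvw
          ext j
          exact congrFun (congrArg Subtype.val hvw) (Sum.inl j)
        · intro v
          rfl
        · intro v hv
          have hv2 : v.1 ∘ Sum.inr = 0 := congrArg Subtype.val hv
          have hv0 := LinearMap.mem_ker.1 v.2
          rw [hφ, hv2, map_zero, add_zero] at hv0
          refine ⟨⟨v.1 ∘ Sum.inl, h.inj (by rw [hv0, map_zero])⟩, ?_⟩
          ext (j | j)
          · rfl
          · exact (congrFun hv2 j).symm
        · intro v
          obtain ⟨x', hx'⟩ := h.exact (ψ v.1) (by rw [hgψ, LinearMap.mem_ker.1 v.2])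
          obtain ⟨v', rfl⟩ := h3' x'
          refine ⟨⟨Sum.elim (-v') v.1, ?_⟩, rfl⟩
          rw [LinearMap.mem_ker, hφ, Sum.elim_comp_inl, Sum.elim_comp_inr, map_neg, map_neg, hx',
            neg_add_cancel]
        · intro k v
          refine ⟨fun hv j => hv (Sum.inl j), fun hv j => ?_⟩
          rcases j with j | j
          · exact hv j
          · exact zero_mem _
        · intro k v hv j
          exact hv (Sum.inr j)
        · intro k v hv
          obtain ⟨x', hx'⟩ := h.exact (ψ v.1) (by rw [hgψ, LinearMap.mem_ker.1 v.2])
          obtain ⟨v', hvm', rfl⟩ := h4' k x' ((h.f_mem k x').1 (hx' ▸ hψmem k _ hv))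
          refine ⟨⟨Sum.elim (-v') v.1, ?_⟩, ?_, rfl⟩
          · rw [LinearMap.mem_ker, hφ, Sum.elim_comp_inl, Sum.elim_comp_inr, map_neg, map_neg, hx',
              neg_add_cancel]
          · rintro (j | j)
            · exact neg_mem (hvm' j)
            · exact hv j

theorem IsGradedShortExact.hasRes_right
    (hmul : ∀ i j a b, a ∈ 𝒜 i → b ∈ 𝒜 j → a * b ∈ 𝒜 (i + j)) (hone : 1 ∈ 𝒜 0)
    {D n : ℕ} {M' M M'' : Type u} [AddCommGroup M'] [Module A M']
    [AddCommGroup M] [Module A M] [AddCommGroup M''] [Module A M'']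
    {ℳ' : ℤ → AddSubgroup M'} {ℳ : ℤ → AddSubgroup M} {ℳ'' : ℤ → AddSubgroup M''}
    {f : M' →ₗ[A] M} {g : M →ₗ[A] M''} (h : IsGradedShortExact ℳ' ℳ ℳ'' f g)
    (h' : HasRes 𝒜 D n M' ℳ') (hM : HasRes 𝒜 D n M ℳ) : HasRes 𝒜 D (n + 1) M'' ℳ'' := by
  obtain ⟨ι, hι, d, φ, h1, h2, h3, h4, h5⟩ := hM.succ
  refine ⟨ι, hι, d, g ∘ₗ φ, h1, fun k v hv => h.g_mem k _ (h2 k v hv), ?_, ?_, ?_⟩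
  · intro x
    obtain ⟨y, rfl⟩ := h.surj x
    obtain ⟨v, rfl⟩ := h3 y
    exact ⟨v, rfl⟩
  · intro k x hx
    obtain ⟨y, hy, rfl⟩ := h.surj_mem k x hx
    obtain ⟨v, hv, rfl⟩ := h4 k y hy
    exact ⟨v, hv, rfl⟩
  · have hker : ∀ v : LinearMap.ker (g ∘ₗ φ), ∃ x, f x = φ v.1 := fun v => h.exact _ v.2
    choose q hq using hker
    let f₁ : LinearMap.ker φ →ₗ[A] LinearMap.ker (g ∘ₗ φ) :=
      Submodule.inclusion (LinearMap.ker_le_ker_comp φ g)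
    let g₁ : LinearMap.ker (g ∘ₗ φ) →ₗ[A] M' :=
      { toFun := q
        map_add' := fun v w => h.inj (by simp [hq])
        map_smul' := fun a v => h.inj (by simp [hq]) }
    refine IsGradedShortExact.hasRes_middle hmul hone (f := f₁) (g := g₁) ?_ ?_ h5 h'
    · intro i j a m ha hm l
      have := hmul _ _ _ _ ha (hm l)
      rw [add_sub_assoc]
      exact this
    · refine ⟨Submodule.inclusion_injective _, ?_, ?_, ?_, ?_, ?_, ?_⟩
      · intro v
        refine h.inj ?_
        change f (q _) = _
        rw [hq, map_zero]
        exact v.2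
      · intro v hv
        have : f (q v) = 0 := by rw [show q v = 0 from hv, map_zero]
        rw [hq] at this
        exact ⟨⟨v.1, this⟩, rfl⟩
      · intro x
        obtain ⟨v, hv⟩ := h3 (f x)
        refine ⟨⟨v, ?_⟩, h.inj ?_⟩
        · rw [LinearMap.mem_ker, LinearMap.comp_apply, hv, h.comp]
        · change f (q _) = _
          rw [hq, hv]
      · intro k v
        exact Iff.rfl
      · intro k v hv
        rw [← h.f_mem]
        change f (q _) ∈ _
        rw [hq]
        exact h2 k _ hv
      · intro k x hx
        obtain ⟨v, hvm, hv⟩ := h4 k (f x) ((h.f_mem k x).2 hx)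
        refine ⟨⟨v, ?_⟩, hvm, h.inj ?_⟩
        · rw [LinearMap.mem_ker, LinearMap.comp_apply, hv, h.comp]
        · change f (q _) = _
          rw [hq, hv]

end Basic

/-! ### Adjoining a variable -/

section Polynomial

open Polynomial

variable {A : Type u} [CommRing A] (𝒜 : ℤ → AddSubgroup A) (w : ℕ)

/-- The grading of `A[X]` in which the variable has degree `w`. -/
def polyGrading (n : ℤ) : AddSubgroup A[X] where
  carrier := {p | ∀ i : ℕ, p.coeff i ∈ 𝒜 (n - i * w)}
  zero_mem' i := by simp
  add_mem' hp hq i := by rw [coeff_add]; exact add_mem (hp i) (hq i)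
  neg_mem' hp i := by rw [coeff_neg]; exact neg_mem (hp i)

/-- The grading of `M[X]` in which the variable has degree `w`. -/
def polyModuleGrading {M : Type u} [AddCommGroup M] [Module A M] (ℳ : ℤ → AddSubgroup M) (n : ℤ) :
    AddSubgroup (PolynomialModule A M) where
  carrier := {x | ∀ i : ℕ, x.coeff i ∈ ℳ (n - i * w)}
  zero_mem' i := by simp
  add_mem' hp hq i := by
    rw [PolynomialModule.coeff_add]; exact add_mem (hp i) (hq i)
  neg_mem' {x} hp i := by
    rw [show (-x).coeff = -x.coeff from map_neg PolynomialModule.coeffAddEquiv x]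
    exact neg_mem (hp i)

variable {𝒜 w}

theorem polyGrading_mul (hmul : ∀ i j a b, a ∈ 𝒜 i → b ∈ 𝒜 j → a * b ∈ 𝒜 (i + j))
    (i j : ℤ) (a b : A[X]) (ha : a ∈ polyGrading 𝒜 w i) (hb : b ∈ polyGrading 𝒜 w j) :
    a * b ∈ polyGrading 𝒜 w (i + j) := by
  intro n
  rw [coeff_mul]
  refine sum_mem fun x hx => ?_
  have := hmul _ _ _ _ (ha x.1) (hb x.2)
  rw [Finset.HasAntidiagonal.mem_antidiagonal] at hx
  rw [← hx]
  convert this using 2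
  push_cast
  ring

theorem polyGrading_one (hone : 1 ∈ 𝒜 0) : 1 ∈ polyGrading 𝒜 w 0 := by
  intro n
  rw [coeff_one]
  split_ifs with h
  · subst h
    simpa using hone
  · exact zero_mem _

theorem X_mul_mem_polyGrading {n : ℤ} {p : A[X]} :
    X * p ∈ polyGrading 𝒜 w n ↔ p ∈ polyGrading 𝒜 w (n - w) := by
  constructor
  · intro h i
    have := h (i + 1)
    rw [coeff_X_mul] at this
    convert this using 2
    push_cast
    ring
  · rintro h (_ | i)
    · simp
    · rw [coeff_X_mul]
      have := h i
      convert this using 2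
      push_cast
      ring

theorem HasRes.polynomialModule {D n : ℕ} {M : Type u} [AddCommGroup M] [Module A M]
    {ℳ : ℤ → AddSubgroup M} (h : HasRes 𝒜 D n M ℳ) :
    HasRes (polyGrading 𝒜 w) D n (PolynomialModule A M) (polyModuleGrading w ℳ) := by
  induction n generalizing M with
  | zero =>
    have : Subsingleton M := h
    exact ⟨fun x y => PolynomialModule.ext (Finsupp.ext fun i => Subsingleton.elim _ _)⟩
  | succ n ih =>
    classical
    obtain ⟨ι, _, d, φ, h1, h2, h3, h4, h5⟩ := h
    have := Fintype.ofFinite ι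
    let Φ : (ι → A[X]) →ₗ[A[X]] PolynomialModule A M :=
      Fintype.linearCombination A[X] fun j => PolynomialModule.single A 0 (φ (Pi.single j 1))
    have hΦ : ∀ v i, (Φ v).coeff i = φ fun j => (v j).coeff i := by
      intro v i
      conv_rhs => rw [pi_eq_sum_univ' (fun j => (v j).coeff i)]
      rw [show Φ v = ∑ j, v j • PolynomialModule.single A 0 (φ (Pi.single j 1)) from rfl]
      simp [PolynomialModule.coeff_sum, Finsupp.finsetSum_apply]
    have hsurj : ∀ (x : PolynomialModule A M) (u : ℕ → ι → A), (∀ i, φ (u i) = x.coeff i) →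
        Φ (fun j => ∑ i ∈ x.coeff.support, monomial i (u i j)) = x := by
      intro x u hu
      refine PolynomialModule.ext (Finsupp.ext fun i => ?_)
      rw [hΦ]
      by_cases hi : i ∈ x.coeff.support
      · rw [← hu]
        congr 1
        ext j
        rw [finsetSum_coeff, Finset.sum_eq_single i] <;> simp +contextual [coeff_monomial, hi]
      · rw [Finsupp.notMem_support_iff.1 hi]
        convert map_zero φ
        rw [finsetSum_coeff, Finset.sum_eq_zero]
        · rfl
        · intro a ha
          rw [coeff_monomial, if_neg]
          rintro rfl
          exact hi ha
    refine ⟨ι, inferInstance, d, Φ, h1, ?_, ?_, ?_, ?_⟩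
    · intro k v hv i
      rw [hΦ]
      refine h2 _ _ fun j => ?_
      have := hv j i
      rwa [sub_right_comm] at this
    · intro x
      choose u hu using fun i => h3 (x.coeff i)
      exact ⟨_, hsurj x u hu⟩
    · intro k x hx
      choose u hum hu using fun i => h4 _ (x.coeff i) (hx i)
      refine ⟨_, ?_, hsurj x u hu⟩
      intro j i
      rw [finsetSum_coeff]
      refine sum_mem fun a _ => ?_
      rw [coeff_monomial]
      split_ifs with hai
      · subst hai
        rw [sub_right_comm]
        exact hum a j
      · exact zero_mem _
    · let K := LinearMap.ker φ
      let q : ι → K →ₗ[A] A := fun j => LinearMap.proj j ∘ₗ K.subtype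
      let T : PolynomialModule A K →ₗ[A[X]] (ι → A[X]) :=
        { toFun := fun x j => PolynomialModule.equivPolynomialSelf (PolynomialModule.map A (q j) x)
          map_add' := fun x y => by ext1 j; simp
          map_smul' := fun p x => by
            ext1 j
            rw [PolynomialModule.map_smul]
            simp }
      have hT : ∀ x j i, (T x j).coeff i = (x.coeff i).1 j := fun x j i => rfl
      have hTΦ : ∀ x, Φ (T x) = 0 := by
        intro x
        refine PolynomialModule.ext (Finsupp.ext fun i => ?_)
        rw [hΦ]
        exact (x.coeff i).2
      let T' : PolynomialModule A K →ₗ[A[X]] LinearMap.ker Φ := T.codRestrict _ hTΦ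
      have hbij : Function.Bijective T' := by
        constructor
        · intro x y hxy
          refine PolynomialModule.ext (Finsupp.ext fun i => Subtype.ext (funext fun j => ?_))
          rw [← hT, ← hT]
          exact congrArg (fun z => (z.1 j).coeff i) hxy
        · intro v
          let y : ℕ → K := fun i => ⟨fun j => (v.1 j).coeff i, by
            rw [LinearMap.mem_ker, ← hΦ, LinearMap.mem_ker.1 v.2]; rfl⟩
          refine ⟨PolynomialModule.ofCoeff A (Finsupp.onFinset
            (Finset.univ.biUnion fun j => (v.1 j).support) y ?_), ?_⟩
          · intro i hi
            by_contra hcon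
            refine hi (Subtype.ext (funext fun j => ?_))
            simp only [Finset.mem_biUnion, Finset.mem_univ, true_and, not_exists,
              Polynomial.notMem_support_iff] at hcon
            exact hcon j
          · refine Subtype.ext (funext fun j => Polynomial.ext fun i => ?_)
            change (T _ j).coeff i = _
            rw [hT]
            rfl
      refine HasRes.of_linearEquiv (LinearEquiv.ofBijective T' hbij) ?_ (ih h5)
      intro k x
      change (∀ j i, (T x j).coeff i ∈ _) ↔ ∀ i, ∀ j, _
      rw [forall_comm]
      refine forall_congr' fun i => forall_congr' fun j => ?_
      rw [hT, sub_right_comm]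
      exact Iff.rfl

end Polynomial

section Slices

open Polynomial

variable {A : Type u} [CommRing A]

/-- The elements of degree less than `k` of an ideal of `A[X]`. -/
noncomputable def truncLT (J : Ideal A[X]) (k : ℕ) : Submodule A A[X] where
  carrier := {p | p ∈ J ∧ ∀ i, k ≤ i → p.coeff i = 0}
  zero_mem' := ⟨zero_mem _, fun _ _ => coeff_zero _⟩
  add_mem' hp hq := ⟨add_mem hp.1 hq.1, fun i hi => by
    rw [coeff_add, hp.2 i hi, hq.2 i hi, add_zero]⟩
  smul_mem' a p hp := ⟨by rw [smul_eq_C_mul]; exact J.mul_mem_left _ hp.1, fun i hi => by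
    rw [coeff_smul, hp.2 i hi, smul_zero]⟩

/-- The ideal of coefficients of `X ^ k` of the elements of degree at most `k`. -/
noncomputable def leadSlice (J : Ideal A[X]) (k : ℕ) : Ideal A := (truncLT J (k + 1)).map (lcoeff A k)

theorem mem_leadSlice {J : Ideal A[X]} {k : ℕ} {a : A} :
    a ∈ leadSlice J k ↔ ∃ p ∈ truncLT J (k + 1), p.coeff k = a := Iff.rfl

theorem truncLT_succ (J : Ideal A[X]) (k : ℕ) : truncLT J k ≤ truncLT J (k + 1) :=
  fun _ hp => ⟨hp.1, fun i hi => hp.2 i (by omega)⟩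

theorem mem_truncLT_of_succ {J : Ideal A[X]} {k : ℕ} {p : A[X]} (hp : p ∈ truncLT J (k + 1))
    (h : p.coeff k = 0) : p ∈ truncLT J k :=
  ⟨hp.1, fun i hi => by
    rcases hi.eq_or_lt with rfl | hi
    · exact h
    · exact hp.2 i hi⟩

theorem X_mul_mem_truncLT {J : Ideal A[X]} {k : ℕ} {p : A[X]} (hp : p ∈ truncLT J k) :
    X * p ∈ truncLT J (k + 1) :=
  ⟨J.mul_mem_left _ hp.1, fun i hi => by
    obtain ⟨i, rfl⟩ : ∃ j, i = j + 1 := ⟨i - 1, by omega⟩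
    rw [coeff_X_mul, hp.2 i (by omega)]⟩

theorem polyGrading_smul {𝒜 : ℤ → AddSubgroup A} {w : ℕ}
    (hmul : ∀ i j a b, a ∈ 𝒜 i → b ∈ 𝒜 j → a * b ∈ 𝒜 (i + j))
    (i j : ℤ) (a : A) (p : A[X]) (ha : a ∈ 𝒜 i) (hp : p ∈ polyGrading 𝒜 w j) :
    a • p ∈ polyGrading 𝒜 w (i + j) := by
  intro n
  rw [coeff_smul, add_sub_assoc]
  exact hmul _ _ _ _ ha (hp n)

theorem hasRes_truncLT {𝒜 : ℤ → AddSubgroup A} {w : ℕ}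
    (hmul : ∀ i j a b, a ∈ 𝒜 i → b ∈ 𝒜 j → a * b ∈ 𝒜 (i + j)) (hone : 1 ∈ 𝒜 0)
    {D n : ℕ} (J : Ideal A[X])
    (hJ : ∀ k d, ∀ a ∈ leadSlice J k, a ∈ 𝒜 d →
      ∃ p ∈ truncLT J (k + 1), p ∈ polyGrading 𝒜 w (d + k * w) ∧ p.coeff k = a) (k : ℕ)
    (hL : ∀ i < k, HasRes 𝒜 D n (leadSlice J i) (inducedGrading 𝒜 (leadSlice J i))) :
    HasRes 𝒜 (D + k * w) n (truncLT J k) (inducedGrading (polyGrading 𝒜 w) (truncLT J k)) := by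
  induction k with
  | zero =>
    have : Subsingleton (truncLT J 0) :=
      ⟨fun x y => Subtype.ext (Polynomial.ext fun i => by
        rw [x.2.2 i (Nat.zero_le _), y.2.2 i (Nat.zero_le _)])⟩
    exact .of_subsingleton _ _
  | succ k ih =>
    have h1 := (ih fun i hi => hL i (by omega)).mono
      (show D + k * w ≤ D + (k + 1) * w by rw [add_mul]; omega)
    have h2 := ((hL k (by omega)).shift (k * w)).mono
      (show D + k * w ≤ D + (k + 1) * w by rw [add_mul]; omega)
    refine IsGradedShortExact.hasRes_middle hmul hone ?_
      (f := Submodule.inclusion (truncLT_succ J k))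
      (g := (lcoeff A k).submoduleMap (truncLT J (k + 1))) ?_ h1 h2
    · intro i j a m ha hm
      exact polyGrading_smul hmul i j a m ha hm
    · refine ⟨Submodule.inclusion_injective _, ?_, ?_, LinearMap.submoduleMap_surjective _ _,
        fun k x => Iff.rfl, ?_, ?_⟩
      · intro x
        exact Subtype.ext (x.2.2 k le_rfl)
      · intro y hy
        exact ⟨⟨y, mem_truncLT_of_succ y.2 (congrArg Subtype.val hy)⟩, rfl⟩
      · intro d y hy
        change y.1.coeff k ∈ 𝒜 (d - (k * w : ℕ))
        have := hy k
        push_cast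
        exact this
      · intro d z hz
        obtain ⟨p, hp, hpd, hpz⟩ := hJ k _ z z.2 hz
        refine ⟨⟨p, hp⟩, ?_, Subtype.ext hpz⟩
        change p ∈ polyGrading 𝒜 w d
        convert hpd using 1
        push_cast
        ring_nf

/-- Multiplication by `X` from `J_{<k}` to `J_{<k+1}`. -/
noncomputable def truncMulX (J : Ideal A[X]) (k : ℕ) : truncLT J k →ₗ[A] truncLT J (k + 1) where
  toFun p := ⟨X * p.1, X_mul_mem_truncLT p.2⟩
  map_add' _ _ := Subtype.ext (mul_add _ _ _)
  map_smul' _ _ := Subtype.ext (mul_smul_comm _ _ _)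

/-- The map `X ⊗ m - 1 ⊗ X m` from `J_{<k}[X]` to `J_{<k+1}[X]`. -/
noncomputable def truncSyz (J : Ideal A[X]) (k : ℕ) :
    PolynomialModule A (truncLT J k) →ₗ[A[X]] PolynomialModule A (truncLT J (k + 1)) where
  toFun x := (monomial 1 1 : A[X]) •
    PolynomialModule.map A (Submodule.inclusion (truncLT_succ J k)) x -
    PolynomialModule.map A (truncMulX J k) x
  map_add' x y := by
    simp only [map_add, smul_add]; abel
  map_smul' p x := by
    simp only [PolynomialModule.map_smul, RingHom.id_apply, smul_sub, Algebra.algebraMap_self,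
      Polynomial.map_id]
    rw [smul_comm]

theorem polynomialModule_coeff_sub {M : Type*} [AddCommGroup M] [Module A M]
    (x y : PolynomialModule A M) (n : ℕ) : (x - y).coeff n = x.coeff n - y.coeff n :=
  DFunLike.congr_fun (map_sub PolynomialModule.coeffAddEquiv x y) n

theorem truncSyz_coeff_zero (J : Ideal A[X]) (k : ℕ) (x : PolynomialModule A (truncLT J k)) :
    (((truncSyz J k x).coeff 0 : truncLT J (k + 1)) : A[X]) = -(X * (x.coeff 0 : A[X])) := by
  change (((_ - _ : PolynomialModule A (truncLT J (k + 1))).coeff 0 : truncLT J (k + 1)) : A[X]) = _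
  rw [polynomialModule_coeff_sub, PolynomialModule.monomial_smul_apply, if_neg (by omega),
    zero_sub, Submodule.coe_neg]
  rfl

theorem truncSyz_coeff_succ (J : Ideal A[X]) (k n : ℕ) (x : PolynomialModule A (truncLT J k)) :
    (((truncSyz J k x).coeff (n + 1) : truncLT J (k + 1)) : A[X]) =
      (x.coeff n : A[X]) - X * (x.coeff (n + 1) : A[X]) := by
  change (((_ - _ : PolynomialModule A (truncLT J (k + 1))).coeff (n + 1) :
    truncLT J (k + 1)) : A[X]) = _
  rw [polynomialModule_coeff_sub, PolynomialModule.monomial_smul_apply, if_pos (by omega),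
    one_smul, Submodule.coe_sub]
  rfl

/-- The multiplication map `J_{<k}[X] → A[X]`, as an additive map. -/
noncomputable def truncSum (J : Ideal A[X]) (k : ℕ) : PolynomialModule A (truncLT J k) →+ A[X] :=
  (Finsupp.liftAddHom fun n =>
    (AddMonoidHom.mulLeft (X ^ n : A[X])).comp (truncLT J k).subtype.toAddMonoidHom).comp
    PolynomialModule.coeffAddEquiv.toAddMonoidHom

theorem truncSum_apply (J : Ideal A[X]) (k : ℕ) (x : PolynomialModule A (truncLT J k)) :
    truncSum J k x = x.coeff.sum fun n m => X ^ n * (m : A[X]) := rfl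

theorem truncSum_single (J : Ideal A[X]) (k n : ℕ) (m : truncLT J k) :
    truncSum J k (PolynomialModule.single A n m) = X ^ n * (m : A[X]) := by
  rw [truncSum_apply, PolynomialModule.coeff_single, Finsupp.sum_single_index]
  rw [Submodule.coe_zero, mul_zero]

theorem truncSum_smul (J : Ideal A[X]) (k : ℕ) (p : A[X]) (x : PolynomialModule A (truncLT J k)) :
    truncSum J k (p • x) = p * truncSum J k x := by
  induction x using PolynomialModule.induction_linear with
  | zero => rw [smul_zero, map_zero, mul_zero]
  | add x y hx hy => rw [smul_add, map_add, map_add, hx, hy, mul_add]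
  | single i m =>
    induction p using Polynomial.induction_on' with
    | add p q hp hq => rw [add_smul, map_add, hp, hq, add_mul]
    | monomial j a =>
      rw [PolynomialModule.monomial_smul_single, truncSum_single, truncSum_single,
        Submodule.coe_smul, ← C_mul_X_pow_eq_monomial, smul_eq_C_mul]
      ring

/-- The multiplication map `J_{<k}[X] → J`. -/
noncomputable def truncEval (J : Ideal A[X]) (k : ℕ) :
    PolynomialModule A (truncLT J k) →ₗ[A[X]] J where
  toFun x := ⟨truncSum J k x, sum_mem fun n _ => J.mul_mem_left _ (x.coeff n).2.1⟩
  map_add' x y := Subtype.ext (map_add (truncSum J k) x y)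
  map_smul' p x := Subtype.ext (truncSum_smul J k p x)

theorem truncEval_apply (J : Ideal A[X]) (k : ℕ) (x : PolynomialModule A (truncLT J k)) :
    (truncEval J k x : A[X]) = x.coeff.sum fun n m => X ^ n * (m : A[X]) := rfl

theorem truncEval_single (J : Ideal A[X]) (k n : ℕ) (m : truncLT J k) :
    (truncEval J k (PolynomialModule.single A n m) : A[X]) = X ^ n * (m : A[X]) :=
  truncSum_single J k n m

theorem truncSyz_single (J : Ideal A[X]) (k n : ℕ) (m : truncLT J k) :
    truncSyz J k (PolynomialModule.single A n m) =
      PolynomialModule.single A (n + 1) (Submodule.inclusion (truncLT_succ J k) m) -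
        PolynomialModule.single A n (truncMulX J k m) := by
  change (monomial 1 1 : A[X]) • PolynomialModule.map A _ _ - PolynomialModule.map A _ _ = _
  rw [PolynomialModule.map_single, PolynomialModule.map_single,
    PolynomialModule.monomial_smul_single, one_smul, add_comm 1]

theorem truncEval_truncSyz (J : Ideal A[X]) (k : ℕ) (x : PolynomialModule A (truncLT J k)) :
    truncEval J (k + 1) (truncSyz J k x) = 0 := by
  induction x using PolynomialModule.induction_linear with
  | zero => simp
  | add x y hx hy => rw [map_add, map_add, hx, hy, add_zero]
  | single n m =>
    refine Subtype.ext ?_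
    rw [truncSyz_single, map_sub, Submodule.coe_sub, truncEval_single, truncEval_single]
    change (X : A[X]) ^ (n + 1) * m.1 - X ^ n * (X * m.1) = 0
    ring

theorem truncSyz_injective (J : Ideal A[X]) (k : ℕ) : Function.Injective (truncSyz J k) := by
  rw [injective_iff_map_eq_zero]
  intro x hx
  have hX : ∀ p : A[X], X * p = 0 → p = 0 := fun p hp => by
    ext i
    rw [← coeff_X_mul, hp, coeff_zero, coeff_zero]
  have key : ∀ n, (x.coeff n : A[X]) = 0 := by
    intro n
    induction n with
    | zero =>
      have := truncSyz_coeff_zero J k x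
      rw [hx] at this
      exact hX _ (neg_eq_zero.1 this.symm)
    | succ n ih =>
      have := truncSyz_coeff_succ J k n x
      rw [hx, ih, zero_sub] at this
      exact hX _ (neg_eq_zero.1 this.symm)
  exact PolynomialModule.ext (Finsupp.ext fun n => Subtype.ext (key n))

theorem exists_truncSyz_eq (J : Ideal A[X]) (k : ℕ) (y : PolynomialModule A (truncLT J (k + 1)))
    (hy : truncEval J (k + 1) y = 0) : ∃ x, truncSyz J k x = y := by
  obtain ⟨N, hN⟩ : ∃ N, ∀ n, N ≤ n → y.coeff n = 0 := by
    obtain ⟨N, hN⟩ := y.coeff.support.bddAbove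
    refine ⟨N + 1, fun n hn => ?_⟩
    by_contra h
    have := hN (Finsupp.mem_support_iff.2 h)
    omega
  induction N generalizing y with
  | zero => exact ⟨0, by
      rw [map_zero]
      exact (PolynomialModule.ext (Finsupp.ext fun n => hN n (Nat.zero_le _))).symm⟩
  | succ N ih =>
    have hsum : ∑ n ∈ Finset.range (N + 1), X ^ n * (y.coeff n : A[X]) = 0 := by
      rw [← show (truncEval J (k + 1) y : A[X]) = 0 from congrArg Subtype.val hy, truncEval_apply]
      symm
      refine Finset.sum_subset ?_ ?_
      · intro n hn
        rw [Finset.mem_range]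
        by_contra h
        exact Finsupp.mem_support_iff.1 hn (hN n (by omega))
      · intro n _ hn
        rw [Finsupp.notMem_support_iff.1 hn]
        exact mul_zero _
    have htop : (y.coeff N : A[X]).coeff k = 0 := by
      have h := congrArg (fun p => p.coeff (N + k)) hsum
      simp only [finsetSum_coeff, coeff_zero] at h
      rw [Finset.sum_range_succ, Finset.sum_eq_zero, zero_add, add_comm N k, coeff_X_pow_mul] at h
      · exact h
      · intro n hn
        rw [Finset.mem_range] at hn
        rw [show N + k = (N + k - n) + n by omega, coeff_X_pow_mul]
        exact (y.coeff n).2.2 _ (by omega)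
    let m : truncLT J k := ⟨y.coeff N, mem_truncLT_of_succ (y.coeff N).2 htop⟩
    rcases N with _ | N
    · refine ⟨0, ?_⟩
      rw [map_zero]
      refine (PolynomialModule.ext (Finsupp.ext fun n => ?_)).symm
      rcases n with _ | n
      · refine Subtype.ext ?_
        simpa using hsum
      · exact hN _ (by omega)
    · have hlt : ∀ n, N + 1 ≤ n →
          (y - truncSyz J k (PolynomialModule.single A N m)).coeff n = 0 := by
        intro n hn
        rw [polynomialModule_coeff_sub, truncSyz_single, polynomialModule_coeff_sub,
          PolynomialModule.coeff_single, PolynomialModule.coeff_single,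
          Finsupp.single_eq_of_ne (a := N) (by omega), sub_zero]
        rcases hn.eq_or_lt with rfl | hn
        · rw [Finsupp.single_eq_same]
          exact sub_self _
        · rw [Finsupp.single_eq_of_ne (by omega), hN n hn, sub_zero]
      obtain ⟨x, hx⟩ := ih (y - truncSyz J k (PolynomialModule.single A N m))
        (by rw [map_sub, hy, truncEval_truncSyz, sub_zero]) hlt
      exact ⟨x + PolynomialModule.single A N m, by rw [map_add, hx, sub_add_cancel]⟩

theorem exists_truncEval_eq {𝒜 : ℤ → AddSubgroup A} {w : ℕ} (J : Ideal A[X])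
    (hJ : ∀ k d, ∀ a ∈ leadSlice J k, a ∈ 𝒜 d →
      ∃ p ∈ truncLT J (k + 1), p ∈ polyGrading 𝒜 w (d + k * w) ∧ p.coeff k = a) (k : ℕ)
    (hk : ∀ i, k ≤ i → leadSlice J i ≤ leadSlice J k) (d : ℤ) (N : ℕ) (p : A[X])
    (hp : p ∈ truncLT J N) (hpd : p ∈ polyGrading 𝒜 w d) :
    ∃ y ∈ polyModuleGrading w (inducedGrading (polyGrading 𝒜 w) (truncLT J (k + 1))) d,
      (truncEval J (k + 1) y : A[X]) = p := by
  induction N generalizing p with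
  | zero =>
    refine ⟨0, zero_mem _, ?_⟩
    rw [map_zero]
    exact Polynomial.ext fun i => (hp.2 i (Nat.zero_le _)).symm
  | succ N ih =>
    have hmem : ∀ (n : ℕ) (m : truncLT J (k + 1)), (m : A[X]) ∈ polyGrading 𝒜 w (d - n * w) →
        PolynomialModule.single A n m ∈
          polyModuleGrading w (inducedGrading (polyGrading 𝒜 w) (truncLT J (k + 1))) d := by
      intro n m hm i
      rw [PolynomialModule.coeff_single]
      by_cases h : n = i
      · subst h
        rw [Finsupp.single_eq_same]
        exact hm
      · rw [Finsupp.single_eq_of_ne (Ne.symm h)]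
        exact zero_mem _
    by_cases hN : N ≤ k
    · refine ⟨PolynomialModule.single A 0 ⟨p, hp.1, fun i hi => hp.2 i (by omega)⟩, ?_, ?_⟩
      · exact hmem _ _ (by simpa using hpd)
      · rw [truncEval_single, pow_zero, one_mul]
    · obtain ⟨j, rfl⟩ : ∃ j, N = k + j := ⟨N - k, by omega⟩
      obtain ⟨q, hq, hqd, hqa⟩ := hJ k (d - (k + j : ℕ) * w) (p.coeff (k + j))
        (hk (k + j) (by omega) ⟨p, hp, rfl⟩) (hpd _)
      have hqd' : q ∈ polyGrading 𝒜 w (d - j * w) := by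
        convert hqd using 1
        push_cast
        ring_nf
      have hXq : X ^ j * q ∈ polyGrading 𝒜 w d := by
        intro i
        rw [coeff_X_pow_mul']
        split_ifs with h
        · have := hqd' (i - j)
          convert this using 2
          push_cast [h]
          ring
        · exact zero_mem _
      have hlt : p - X ^ j * q ∈ truncLT J (k + j) := by
        refine ⟨J.sub_mem hp.1 (J.mul_mem_left _ hq.1), fun i hi => ?_⟩
        obtain ⟨l, rfl⟩ : ∃ l, i = l + j := ⟨i - j, by omega⟩
        rw [coeff_sub, coeff_X_pow_mul]
        rcases (show k ≤ l by omega).eq_or_lt with rfl | h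
        · rw [hqa, sub_self]
        · rw [hp.2 _ (by omega), hq.2 _ (by omega), sub_zero]
      obtain ⟨y, hy, hyp⟩ := ih (p - X ^ j * q) hlt (sub_mem hpd hXq)
      refine ⟨y + PolynomialModule.single A j ⟨q, hq⟩, add_mem hy (hmem _ _ hqd'), ?_⟩
      rw [map_add, Submodule.coe_add, hyp, truncEval_single, sub_add_cancel]

theorem hasRes_ideal_polynomial {𝒜 : ℤ → AddSubgroup A} {w : ℕ}
    (hmul : ∀ i j a b, a ∈ 𝒜 i → b ∈ 𝒜 j → a * b ∈ 𝒜 (i + j)) (hone : 1 ∈ 𝒜 0)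
    {D n : ℕ} (J : Ideal A[X])
    (hJ : ∀ k d, ∀ a ∈ leadSlice J k, a ∈ 𝒜 d →
      ∃ p ∈ truncLT J (k + 1), p ∈ polyGrading 𝒜 w (d + k * w) ∧ p.coeff k = a) (k : ℕ)
    (hk : ∀ i, k ≤ i → leadSlice J i ≤ leadSlice J k)
    (hL : ∀ i, HasRes 𝒜 D n (leadSlice J i) (inducedGrading 𝒜 (leadSlice J i))) :
    HasRes (polyGrading 𝒜 w) (D + (k + 1) * w) (n + 1) J
      (inducedGrading (polyGrading 𝒜 w) J) := by
  have h1 := (((hasRes_truncLT hmul hone J hJ k fun i _ => hL i).polynomialModule (w := w)).shift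
    w).mono (show D + k * w + w ≤ D + (k + 1) * w by rw [add_mul]; omega)
  have h2 := (hasRes_truncLT hmul hone J hJ (k + 1) fun i _ => hL i).polynomialModule (w := w)
  have hfin : ∀ p ∈ J, ∃ N, p ∈ truncLT J N := fun p hp =>
    ⟨p.natDegree + 1, hp, fun i hi => coeff_eq_zero_of_natDegree_lt (by omega)⟩
  refine IsGradedShortExact.hasRes_right (polyGrading_mul hmul) (polyGrading_one hone)
    (f := truncSyz J k) (g := truncEval J (k + 1)) ?_ h1 h2
  refine ⟨truncSyz_injective J k, truncEval_truncSyz J k, exists_truncSyz_eq J k, ?_, ?_, ?_, ?_⟩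
  · intro p
    obtain ⟨N, hN⟩ := hfin p p.2
    obtain ⟨y, -, hy⟩ := exists_truncEval_eq (𝒜 := fun _ => ⊤) (w := w) J
      (fun k d a ha _ => by
        obtain ⟨p, hp, hpa⟩ := ha
        exact ⟨p, hp, fun _ => trivial, hpa⟩) k hk 0 N p hN (fun _ => trivial)
    exact ⟨y, Subtype.ext hy⟩
  · intro d x
    constructor
    · intro h
      have key : ∀ n : ℕ, (x.coeff n : A[X]) ∈ polyGrading 𝒜 w (d - w - n * w) := by
        intro n
        induction n with
        | zero =>
          have := h 0
          rw [mem_inducedGrading, truncSyz_coeff_zero, neg_mem_iff, X_mul_mem_polyGrading] at this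
          simpa using this
        | succ n ih =>
          have := h (n + 1)
          rw [mem_inducedGrading, truncSyz_coeff_succ] at this
          have h2 : (x.coeff n : A[X]) ∈ polyGrading 𝒜 w (d - (n + 1 : ℕ) * w) := by
            convert ih using 1
            push_cast
            ring_nf
          have h3 := sub_mem h2 this
          rw [sub_sub_cancel, X_mul_mem_polyGrading] at h3
          rwa [sub_right_comm]
      exact key
    · rintro h (_ | n)
      · rw [mem_inducedGrading, truncSyz_coeff_zero, neg_mem_iff, X_mul_mem_polyGrading]
        rw [← mem_inducedGrading]
        simpa using h 0
      · rw [mem_inducedGrading, truncSyz_coeff_succ]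
        refine sub_mem ?_ ?_
        · have := h n
          rw [mem_inducedGrading] at this
          convert this using 1
          push_cast
          ring_nf
        · rw [X_mul_mem_polyGrading, sub_right_comm]
          exact h (n + 1)
  · intro d y hy
    rw [mem_inducedGrading, truncEval_apply]
    refine sum_mem fun n _ i => ?_
    rw [coeff_X_pow_mul']
    split_ifs with h
    · have : (y.coeff n : A[X]).coeff (i - n) ∈ 𝒜 _ := hy n (i - n)
      convert this using 2
      push_cast [h]
      ring
    · exact zero_mem _
  · intro d p hp
    obtain ⟨N, hN⟩ := hfin p p.2
    obtain ⟨y, hy, hyp⟩ := exists_truncEval_eq J hJ k hk d N p hN hp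
    exact ⟨y, hy, Subtype.ext hyp⟩

end Slices

section Groebner

open MvPolynomial MonomialOrder

variable {σ K : Type*} [Field K] (m : MonomialOrder σ) (w : σ → ℕ)

/-- The nonzero weighted homogeneous elements of weight at most `d` in `J`. -/
def homogeneousBelow (J : Ideal (MvPolynomial σ K)) (d : ℕ) : Set (MvPolynomial σ K) :=
  {q | q ∈ J ∧ q ≠ 0 ∧ ∃ n ≤ d, IsWeightedHomogeneous w q n}

/-- The span of the monomial multiples of elements of `G` with leading exponent in `s`. -/
noncomputable def multiplesSpan (G : Set (MvPolynomial σ K)) (s : Set m.syn) :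
    Submodule K (MvPolynomial σ K) :=
  Submodule.span K {f | ∃ a, ∃ q ∈ G, m.toSyn (a + m.degree q) ∈ s ∧ f = monomial a 1 * q}

variable {m w}

theorem weight_degree_of_isWeightedHomogeneous {q : MvPolynomial σ K} (hq : q ≠ 0) {n : ℕ}
    (h : IsWeightedHomogeneous w q n) : Finsupp.weight w (m.degree q) = n :=
  h (m.coeff_degree_ne_zero_iff.2 hq)

theorem multiplesSpan_mono (G : Set (MvPolynomial σ K)) {s s' : Set m.syn} (h : s ⊆ s') :
    multiplesSpan m G s ≤ multiplesSpan m G s' :=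
  Submodule.span_mono fun _ ⟨a, q, hq, ha, hf⟩ => ⟨a, q, hq, h ha, hf⟩

theorem coeff_eq_zero_of_mem_multiplesSpan {G : Set (MvPolynomial σ K)} {s : Set m.syn}
    {f : MvPolynomial σ K} (hf : f ∈ multiplesSpan m G s) {c : σ →₀ ℕ}
    (hc : ∀ ν ∈ s, ν < m.toSyn c) : coeff c f = 0 := by
  induction hf using Submodule.span_induction with
  | mem f h =>
    obtain ⟨a, q, hq, ha, rfl⟩ := h
    refine m.coeff_eq_zero_of_lt (lt_of_le_of_lt ?_ (hc _ ha))
    refine (m.degree_mul_le).trans ?_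
    rw [map_add, map_add]
    gcongr
    exact m.degree_monomial_le 1
  | zero => rw [coeff_zero]
  | add f g _ _ hf hg => rw [coeff_add, hf, hg, add_zero]
  | smul r f _ hf => rw [coeff_smul, hf, smul_zero]

theorem monomial_eq_smul_monomial_one (a : σ →₀ ℕ) (c : K) :
    monomial a c = c • monomial a 1 := by
  rw [smul_monomial, smul_eq_mul, mul_one]

theorem monomial_mul_mem_multiplesSpan {G : Set (MvPolynomial σ K)} {s s' : Set m.syn}
    {f : MvPolynomial σ K} (hf : f ∈ multiplesSpan m G s) (b : σ →₀ ℕ) (c : K)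
    (h : ∀ ν ∈ s, m.toSyn b + ν ∈ s') : monomial b c * f ∈ multiplesSpan m G s' := by
  induction hf using Submodule.span_induction with
  | mem f hf =>
    obtain ⟨a, q, hq, ha, rfl⟩ := hf
    rw [← mul_assoc, monomial_mul, mul_one, monomial_eq_smul_monomial_one, smul_mul_assoc]
    refine Submodule.smul_mem _ _ (Submodule.subset_span ⟨b + a, q, hq, ?_, rfl⟩)
    rw [add_assoc, map_add]
    exact h _ ha
  | zero => rw [mul_zero]; exact zero_mem _
  | add f g _ _ hf hg => rw [mul_add]; exact add_mem hf hg
  | smul r f _ hf => rw [mul_smul_comm]; exact Submodule.smul_mem _ _ hf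

theorem exists_mem_Iic_of_mem_Iio {G : Set (MvPolynomial σ K)} {μ : m.syn}
    {f : MvPolynomial σ K} (hf : f ∈ multiplesSpan m G (Set.Iio μ)) (h0 : f ≠ 0) :
    ∃ ν < μ, f ∈ multiplesSpan m G (Set.Iic ν) := by
  suffices f = 0 ∨ ∃ ν < μ, f ∈ multiplesSpan m G (Set.Iic ν) from this.resolve_left h0
  clear h0
  induction hf using Submodule.span_induction with
  | mem f h =>
    obtain ⟨a, q, hq, ha, rfl⟩ := h
    exact Or.inr ⟨_, ha, Submodule.subset_span ⟨a, q, hq, le_rfl, rfl⟩⟩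
  | zero => exact Or.inl rfl
  | add f g _ _ hf hg =>
    rcases hf with rfl | ⟨ν, hν, hf⟩
    · rwa [zero_add]
    rcases hg with rfl | ⟨ν', hν', hg⟩
    · rw [add_zero]; exact Or.inr ⟨ν, hν, hf⟩
    exact Or.inr ⟨max ν ν', max_lt hν hν', add_mem
      (multiplesSpan_mono G (Set.Iic_subset_Iic.2 (le_max_left _ _)) hf)
      (multiplesSpan_mono G (Set.Iic_subset_Iic.2 (le_max_right _ _)) hg)⟩
  | smul r f _ hf =>
    rcases hf with rfl | ⟨ν, hν, hf⟩
    · exact Or.inl (smul_zero _)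
    · exact Or.inr ⟨ν, hν, Submodule.smul_mem _ _ hf⟩

theorem exists_mem_multiplesSpan_Iic {G : Set (MvPolynomial σ K)} {f : MvPolynomial σ K}
    (hf : f ∈ Ideal.span G) : ∃ μ, f ∈ multiplesSpan m G (Set.Iic μ) := by
  have hadd : ∀ f g, (∃ μ, f ∈ multiplesSpan m G (Set.Iic μ)) →
      (∃ μ, g ∈ multiplesSpan m G (Set.Iic μ)) →
      ∃ μ, f + g ∈ multiplesSpan m G (Set.Iic μ) := by
    rintro f g ⟨ν, hf⟩ ⟨ν', hg⟩
    exact ⟨max ν ν', add_mem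
      (multiplesSpan_mono G (Set.Iic_subset_Iic.2 (le_max_left _ _)) hf)
      (multiplesSpan_mono G (Set.Iic_subset_Iic.2 (le_max_right _ _)) hg)⟩
  induction hf using Submodule.span_induction with
  | mem f h =>
    refine ⟨m.toSyn (m.degree f), Submodule.subset_span ⟨0, f, h, ?_, ?_⟩⟩
    · rw [zero_add]; exact le_rfl
    · rw [← C_apply, C_1, one_mul]
  | zero => exact ⟨0, zero_mem _⟩
  | add f g _ _ hf hg => exact hadd f g hf hg
  | smul r f _ hf =>
    obtain ⟨μ, hf⟩ := hf
    rw [smul_eq_mul]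
    induction r using MvPolynomial.induction_on' with
    | monomial u a =>
      exact ⟨m.toSyn u + μ, monomial_mul_mem_multiplesSpan hf u a fun ν hν => by
        rw [Set.mem_Iic] at hν ⊢; gcongr⟩
    | add p q hp hq => rw [add_mul]; exact hadd _ _ hp hq

theorem degree_lt_of_coeff_eq_zero {f : MvPolynomial σ K} (hf : f ≠ 0) {μ : σ →₀ ℕ}
    (h : m.degree f ≼[m] μ) (h0 : coeff μ f = 0) : m.degree f ≺[m] μ := by
  refine lt_of_le_of_ne h fun h' => ?_
  rw [← m.toSyn.injective h'] at h0
  exact hf (m.coeff_degree_eq_zero_iff.1 h0)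

/-- If the leading exponents of elements of weight at most `2 d` are reached in weight at most
`d`, then homogeneous elements of weight at most `2 d` have standard representations. -/
theorem mem_multiplesSpan_of_isWeightedHomogeneous {J : Ideal (MvPolynomial σ K)} {d : ℕ}
    (hJ : ∀ p ∈ homogeneousBelow w J (2 * d), ∃ q ∈ homogeneousBelow w J d,
      m.degree q ≤ m.degree p) {p : MvPolynomial σ K} (hp : p ∈ homogeneousBelow w J (2 * d)) :
    p ∈ multiplesSpan m (homogeneousBelow w J d) (Set.Iic (m.toSyn (m.degree p))) := by
  induction hμ : m.toSyn (m.degree p) using WellFoundedLT.induction generalizing p with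
  | ind μ ih =>
  subst hμ
  obtain ⟨q, hq, hqp⟩ := hJ p hp
  obtain ⟨hpJ, hp0, n, hn, hph⟩ := hp
  have hq' := hq
  obtain ⟨hqJ, hq0, n', hn', hqh⟩ := hq'
  set a := m.degree p - m.degree q with ha
  have hadd : a + m.degree q = m.degree p := tsub_add_cancel_of_le hqp
  set c := m.leadingCoeff p * (m.leadingCoeff q)⁻¹ with hc
  have hlq : m.leadingCoeff q ≠ 0 := m.leadingCoeff_ne_zero_iff.2 hq0
  have hmem : monomial a c * q ∈ multiplesSpan m (homogeneousBelow w J d)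
      (Set.Iic (m.toSyn (m.degree p))) := by
    rw [monomial_eq_smul_monomial_one, smul_mul_assoc]
    exact Submodule.smul_mem _ _ (Submodule.subset_span ⟨a, q, hq, by rw [hadd]; exact le_rfl, rfl⟩)
  by_cases h0 : p - monomial a c * q = 0
  · rwa [← sub_eq_zero.1 h0] at hmem
  have hh : IsWeightedHomogeneous w (p - monomial a c * q) n := by
    refine hph.sub ?_
    have := (isWeightedHomogeneous_monomial w a c rfl).mul hqh
    rwa [← weight_degree_of_isWeightedHomogeneous (m := m) hq0 hqh, ← map_add, hadd,
      weight_degree_of_isWeightedHomogeneous hp0 hph] at this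
  have hlt : m.degree (p - monomial a c * q) ≺[m] m.degree p := by
    refine degree_lt_of_coeff_eq_zero h0 (m.degree_sub_le.trans (sup_le le_rfl ?_)) ?_
    · refine m.degree_mul_le.trans ?_
      rw [← hadd, map_add, map_add]
      gcongr
      exact m.degree_monomial_le c
    · rw [coeff_sub, ← hadd, coeff_monomial_mul, hadd, hc]
      change m.leadingCoeff p - _ * m.leadingCoeff q = 0
      field_simp
      ring
  have := ih _ hlt ⟨J.sub_mem hpJ (J.mul_mem_left _ hqJ), h0, n, hn, hh⟩ rfl
  have h2 := add_mem (multiplesSpan_mono _ (Set.Iic_subset_Iic.2 hlt.le) this) hmem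
  rwa [sub_add_cancel] at h2

/-- The `S`-polynomial computation: two multiples with the same leading exponent agree up to
scalars and terms with smaller leading exponent. -/
theorem monomial_mul_sub_mem {J : Ideal (MvPolynomial σ K)} {d : ℕ}
    (hJ : ∀ p ∈ homogeneousBelow w J (2 * d), ∃ q ∈ homogeneousBelow w J d,
      m.degree q ≤ m.degree p) {q q' : MvPolynomial σ K} (hq : q ∈ homogeneousBelow w J d)
    (hq' : q' ∈ homogeneousBelow w J d) {a a' : σ →₀ ℕ} (h : a + m.degree q = a' + m.degree q') :
    monomial a (m.leadingCoeff q') * q - monomial a' (m.leadingCoeff q) * q' ∈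
      multiplesSpan m (homogeneousBelow w J d) (Set.Iio (m.toSyn (a + m.degree q))) := by
  have hle : m.degree q ⊔ m.degree q' ≤ a + m.degree q :=
    sup_le le_add_self (h ▸ le_add_self)
  obtain ⟨b, hb⟩ := exists_add_of_le hle
  have h1 : a = b + (m.degree q ⊔ m.degree q' - m.degree q) := by
    refine add_right_cancel (b := m.degree q) ?_
    rw [add_assoc, tsub_add_cancel_of_le le_sup_left, hb, add_comm]
  have h2 : a' = b + (m.degree q ⊔ m.degree q' - m.degree q') := by
    refine add_right_cancel (b := m.degree q') ?_
    rw [add_assoc, tsub_add_cancel_of_le le_sup_right, ← h, hb, add_comm]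
  have hS : monomial a (m.leadingCoeff q') * q - monomial a' (m.leadingCoeff q) * q' =
      monomial b 1 * m.sPolynomial q q' := by
    rw [sPolynomial_def, mul_sub, ← mul_assoc, ← mul_assoc, monomial_mul, monomial_mul, one_mul,
      one_mul, ← h1, ← h2]
  rw [hS]
  by_cases h0 : m.sPolynomial q q' = 0
  · rw [h0, mul_zero]; exact zero_mem _
  have hlt := m.degree_sPolynomial_lt_sup_degree h0
  obtain ⟨hqJ, hq0, n, hn, hqh⟩ := hq
  obtain ⟨hqJ', hq0', n', hn', hqh'⟩ := hq'
  have hSJ : m.sPolynomial q q' ∈ homogeneousBelow w J (2 * d) := by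
    refine ⟨?_, h0, Finsupp.weight w (m.degree q ⊔ m.degree q'), ?_, ?_⟩
    · exact J.sub_mem (J.mul_mem_left _ hqJ) (J.mul_mem_left _ hqJ')
    · have hsup : m.degree q ⊔ m.degree q' ≤ m.degree q + m.degree q' :=
        sup_le le_self_add le_add_self
      obtain ⟨c, hc⟩ := exists_add_of_le hsup
      have := congrArg (Finsupp.weight w) hc
      rw [map_add, map_add, weight_degree_of_isWeightedHomogeneous hq0 hqh,
        weight_degree_of_isWeightedHomogeneous hq0' hqh'] at this
      omega
    · rw [sPolynomial_def]
      refine IsWeightedHomogeneous.sub ?_ ?_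
      · have := (isWeightedHomogeneous_monomial w (m.degree q ⊔ m.degree q' - m.degree q)
          (m.leadingCoeff q') rfl).mul hqh
        rwa [← weight_degree_of_isWeightedHomogeneous (m := m) hq0 hqh, ← map_add,
          tsub_add_cancel_of_le le_sup_left] at this
      · have := (isWeightedHomogeneous_monomial w (m.degree q ⊔ m.degree q' - m.degree q')
          (m.leadingCoeff q) rfl).mul hqh'
        rwa [← weight_degree_of_isWeightedHomogeneous (m := m) hq0' hqh', ← map_add,
          tsub_add_cancel_of_le le_sup_right] at this
  refine monomial_mul_mem_multiplesSpan (mem_multiplesSpan_of_isWeightedHomogeneous hJ hSJ) b 1 ?_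
  intro ν hν
  rw [hb, add_comm _ b, map_add, Set.mem_Iio]
  exact add_lt_add_right (lt_of_le_of_lt hν hlt) _

/-- Buchberger's criterion in the form of a gap statement. -/
theorem exists_degree_le_of_gap {J : Ideal (MvPolynomial σ K)} {d : ℕ}
    (hgen : J ≤ Ideal.span (homogeneousBelow w J d))
    (hJ : ∀ p ∈ homogeneousBelow w J (2 * d), ∃ q ∈ homogeneousBelow w J d,
      m.degree q ≤ m.degree p) {p : MvPolynomial σ K} (hp : p ∈ J) (hp0 : p ≠ 0) :
    ∃ q ∈ homogeneousBelow w J d, m.degree q ≤ m.degree p := by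
  obtain ⟨μ, hμ⟩ := exists_mem_multiplesSpan_Iic (m := m) (hgen hp)
  induction μ using WellFoundedLT.induction with
  | ind μ ih =>
  by_cases hlt : p ∈ multiplesSpan m (homogeneousBelow w J d) (Set.Iio μ)
  · obtain ⟨ν, hν, h⟩ := exists_mem_Iic_of_mem_Iio hlt hp0
    exact ih ν hν h
  obtain ⟨a', q', hq', ha'⟩ : ∃ a', ∃ q' ∈ homogeneousBelow w J d,
      m.toSyn (a' + m.degree q') = μ := by
    by_contra! hcon
    refine hlt (Submodule.span_mono ?_ hμ)
    rintro f ⟨a, q, hq, ha, rfl⟩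
    exact ⟨a, q, hq, lt_of_le_of_ne ha (hcon a q hq), rfl⟩
  have hlq' : m.leadingCoeff q' ≠ 0 := m.leadingCoeff_ne_zero_iff.2 hq'.2.1
  have hle : multiplesSpan m (homogeneousBelow w J d) (Set.Iic μ) ≤
      K ∙ (monomial a' 1 * q') ⊔ multiplesSpan m (homogeneousBelow w J d) (Set.Iio μ) := by
    refine Submodule.span_le.2 ?_
    rintro f ⟨a, q, hq, ha, rfl⟩
    rcases lt_or_eq_of_le (show m.toSyn (a + m.degree q) ≤ μ from ha) with h | h
    · exact Submodule.mem_sup_right (Submodule.subset_span ⟨a, q, hq, h, rfl⟩)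
    · have hmem := monomial_mul_sub_mem hJ hq hq' (m.toSyn.injective (h.trans ha'.symm))
      rw [h] at hmem
      have h1 : monomial a 1 * q = (m.leadingCoeff q' )⁻¹ • (m.leadingCoeff q •
          (monomial a' 1 * q')) + (m.leadingCoeff q')⁻¹ • (monomial a (m.leadingCoeff q') * q -
            monomial a' (m.leadingCoeff q) * q') := by
        rw [← smul_add, ← smul_mul_assoc, smul_monomial, smul_eq_mul, mul_one, add_sub_cancel,
          ← smul_mul_assoc, smul_monomial, smul_eq_mul, inv_mul_cancel₀ hlq']
      rw [h1]
      exact add_mem (Submodule.mem_sup_left (Submodule.smul_mem _ _ (Submodule.smul_mem _ _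
        (Submodule.mem_span_singleton_self _)))) (Submodule.mem_sup_right
        (Submodule.smul_mem _ _ hmem))
  obtain ⟨x, hx, y, hy, hxy⟩ := Submodule.mem_sup.1 (hle hμ)
  obtain ⟨c, rfl⟩ := Submodule.mem_span_singleton.1 hx
  have hc : c ≠ 0 := by
    rintro rfl
    rw [zero_smul, zero_add] at hxy
    exact hlt (hxy ▸ hy)
  have hcoeff : coeff (a' + m.degree q') p ≠ 0 := by
    rw [← hxy, coeff_add, coeff_eq_zero_of_mem_multiplesSpan hy (fun ν hν => ha' ▸ hν), add_zero,
      coeff_smul, coeff_monomial_mul, one_mul]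
    exact mul_ne_zero hc hlq'
  have hdeg : m.degree p = a' + m.degree q' := by
    refine m.toSyn.injective (le_antisymm ?_ (m.le_degree (mem_support_iff.2 hcoeff)))
    rw [ha']
    by_contra! hcon
    exact m.coeff_degree_ne_zero_iff.2 hp0
      (coeff_eq_zero_of_mem_multiplesSpan hμ fun ν hν => lt_of_le_of_lt hν hcon)
  exact ⟨q', hq', hdeg ▸ le_add_self⟩

end Groebner

section ExponentBound

open MvPolynomial MonomialOrder

/-- In a well quasi-order, bad sequences with entries in prescribed finite sets have bounded
length. -/
theorem exists_length_bound {α : Type*} [LE α] [WellQuasiOrderedLE α] (S : ℕ → Finset α) :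
    ∃ n, ∀ f : ℕ → α, (∀ i, f i ∈ S i) → ∃ i j, i < j ∧ j < n ∧ f i ≤ f j := by
  by_contra! hcon
  let _ : TopologicalSpace α := ⊥
  have _ : DiscreteTopology α := ⟨rfl⟩
  let T : ℕ → Set (ℕ → α) := fun n =>
    Set.pi Set.univ (fun i => (S i : Set α)) ∩
      ⋂ i, ⋂ j, {f | i < j → j < n → ¬ f i ≤ f j}
  have hcl : ∀ n, IsClosed (T n) := fun n => by
    refine (isClosed_set_pi fun i _ => isClosed_discrete _).inter
      (isClosed_iInter fun i => isClosed_iInter fun j => ?_)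
    have hc : Continuous fun f : ℕ → α => (f i, f j) :=
      (continuous_apply i).prodMk (continuous_apply j)
    exact (isClosed_discrete {q : α × α | i < j → j < n → ¬ q.1 ≤ q.2}).preimage hc
  have hne := IsCompact.nonempty_iInter_of_sequence_nonempty_isCompact_isClosed T ?_ ?_ ?_ hcl
  · obtain ⟨f, hf⟩ := hne
    obtain ⟨i, j, hij, h⟩ := wellQuasiOrdered_le f
    have := (Set.mem_iInter.1 hf (j + 1)).2
    simp only [Set.mem_iInter, Set.mem_ofPred_eq] at this
    exact this i j hij (Nat.lt_succ_self j) h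
  · rintro n f ⟨hf, h⟩
    refine ⟨hf, ?_⟩
    simp only [Set.mem_iInter, Set.mem_ofPred_eq] at h ⊢
    exact fun i j hij hj => h i j hij (Nat.lt_succ_of_lt hj)
  · intro n
    obtain ⟨f, hf, h⟩ := hcon n
    refine ⟨f, fun i _ => hf i, ?_⟩
    simp only [Set.mem_iInter, Set.mem_ofPred_eq]
    exact h
  · exact (isCompact_univ_pi fun i => (S i).finite_toSet.isCompact).of_isClosed_subset (hcl 0)
      Set.inter_subset_left

theorem le_weight_of_one_le {t : ℕ} {w : Fin t → ℕ} (hw : ∀ i, 1 ≤ w i) (c : Fin t →₀ ℕ)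
    (i : Fin t) : c i ≤ Finsupp.weight w c := by
  exact Finsupp.le_weight w (Nat.one_le_iff_ne_zero.1 (hw i)) c

theorem finite_weight_le {t : ℕ} {w : Fin t → ℕ} (hw : ∀ i, 1 ≤ w i) (d : ℕ) :
    {c : Fin t →₀ ℕ | Finsupp.weight w c ≤ d}.Finite := by
  refine (Set.finite_Iic (Finsupp.equivFunOnFinite.symm fun _ => d)).subset ?_
  intro c hc i
  exact (le_weight_of_one_le hw c i).trans hc

/-- The leading exponents of an ideal generated in bounded degree are generated by exponents
bounded independently of the ideal. -/
theorem exists_exponent_bound {t : ℕ} (m : MonomialOrder (Fin t)) (w : Fin t → ℕ)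
    (hw : ∀ i, 1 ≤ w i) (D : ℕ) :
    ∃ E : ℕ, ∀ (K : Type*) [Field K] (J : Ideal (MvPolynomial (Fin t) K)),
      J ≤ Ideal.span (homogeneousBelow w J D) → ∀ p ∈ J, p ≠ 0 →
      ∃ q ∈ J, q ≠ 0 ∧ m.degree q ≤ m.degree p ∧ ∀ i, m.degree q i ≤ E := by
  obtain ⟨n, hn⟩ := exists_length_bound
    (fun i => (finite_weight_le hw (2 ^ (i + 1) * D)).toFinset)
  refine ⟨2 ^ n * D, fun K _ J hJ => ?_⟩
  have hmono : ∀ d d', d ≤ d' → homogeneousBelow w J d ⊆ homogeneousBelow w J d' :=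
    fun d d' h q ⟨h1, h2, k, hk, h3⟩ => ⟨h1, h2, k, hk.trans h, h3⟩
  have hpow : ∀ i j, i ≤ j → 2 ^ i * D ≤ 2 ^ j * D := fun i j hij =>
    Nat.mul_le_mul_right _ (Nat.pow_le_pow_right (by norm_num) hij)
  obtain ⟨i, hi, hgap⟩ : ∃ i < n, ∀ p ∈ homogeneousBelow w J (2 * (2 ^ i * D)),
      ∃ q ∈ homogeneousBelow w J (2 ^ i * D), m.degree q ≤ m.degree p := by
    by_contra! hcon
    choose! p hp hp' using hcon
    obtain ⟨i, j, hij, hj, hle⟩ := hn (fun i => if i < n then m.degree (p i) else 0) (by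
      intro i
      simp only [Set.Finite.mem_toFinset, Set.mem_ofPred_eq]
      split_ifs with h
      · obtain ⟨-, h0, k, hk, hph⟩ := hp i h
        rw [weight_degree_of_isWeightedHomogeneous h0 hph, pow_succ']
        rwa [← mul_assoc] at hk
      · rw [map_zero]; exact Nat.zero_le _)
    simp only [hj, hij.trans hj, if_true] at hle
    refine hp' j hj (p i) (hmono _ _ ?_ (hp i (hij.trans hj))) hle
    rw [← mul_assoc, ← pow_succ']
    exact hpow _ _ hij
  intro p hp hp0
  have h1 : D ≤ 2 ^ i * D := by simpa using hpow 0 i (Nat.zero_le _)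
  obtain ⟨q, ⟨hq, hq0, k, hk, hqh⟩, hqp⟩ := exists_degree_le_of_gap
    (hJ.trans (Ideal.span_mono (hmono _ _ h1))) hgap hp hp0
  refine ⟨q, hq, hq0, hqp, fun l => (le_weight_of_one_le hw _ l).trans ?_⟩
  rw [weight_degree_of_isWeightedHomogeneous hq0 hqh]
  exact hk.trans (hpow _ _ hi.le)

end ExponentBound

section Recursion

open MvPolynomial MonomialOrder

/-- The grading of a polynomial ring over a field by weights of the variables. -/
noncomputable def weightGrading {σ : Type*} (K : Type u) [Field K] (w : σ → ℕ) (n : ℤ) :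
    AddSubgroup (MvPolynomial σ K) where
  carrier := {p | ∀ c, coeff c p ≠ 0 → (Finsupp.weight w c : ℤ) = n}
  zero_mem' c hc := absurd (coeff_zero c) hc
  add_mem' {p q} hp hq c hc := by
    by_cases h : coeff c p = 0
    · rw [coeff_add, h, zero_add] at hc; exact hq c hc
    · exact hp c h
  neg_mem' {p} hp c hc := by
    rw [coeff_neg, neg_ne_zero] at hc; exact hp c hc

theorem mem_weightGrading_natCast {σ : Type*} {K : Type u} [Field K] {w : σ → ℕ} {n : ℕ}
    {p : MvPolynomial σ K} : p ∈ weightGrading K w n ↔ IsWeightedHomogeneous w p n :=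
  ⟨fun h _ hc => Int.ofNat_injective (h _ hc), fun h _ hc => congrArg _ (h hc)⟩

theorem eq_zero_or_exists_of_mem_weightGrading {σ : Type*} {K : Type u} [Field K] {w : σ → ℕ}
    {n : ℤ} {p : MvPolynomial σ K} (h : p ∈ weightGrading K w n) : p = 0 ∨ ∃ k : ℕ, n = k := by
  by_cases h0 : p = 0
  · exact Or.inl h0
  · obtain ⟨c, hc⟩ := ne_zero_iff.1 h0
    exact Or.inr ⟨_, (h c hc).symm⟩

theorem weightGrading_mul {σ : Type*} {K : Type u} [Field K] (w : σ → ℕ) (i j : ℤ)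
    (a b : MvPolynomial σ K) (ha : a ∈ weightGrading K w i) (hb : b ∈ weightGrading K w j) :
    a * b ∈ weightGrading K w (i + j) := by
  rcases eq_zero_or_exists_of_mem_weightGrading ha with rfl | ⟨i, rfl⟩
  · rw [zero_mul]; exact zero_mem _
  rcases eq_zero_or_exists_of_mem_weightGrading hb with rfl | ⟨j, rfl⟩
  · rw [mul_zero]; exact zero_mem _
  rw [← Nat.cast_add, mem_weightGrading_natCast]
  exact (mem_weightGrading_natCast.1 ha).mul (mem_weightGrading_natCast.1 hb)

theorem weightGrading_one {σ : Type*} {K : Type u} [Field K] (w : σ → ℕ) :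
    (1 : MvPolynomial σ K) ∈ weightGrading K w 0 :=
  mem_weightGrading_natCast.2 (isWeightedHomogeneous_one K w)

theorem weight_cons {t : ℕ} (w : Fin (t + 1) → ℕ) (k : ℕ) (c : Fin t →₀ ℕ) :
    Finsupp.weight w (c.cons k) = Finsupp.weight (Fin.tail w) c + k * w 0 := by
  simp [Finsupp.weight_apply, Finsupp.sum_fintype, Fin.sum_univ_succ, Fin.tail, add_comm]

theorem finSuccEquiv_symm_mem_weightGrading {t : ℕ} {K : Type u} [Field K] (w : Fin (t + 1) → ℕ)
    (n : ℤ) (p : Polynomial (MvPolynomial (Fin t) K)) :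
    (finSuccEquiv K t).symm p ∈ weightGrading K w n ↔
      p ∈ polyGrading (weightGrading K (Fin.tail w)) (w 0) n := by
  obtain ⟨q, rfl⟩ := (finSuccEquiv K t).surjective p
  rw [AlgEquiv.symm_apply_apply]
  constructor
  · intro h i c hc
    rw [finSuccEquiv_coeff_coeff] at hc
    have := h _ hc
    rw [weight_cons] at this
    push_cast at this
    linarith
  · intro h c hc
    rw [← Finsupp.cons_tail c, ← finSuccEquiv_coeff_coeff] at hc
    have := h _ _ hc
    rw [← Finsupp.cons_tail c, weight_cons]
    push_cast
    linarith

theorem toLex_cons_le {t : ℕ} {a b : Fin t →₀ ℕ} {k l : ℕ} :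
    toLex (a.cons k) ≤ toLex (b.cons l) ↔ k < l ∨ k = l ∧ toLex a ≤ toLex b := by
  have hlt : ∀ {a b : Fin t →₀ ℕ} {k l : ℕ},
      toLex (a.cons k) < toLex (b.cons l) ↔ k < l ∨ k = l ∧ toLex a < toLex b := by
    intro a b k l
    simp only [Finsupp.Lex.lt_iff, ofLex_toLex]
    constructor
    · rintro ⟨i, h1, h2⟩
      induction i using Fin.cases with
      | zero => exact Or.inl h2
      | succ i =>
        refine Or.inr ⟨h1 0 (Fin.succ_pos i), i, fun j hj => ?_, by simpa using h2⟩
        simpa using h1 j.succ (Fin.succ_lt_succ_iff.2 hj)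
    · rintro (h | ⟨rfl, i, h1, h2⟩)
      · exact ⟨0, fun j hj => absurd hj (Fin.not_lt_zero j), h⟩
      · refine ⟨i.succ, fun j hj => ?_, by simpa using h2⟩
        induction j using Fin.cases with
        | zero => rfl
        | succ j => simpa using h1 j (Fin.succ_lt_succ_iff.1 hj)
  rw [← not_lt, hlt, ← not_lt (a := toLex b)]
  rcases lt_trichotomy k l with h | h | h
  · simp [h, h.not_gt, h.ne']
  · simp [h]
  · simp [h, h.not_gt, h.ne']

theorem lex_degree_eq_cons {t : ℕ} {K : Type u} [Field K] {p : MvPolynomial (Fin (t + 1)) K}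
    (hp : p ≠ 0) : lex.degree p = (lex.degree (finSuccEquiv K t p).leadingCoeff).cons
      (finSuccEquiv K t p).natDegree := by
  have h0 : (finSuccEquiv K t p).leadingCoeff ≠ 0 := by
    rwa [Polynomial.leadingCoeff_ne_zero, (map_ne_zero_iff _ (finSuccEquiv K t).injective)]
  refine lex.toSyn.injective (le_antisymm ?_ (le_degree (mem_support_iff.2 ?_)))
  · rw [degree_le_iff]
    intro c hc
    rw [mem_support_iff, ← Finsupp.cons_tail c, ← finSuccEquiv_coeff_coeff] at hc
    rw [lex_le_iff, ← Finsupp.cons_tail c, toLex_cons_le]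
    have hne : (finSuccEquiv K t p).coeff (c 0) ≠ 0 := fun h => hc (by rw [h, coeff_zero])
    rcases (Polynomial.le_natDegree_of_ne_zero hne).lt_or_eq with h | h
    · exact Or.inl h
    · refine Or.inr ⟨h, ?_⟩
      rw [h] at hc
      exact lex_le_iff.1 (le_degree (mem_support_iff.2 hc))
  · rw [← finSuccEquiv_coeff_coeff]
    exact lex.coeff_degree_ne_zero_iff.2 h0

/-- Every leading exponent of `J` is divisible by one with entries at most `E`. -/
def ExponentsLE {t : ℕ} {K : Type u} [Field K] (J : Ideal (MvPolynomial (Fin t) K)) (E : ℕ) :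
    Prop :=
  ∀ p ∈ J, p ≠ 0 → ∃ q ∈ J, q ≠ 0 ∧ lex.degree q ≤ lex.degree p ∧ ∀ i, lex.degree q i ≤ E

/-- The ideal is closed under taking weighted homogeneous components. -/
def IsWeightedHomogeneousIdeal {t : ℕ} {K : Type u} [Field K] (w : Fin t → ℕ)
    (J : Ideal (MvPolynomial (Fin t) K)) : Prop :=
  ∀ p ∈ J, ∀ n, weightedHomogeneousComponent w n p ∈ J

theorem le_of_forall_exists_degree_le {σ : Type*} {K : Type u} [Field K] (m : MonomialOrder σ)
    {I I' : Ideal (MvPolynomial σ K)} (hI : I ≤ I')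
    (h : ∀ p ∈ I', p ≠ 0 → ∃ q ∈ I, q ≠ 0 ∧ m.degree q ≤ m.degree p) : I' ≤ I := by
  intro p hp
  induction hμ : m.toSyn (m.degree p) using WellFoundedLT.induction generalizing p with
  | ind μ ih =>
  subst hμ
  by_cases hp0 : p = 0
  · rw [hp0]; exact zero_mem _
  obtain ⟨q, hq, hq0, hqp⟩ := h p hp hp0
  set a := m.degree p - m.degree q with ha
  have hadd : a + m.degree q = m.degree p := tsub_add_cancel_of_le hqp
  set c := m.leadingCoeff p * (m.leadingCoeff q)⁻¹ with hc
  have hlq : m.leadingCoeff q ≠ 0 := m.leadingCoeff_ne_zero_iff.2 hq0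
  have hmem : monomial a c * q ∈ I := I.mul_mem_left _ hq
  suffices p - monomial a c * q ∈ I by
    have h2 := add_mem this hmem
    rwa [sub_add_cancel] at h2
  by_cases h0 : p - monomial a c * q = 0
  · rw [h0]; exact zero_mem _
  refine ih _ (degree_lt_of_coeff_eq_zero h0 (m.degree_sub_le.trans (sup_le le_rfl ?_)) ?_)
    (sub_mem hp (hI hmem)) rfl
  · refine m.degree_mul_le.trans ?_
    rw [← hadd, map_add, map_add]
    gcongr
    exact m.degree_monomial_le c
  · rw [coeff_sub, ← hadd, coeff_monomial_mul, hadd, hc]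
    change m.leadingCoeff p - _ * m.leadingCoeff q = 0
    field_simp
    ring

theorem leadSlice_mono {A : Type u} [CommRing A] (J : Ideal (Polynomial A)) :
    Monotone (leadSlice J) := by
  refine monotone_nat_of_le_succ fun k => ?_
  rintro a ⟨p, hp, rfl⟩
  exact mem_leadSlice.2 ⟨Polynomial.X * p, X_mul_mem_truncLT hp, Polynomial.coeff_X_mul p k⟩

/-- The image of an ideal under `finSuccEquiv`. -/
noncomputable def polyIdeal {t : ℕ} {K : Type u} [Field K]
    (J : Ideal (MvPolynomial (Fin (t + 1)) K)) : Ideal (Polynomial (MvPolynomial (Fin t) K)) :=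
  J.comap (finSuccEquiv K t).symm

theorem mem_polyIdeal {t : ℕ} {K : Type u} [Field K] {J : Ideal (MvPolynomial (Fin (t + 1)) K)}
    {p : Polynomial (MvPolynomial (Fin t) K)} :
    p ∈ polyIdeal J ↔ (finSuccEquiv K t).symm p ∈ J := Iff.rfl

theorem exists_mem_leadSlice {t : ℕ} {K : Type u} [Field K]
    {J : Ideal (MvPolynomial (Fin (t + 1)) K)} {E : ℕ} (hE : ExponentsLE J E) {k : ℕ}
    {a : MvPolynomial (Fin t) K} (ha : a ∈ leadSlice (polyIdeal J) k) (h0 : a ≠ 0) :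
    ∃ l ≤ k, l ≤ E ∧ ∃ b ∈ leadSlice (polyIdeal J) l,
      b ≠ 0 ∧ lex.degree b ≤ lex.degree a ∧ ∀ i, lex.degree b i ≤ E := by
  obtain ⟨p, hp, rfl⟩ := ha
  change p.coeff k ≠ 0 at h0
  have hdeg : p.natDegree = k := le_antisymm
    (Polynomial.natDegree_le_iff_coeff_eq_zero.2 fun i hi => hp.2 i hi)
    (Polynomial.le_natDegree_of_ne_zero h0)
  have hp0 : (finSuccEquiv K t).symm p ≠ 0 := by
    rw [map_ne_zero_iff _ (finSuccEquiv K t).symm.injective]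
    rintro rfl
    exact h0 (Polynomial.coeff_zero k)
  obtain ⟨q, hq, hq0, hqp, hqE⟩ := hE _ hp.1 hp0
  rw [lex_degree_eq_cons hq0, lex_degree_eq_cons hp0, AlgEquiv.apply_symm_apply] at hqp
  rw [lex_degree_eq_cons hq0] at hqE
  have h1 := hqp 0
  have h2 := hqE 0
  rw [Finsupp.cons_zero, Finsupp.cons_zero, hdeg] at h1
  rw [Finsupp.cons_zero] at h2
  refine ⟨_, h1, h2, _, mem_leadSlice.2 ⟨finSuccEquiv K t q, ⟨?_, fun i hi => ?_⟩, rfl⟩, ?_, ?_, ?_⟩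
  · rw [mem_polyIdeal, AlgEquiv.symm_apply_apply]; exact hq
  · exact Polynomial.coeff_eq_zero_of_natDegree_lt hi
  · rwa [Polynomial.coeff_natDegree, Polynomial.leadingCoeff_ne_zero,
      (map_ne_zero_iff _ (finSuccEquiv K t).injective)]
  · intro i
    have := hqp i.succ
    rw [Finsupp.cons_succ, Finsupp.cons_succ, Polynomial.leadingCoeff, Polynomial.leadingCoeff,
      hdeg] at this
    exact this
  · intro i
    have := hqE i.succ
    rwa [Finsupp.cons_succ] at this

theorem exists_component_mem_truncLT {t : ℕ} {K : Type u} [Field K] {w : Fin (t + 1) → ℕ}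
    {J : Ideal (MvPolynomial (Fin (t + 1)) K)} (hJ : IsWeightedHomogeneousIdeal w J) {k : ℕ}
    {p : Polynomial (MvPolynomial (Fin t) K)} (hp : p ∈ truncLT (polyIdeal J) (k + 1)) (n : ℕ) :
    ∃ p' ∈ truncLT (polyIdeal J) (k + 1),
      p' ∈ polyGrading (weightGrading K (Fin.tail w)) (w 0) ((n : ℤ) + k * w 0) ∧
      p'.coeff k = weightedHomogeneousComponent (Fin.tail w) n (p.coeff k) := by
  set P := (finSuccEquiv K t).symm p with hP
  have hpP : p = finSuccEquiv K t P := by rw [hP, AlgEquiv.apply_symm_apply]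
  set Q := weightedHomogeneousComponent w (n + k * w 0) P with hQ
  refine ⟨finSuccEquiv K t Q, ⟨?_, fun i hi => ?_⟩, ?_, ?_⟩
  · rw [mem_polyIdeal, AlgEquiv.symm_apply_apply]
    exact hJ _ hp.1 _
  · ext c
    rw [finSuccEquiv_coeff_coeff, hQ, coeff_weightedHomogeneousComponent,
      ← finSuccEquiv_coeff_coeff, ← hpP, hp.2 i hi, coeff_zero, ite_self]
  · rw [← finSuccEquiv_symm_mem_weightGrading, AlgEquiv.symm_apply_apply]
    exact_mod_cast mem_weightGrading_natCast.2 (weightedHomogeneousComponent_isWeightedHomogeneous _ _)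
  · ext c
    rw [finSuccEquiv_coeff_coeff, hQ, coeff_weightedHomogeneousComponent,
      ← finSuccEquiv_coeff_coeff, ← hpP, coeff_weightedHomogeneousComponent, weight_cons]
    simp only [add_left_inj]

theorem weightedHomogeneousComponent_eq_self {σ : Type*} {K : Type u} [Field K] {w : σ → ℕ}
    {n : ℕ} {p : MvPolynomial σ K} (h : IsWeightedHomogeneous w p n) :
    weightedHomogeneousComponent w n p = p := by
  ext c
  rw [coeff_weightedHomogeneousComponent]
  split_ifs with hc
  · rfl
  · by_contra hne
    exact hc (h (Ne.symm hne))

/-- Weighted homogeneous ideals with bounded leading exponents have bounded resolutions. -/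
theorem hasRes_of_exponentsLE {K : Type u} [Field K] {t : ℕ} (w : Fin t → ℕ) (E : ℕ)
    (J : Ideal (MvPolynomial (Fin t) K)) (hJ : IsWeightedHomogeneousIdeal w J)
    (hE : ExponentsLE J E) :
    HasRes (weightGrading K w) ((E + 1) * ∑ i, w i) (t + 1) J
      (inducedGrading (weightGrading K w) J) := by
  induction t with
  | zero =>
    by_cases h : J = ⊥
    · subst h; exact .of_subsingleton _ _
    have htop : J = ⊤ := by
      obtain ⟨p, hp, hp0⟩ := Submodule.exists_mem_ne_zero_of_ne_bot h
      rw [eq_C_of_isEmpty p] at hp hp0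
      refine Ideal.eq_top_of_isUnit_mem _ hp (IsUnit.map C (isUnit_iff_ne_zero.2 fun h => hp0 ?_))
      rw [h, map_zero]
    subst htop
    let e : (Unit → MvPolynomial (Fin 0) K) ≃ₗ[MvPolynomial (Fin 0) K]
        (⊤ : Ideal (MvPolynomial (Fin 0) K)) :=
      (LinearEquiv.funUnique Unit _ _).trans Submodule.topEquiv.symm
    refine ⟨Unit, inferInstance, fun _ => 0, e.toLinearMap, fun _ => Nat.zero_le _, ?_,
      e.surjective, ?_, ?_⟩
    · intro k v hv
      have := hv ()
      rwa [Nat.cast_zero, sub_zero] at this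
    · intro k x hx
      refine ⟨e.symm x, fun j => ?_, e.apply_symm_apply x⟩
      rw [Nat.cast_zero, sub_zero]
      exact hx
    · rw [LinearEquiv.ker]
      exact inferInstanceAs (Subsingleton (⊥ : Submodule (MvPolynomial (Fin 0) K) _))
  | succ t ih =>
    have key := hasRes_ideal_polynomial (w := w 0) (weightGrading_mul (K := K) (Fin.tail w))
      (weightGrading_one _) (D := (E + 1) * ∑ i, Fin.tail w i) (n := t + 1) (polyIdeal J)
      ?_ E ?_ ?_
    · have hsum : (E + 1) * ∑ i, w i = (E + 1) * ∑ i, Fin.tail w i + (E + 1) * w 0 := by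
        rw [Fin.sum_univ_succ, mul_add, add_comm]; rfl
      rw [hsum]
      let e : polyIdeal J ≃+ J :=
        { toFun := fun p => ⟨(finSuccEquiv K t).symm p.1, p.2⟩
          invFun := fun p => ⟨finSuccEquiv K t p.1, by
            rw [mem_polyIdeal, AlgEquiv.symm_apply_apply]; exact p.2⟩
          left_inv := fun p => Subtype.ext (AlgEquiv.apply_symm_apply _ _)
          right_inv := fun p => Subtype.ext (AlgEquiv.symm_apply_apply _ _)
          map_add' := fun p q => Subtype.ext (map_add _ _ _) }
      exact key.of_semilinearEquiv (finSuccEquiv K t).symm.toRingEquiv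
        (finSuccEquiv_symm_mem_weightGrading w) e (fun a m => Subtype.ext (map_mul _ _ _))
        (fun k m => finSuccEquiv_symm_mem_weightGrading w k m.1)
    · intro k d a ha had
      rcases eq_zero_or_exists_of_mem_weightGrading had with rfl | ⟨n, rfl⟩
      · exact ⟨0, zero_mem _, zero_mem _, Polynomial.coeff_zero k⟩
      obtain ⟨p, hp, rfl⟩ := ha
      obtain ⟨p', h1, h2, h3⟩ := exists_component_mem_truncLT hJ hp n
      refine ⟨p', h1, h2, ?_⟩
      rw [h3]
      exact weightedHomogeneousComponent_eq_self (mem_weightGrading_natCast.1 had)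
    · intro k hk
      refine le_of_forall_exists_degree_le lex (leadSlice_mono _ hk) fun a ha h0 => ?_
      obtain ⟨l, -, hl, b, hb, hb0, hba, -⟩ := exists_mem_leadSlice hE ha h0
      exact ⟨b, leadSlice_mono _ hl hb, hb0, hba⟩
    · intro k
      refine ih (Fin.tail w) _ ?_ ?_
      · rintro _ ⟨p, hp, rfl⟩ n
        obtain ⟨p', h1, -, h3⟩ := exists_component_mem_truncLT hJ hp n
        exact mem_leadSlice.2 ⟨p', h1, h3⟩
      · intro a ha h0
        obtain ⟨l, hl, -, b, hb, hb0, hba, hbE⟩ := exists_mem_leadSlice hE ha h0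
        exact ⟨b, leadSlice_mono _ hl hb, hb0, hba, hbE⟩

end Recursion

section BaseChange

open MvPolynomial

theorem HasRes.exists_sequence {A : Type u} [CommRing A] {𝒜 : ℤ → AddSubgroup A}
    (hone : 1 ∈ 𝒜 0) {D n : ℕ} {F : Type u} [AddCommGroup F] [Module A F]
    {ℱ : ℤ → AddSubgroup F} {M : Submodule A F} (h : HasRes 𝒜 D n M (inducedGrading ℱ M)) :
    ∃ (b : ℕ → ℕ) (d : (i : ℕ) → Fin (b i) → ℕ) (φ₀ : (Fin (b 0) → A) →ₗ[A] F)
      (φ : (i : ℕ) → (Fin (b (i + 1)) → A) →ₗ[A] (Fin (b i) → A)),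
      (∀ i j, d i j ≤ D) ∧ (∀ i, n ≤ i → b i = 0) ∧
      (∀ j, φ₀ (Pi.single j 1) ∈ ℱ (d 0 j)) ∧ LinearMap.range φ₀ = M ∧
      (∀ i k j, φ i (Pi.single k 1) j ∈ 𝒜 ((d (i + 1) k : ℤ) - d i j)) ∧
      LinearMap.ker φ₀ = LinearMap.range (φ 0) ∧
      ∀ i, LinearMap.ker (φ i) = LinearMap.range (φ (i + 1)) := by
  induction n generalizing F with
  | zero =>
    have hM : Subsingleton M := h
    refine ⟨fun _ => 0, fun _ => Fin.elim0, 0, fun _ => 0, fun _ j => j.elim0, fun _ _ => rfl,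
      fun j => j.elim0, ?_, fun _ k => k.elim0, Subsingleton.elim _ _,
      fun _ => Subsingleton.elim _ _⟩
    rw [LinearMap.range_zero, eq_comm]
    exact (Submodule.subsingleton_iff_eq_bot).1 hM
  | succ n ih =>
    obtain ⟨ι, hι, d₀, f, hd, hf, hsurj, -, hker⟩ := h
    obtain ⟨b₀, ⟨e⟩⟩ := Finite.exists_equiv_fin ι
    let E : (ι → A) ≃ₗ[A] (Fin b₀ → A) := LinearEquiv.funCongrLeft A A e.symm
    let f' : (Fin b₀ → A) →ₗ[A] M := f ∘ₗ E.symm.toLinearMap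
    have hf' : (LinearMap.ker f).map (E : (ι → A) →ₗ[A] (Fin b₀ → A)) = LinearMap.ker f' := by
      rw [LinearMap.ker_comp, Submodule.map_equiv_eq_comap_symm]
    let g : LinearMap.ker f ≃ₗ[A] LinearMap.ker f' := E.ofSubmodules _ _ hf'
    have hker' : HasRes 𝒜 D n (LinearMap.ker f')
        (inducedGrading (freeGrading 𝒜 (d₀ ∘ e.symm)) (LinearMap.ker f')) := by
      refine HasRes.of_linearEquiv (ℳ := inducedGrading (freeGrading 𝒜 d₀) (LinearMap.ker f)) g
        ?_ hker
      refine fun k m => ⟨fun hm j => ?_, fun hm j => hm (e.symm j)⟩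
      have := hm (e j)
      change m.1 (e.symm (e j)) ∈ 𝒜 (k - d₀ (e.symm (e j))) at this
      rwa [e.symm_apply_apply] at this
    obtain ⟨b, d, φ₀, φ, h1, h2, h3, h4, h5, h6, h7⟩ := ih hker'
    refine ⟨fun i => Nat.casesOn i b₀ b, fun i => match i with
      | 0 => d₀ ∘ e.symm
      | i + 1 => d i, M.subtype ∘ₗ f', fun i => match i with
      | 0 => φ₀
      | i + 1 => φ i, ?_, ?_, ?_, ?_, ?_, ?_, ?_⟩
    · rintro (_ | i) j
      · exact hd _
      · exact h1 i j
    · rintro (_ | i) hi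
      · omega
      · exact h2 i (by omega)
    · intro j
      refine hf _ _ fun l => ?_
      change (Pi.single j 1 : Fin b₀ → A) (e l) ∈ 𝒜 ((d₀ (e.symm j) : ℤ) - d₀ l)
      by_cases hl : e l = j
      · subst hl
        rw [Pi.single_eq_same, e.symm_apply_apply, sub_self]
        exact hone
      · rw [Pi.single_eq_of_ne hl]
        exact zero_mem _
    · rw [LinearMap.range_comp]
      have : LinearMap.range f' = ⊤ :=
        LinearMap.range_eq_top.2 fun x => (hsurj x).imp' E fun v hv => by
          rw [← hv, LinearMap.comp_apply, LinearEquiv.coe_coe, E.symm_apply_apply]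
      rw [this, Submodule.map_subtype_top]
    · rintro (_ | i) k j
      · exact h3 k j
      · exact h5 i k j
    · change _ = LinearMap.range φ₀
      rw [h4, LinearMap.ker_comp_of_ker_eq_bot _ M.ker_subtype]
    · rintro (_ | i)
      · exact h6
      · exact h7 i

/-- The base change of a linear map between finite free modules. -/
noncomputable def baseChangeMap {A : Type u} [CommRing A] (R : Type v) [CommRing R] [Algebra A R]
    {m n : ℕ} (f : (Fin m → A) →ₗ[A] (Fin n → A)) : (Fin m → R) →ₗ[R] (Fin n → R) :=
  Matrix.toLin' ((LinearMap.toMatrix' f).map (algebraMap A R))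

section

variable {A : Type u} [CommRing A] {R : Type v} [CommRing R] [Algebra A R] {l m n : ℕ}

theorem baseChangeMap_single (f : (Fin m → A) →ₗ[A] (Fin n → A)) (k : Fin m) (j : Fin n) :
    baseChangeMap R f (Pi.single k 1) j = algebraMap A R (f (Pi.single k 1) j) := by
  rw [baseChangeMap, Matrix.toLin'_apply, Matrix.mulVec_single_one]
  simp [LinearMap.toMatrix'_apply]

theorem baseChangeMap_algebraMap (f : (Fin m → A) →ₗ[A] (Fin n → A)) (v : Fin m → A) (j : Fin n) :
    baseChangeMap R f (fun i => algebraMap A R (v i)) j = algebraMap A R (f v j) := by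
  rw [baseChangeMap, Matrix.toLin'_apply]
  conv_rhs => rw [← Matrix.toLin'_toMatrix' f, Matrix.toLin'_apply, RingHom.map_mulVec]
  rfl

theorem piScalarRight_lTensor (f : (Fin m → A) →ₗ[A] (Fin n → A))
    (x : TensorProduct A R (Fin m → A)) :
    TensorProduct.piScalarRight A R R (Fin n) (f.lTensor R x) =
      baseChangeMap R f (TensorProduct.piScalarRight A R R (Fin m) x) := by
  induction x using TensorProduct.induction_on with
  | zero => simp only [map_zero]
  | add x y hx hy => simp only [map_add, hx, hy]
  | tmul r v =>
    ext j
    rw [LinearMap.lTensor_tmul, TensorProduct.piScalarRight_apply,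
      TensorProduct.piScalarRight_apply, TensorProduct.piScalarRightHom_tmul,
      TensorProduct.piScalarRightHom_tmul]
    have : (fun j => v j • r) = r • fun j => algebraMap A R (v j) := by
      ext j
      rw [Algebra.smul_def, Pi.smul_apply, smul_eq_mul, mul_comm]
    rw [this, map_smul, Pi.smul_apply, baseChangeMap_algebraMap, smul_eq_mul, mul_comm,
      ← Algebra.smul_def]

theorem ker_baseChangeMap [Module.Flat A R] (f : (Fin l → A) →ₗ[A] (Fin m → A))
    (g : (Fin m → A) →ₗ[A] (Fin n → A)) (h : LinearMap.ker g = LinearMap.range f) :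
    LinearMap.ker (baseChangeMap R g) = LinearMap.range (baseChangeMap R f) := by
  have hex := Module.Flat.lTensor_exact R (LinearMap.exact_iff.2 h)
  ext x
  obtain ⟨y, rfl⟩ := (TensorProduct.piScalarRight A R R (Fin m)).surjective x
  rw [LinearMap.mem_ker, ← piScalarRight_lTensor, LinearEquiv.map_eq_zero_iff, hex y]
  constructor
  · rintro ⟨z, rfl⟩
    exact ⟨_, (piScalarRight_lTensor f z).symm⟩
  · rintro ⟨z, hz⟩
    obtain ⟨z, rfl⟩ := (TensorProduct.piScalarRight A R R (Fin l)).surjective z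
    rw [← piScalarRight_lTensor] at hz
    exact ⟨z, (TensorProduct.piScalarRight A R R (Fin m)).injective hz⟩

end

theorem regLE_map {K : Type u} [Field K] {N : ℕ} {A : Type v} [CommRing A] {𝒜 : ℤ → AddSubgroup A}
    (hone : 1 ∈ 𝒜 0) [Algebra A (MvPolynomial (Fin N) K)]
    [Module.Flat A (MvPolynomial (Fin N) K)]
    (hmap : ∀ k, ∀ a ∈ 𝒜 k, algebraMap A (MvPolynomial (Fin N) K) a ∈ weightGrading K 1 k)
    {D n : ℕ} {J : Ideal A} (h : HasRes 𝒜 D n J (inducedGrading 𝒜 J)) :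
    RegLE (J.map (algebraMap A (MvPolynomial (Fin N) K))) D := by
  obtain ⟨b, d, φ₀, φ, h1, h2, h3, h4, h5, h6, h7⟩ := h.exists_sequence hone
  set R := MvPolynomial (Fin N) K
  let φ₀' : (Fin (b 0) → A) →ₗ[A] (Fin 1 → A) := LinearMap.pi fun _ => φ₀
  have hφ₀' : LinearMap.ker φ₀' = LinearMap.range (φ 0) := by
    rw [← h6]
    ext x
    exact ⟨fun hx => congrFun hx 0, fun hx => funext fun _ => hx⟩
  let e := fun k => Finsupp.linearEquivFunOnFinite R R (Fin k)
  have he : ∀ k j, e k (Finsupp.single j 1) = Pi.single j 1 := fun k j =>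
    Finsupp.linearEquivFunOnFinite_single R R (Fin k) j 1
  have hhom : ∀ {k : ℕ} {p : R}, p ∈ weightGrading K 1 k ↔ p.IsHomogeneous k :=
    mem_weightGrading_natCast
  have hrange : ∀ i, (LinearMap.range (baseChangeMap R (φ i))).comap (e _).toLinearMap =
      LinearMap.range ((e _).symm.toLinearMap ∘ₗ baseChangeMap R (φ i) ∘ₗ (e _).toLinearMap) := by
    intro i
    rw [LinearMap.range_comp, LinearMap.range_comp_of_range_eq_top _ (e _).range,
      Submodule.map_equiv_eq_comap_symm, LinearEquiv.symm_symm]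
  refine ⟨n, b, d, LinearMap.proj 0 ∘ₗ baseChangeMap R φ₀' ∘ₗ (e _).toLinearMap,
    fun i => (e _).symm.toLinearMap ∘ₗ baseChangeMap R (φ i) ∘ₗ (e _).toLinearMap,
    fun i j => (h1 i j).trans (Nat.le_add_right _ _), h2, ?_, ?_, ?_, ?_, ?_⟩
  · intro j
    simp only [LinearMap.comp_apply, LinearEquiv.coe_coe, he, LinearMap.proj_apply,
      baseChangeMap_single]
    exact hhom.1 (hmap _ _ (h3 j))
  · apply le_antisymm
    · rintro _ ⟨x, rfl⟩
      change ∑ k, algebraMap A R (φ₀ (Pi.single k 1)) * e _ x k ∈ _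
      refine sum_mem fun k _ => Ideal.mul_mem_right _ _ (Ideal.mem_map_of_mem _ ?_)
      rw [← h4]
      exact LinearMap.mem_range_self φ₀ _
    · refine Submodule.span_le.2 ?_
      rintro _ ⟨a, ha, rfl⟩
      rw [SetLike.mem_coe, ← h4] at ha
      obtain ⟨v, rfl⟩ := ha
      refine ⟨(e _).symm fun i => algebraMap A R (v i), ?_⟩
      simp only [LinearMap.comp_apply, LinearEquiv.coe_coe, LinearEquiv.apply_symm_apply,
        LinearMap.proj_apply, baseChangeMap_algebraMap]
      rfl
  · intro i k j
    simp only [LinearMap.comp_apply, LinearEquiv.coe_coe, he]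
    change baseChangeMap R (φ i) (Pi.single k 1) j = 0 ∨ _ ∧
      (baseChangeMap R (φ i) (Pi.single k 1) j).IsHomogeneous _
    rw [baseChangeMap_single]
    have := hmap _ _ (h5 i k j)
    rcases eq_zero_or_exists_of_mem_weightGrading this with h0 | ⟨c, hc⟩
    · exact Or.inl h0
    · rw [hc, hhom] at this
      refine Or.inr ⟨by omega, ?_⟩
      rwa [show d (i + 1) k - d i j = c by omega]
  · rw [← hrange, ← ker_baseChangeMap _ _ hφ₀']
    ext x
    exact ⟨fun hx => funext fun j => by rw [Subsingleton.elim j 0]; exact hx,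
      fun hx => congrFun hx 0⟩
  · intro i
    rw [← hrange, ← ker_baseChangeMap _ _ (h7 i)]
    ext x
    exact (e _).symm.map_eq_zero_iff

end BaseChange

section Flat

open MvPolynomial RingTheory.Sequence
open scoped Pointwise

theorem exists_eq_X_mul_add_rename {K : Type*} [CommRing K] {t : ℕ}
    (p : MvPolynomial (Fin (t + 1)) K) : ∃ (q : MvPolynomial (Fin (t + 1)) K)
      (r : MvPolynomial (Fin t) K), p = X 0 * q + rename Fin.succ r := by
  induction p using MvPolynomial.induction_on with
  | C a => exact ⟨0, C a, by rw [mul_zero, zero_add, rename_C]⟩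
  | add p p' hp hp' =>
    obtain ⟨q, r, rfl⟩ := hp
    obtain ⟨q', r', rfl⟩ := hp'
    exact ⟨q + q', r + r', by rw [map_add]; ring⟩
  | mul_X p i hp =>
    obtain ⟨q, r, h⟩ := hp
    induction i using Fin.cases with
    | zero => exact ⟨p, 0, by rw [map_zero]; ring⟩
    | succ i => exact ⟨q * X i.succ, r * X i, by rw [map_mul, rename_X, h]; ring⟩

theorem mem_ofList_cons_smul_top {R M : Type*} [CommRing R] [AddCommGroup M] [Module R M]
    {r : R} {l : List R} {m : M}
    (h : (r • (⊤ : Submodule R M)).mkQ m ∈ (Ideal.ofList l • ⊤ : Submodule R (QuotSMulTop r M))) :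
    m ∈ (Ideal.ofList (r :: l) • ⊤ : Submodule R M) := by
  rw [← Submodule.range_mkQ (r • (⊤ : Submodule R M)), LinearMap.range_eq_map,
    ← Submodule.map_smul'', ← Submodule.mem_comap, Submodule.comap_map_mkQ] at h
  rwa [Ideal.ofList_cons, Submodule.sup_smul, Submodule.ideal_span_singleton_smul]

/-- Elements that are independent modulo a weakly regular sequence are independent over the
polynomial ring acting through the sequence. -/
theorem eq_zero_of_sum_aeval_smul_eq_zero {K R M ι : Type*} [CommRing K] [CommRing R] [Algebra K R]
    [AddCommGroup M] [Module R M] {t : ℕ} (x : Fin t → R)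
    (hx : IsWeaklyRegular M (List.ofFn x)) (e : ι → M)
    (he : ∀ (s : Finset ι) (a : ι → K), ∑ i ∈ s, algebraMap K R (a i) • e i ∈
      (Ideal.ofList (List.ofFn x) • ⊤ : Submodule R M) → ∀ i ∈ s, a i = 0)
    (s : Finset ι) (p : ι → MvPolynomial (Fin t) K) (h : ∑ i ∈ s, aeval x (p i) • e i = 0) :
    ∀ i ∈ s, p i = 0 := by
  induction t generalizing M with
  | zero =>
    have hp : ∀ i, p i = C (coeff 0 (p i)) := fun i => eq_C_of_isEmpty (p i)
    intro i hi
    rw [hp i, he s (fun i => coeff 0 (p i)) ?_ i hi, map_zero]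
    have : ∀ i, algebraMap K R (coeff 0 (p i)) = aeval x (p i) := fun i => by
      conv_rhs => rw [hp i, aeval_C]
    simp only [this, h]
    exact zero_mem _
  | succ t ih =>
    rw [List.ofFn_succ] at hx he
    obtain ⟨hreg, hx'⟩ := (isWeaklyRegular_cons_iff M _ _).1 hx
    choose q r hqr using fun p : MvPolynomial (Fin (t + 1)) K => exists_eq_X_mul_add_rename p
    have haeval : ∀ p : MvPolynomial (Fin (t + 1)) K, aeval x p =
        x 0 * aeval x (q p) + aeval (fun i : Fin t => x i.succ) (r p) := fun p => by
      conv_lhs => rw [hqr p]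
      rw [map_add, map_mul, aeval_X, aeval_rename]
      rfl
    have hdiv : ∀ p : ι → MvPolynomial (Fin (t + 1)) K, ∑ i ∈ s, aeval x (p i) • e i = 0 →
        (∀ i ∈ s, p i = X 0 * q (p i)) ∧ ∑ i ∈ s, aeval x (q (p i)) • e i = 0 := by
      intro p h
      have hr : ∀ i ∈ s, r (p i) = 0 := by
        refine ih (M := QuotSMulTop (x 0) M) (fun i : Fin t => x i.succ) hx'
          (fun i => (x 0 • (⊤ : Submodule R M)).mkQ (e i)) ?_ (fun i => r (p i)) ?_
        · intro s a h
          refine he s a (mem_ofList_cons_smul_top ?_)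
          simpa only [map_sum, map_smul] using h
        · have h2 := congrArg (x 0 • (⊤ : Submodule R M)).mkQ h
          rw [Finset.sum_congr rfl fun i _ => by rw [haeval (p i)]] at h2
          simp only [map_sum, add_smul, map_add, Finset.sum_add_distrib, mul_smul] at h2
          rw [Finset.sum_eq_zero, zero_add, map_zero] at h2
          · simpa only [map_smul] using h2
          · intro i _
            exact (Submodule.Quotient.mk_eq_zero _).2
              (Submodule.smul_mem_pointwise_smul _ _ _ Submodule.mem_top)
      have hp : ∀ i ∈ s, p i = X 0 * q (p i) := fun i hi => by
        conv_lhs => rw [hqr (p i), hr i hi, map_zero, add_zero]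
      refine ⟨hp, hreg ?_⟩
      change x 0 • _ = x 0 • (0 : M)
      rw [smul_zero, ← h, Finset.smul_sum]
      refine Finset.sum_congr rfl fun i hi => ?_
      rw [haeval (p i), hr i hi, map_zero, add_zero, mul_smul]
    have key : ∀ n (p : ι → MvPolynomial (Fin (t + 1)) K), ∑ i ∈ s, aeval x (p i) • e i = 0 →
        ∀ i ∈ s, ∀ a : Fin (t + 1) →₀ ℕ, a 0 < n → coeff a (p i) = 0 := by
      intro n
      induction n with
      | zero => intro p _ i _ a ha; omega
      | succ n ihn =>
        intro p h i hi a ha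
        obtain ⟨h1, h2⟩ := hdiv p h
        rw [h1 i hi, coeff_X_mul']
        split_ifs with h0
        · refine ihn _ h2 i hi _ ?_
          have : a 0 ≠ 0 := Finsupp.mem_support_iff.1 h0
          rw [Finsupp.tsub_apply, Finsupp.single_eq_same]
          omega
        · rfl
    intro i hi
    ext a
    exact key (a 0 + 1) p h i hi a (Nat.lt_succ_self _)

/-- A polynomial ring is flat over the subalgebra generated by a regular sequence of forms of
positive degree. -/
theorem flat_aeval {K : Type*} [Field K] {N t : ℕ} (G : Fin t → MvPolynomial (Fin N) K)
    (dG : Fin t → ℕ) (hdG : ∀ i, 0 < dG i) (hG : ∀ i, (G i).IsHomogeneous (dG i))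
    (hreg : IsWeaklyRegular (MvPolynomial (Fin N) K) (List.ofFn G)) :
    (aeval (R := K) G).toRingHom.Flat := by
  let I : Ideal (MvPolynomial (Fin N) K) := Ideal.span (Set.range G)
  have hofList : Ideal.ofList (List.ofFn G) = I := by
    rw [Ideal.ofList]
    congr 1
    ext r
    simp [List.mem_ofFn]
  obtain ⟨b, hb, hspan, hlin⟩ := exists_linearIndependent K
    (Set.range fun a : Fin N →₀ ℕ => Ideal.Quotient.mk I (monomial a (1 : K)))
  choose ex hex using fun y : b => hb y.2
  let e : b → MvPolynomial (Fin N) K := fun y => monomial (ex y) (1 : K)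
  let _ : Algebra (MvPolynomial (Fin t) K) (MvPolynomial (Fin N) K) :=
    (aeval (R := K) G).toRingHom.toAlgebra
  have hsmul : ∀ (p : MvPolynomial (Fin t) K) (r : MvPolynomial (Fin N) K), p • r = aeval G p * r :=
    fun p r => rfl
  change Module.Flat (MvPolynomial (Fin t) K) (MvPolynomial (Fin N) K)
  have hind : LinearIndependent (MvPolynomial (Fin t) K) e := by
    rw [linearIndependent_iff']
    intro s p h
    refine eq_zero_of_sum_aeval_smul_eq_zero G hreg e ?_ s p h
    intro s a h
    refine linearIndependent_iff'.1 hlin s a ?_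
    rw [hofList, smul_eq_mul, Ideal.mul_top] at h
    have := Ideal.Quotient.eq_zero_iff_mem.2 h
    rw [map_sum] at this
    rw [← this]
    refine Finset.sum_congr rfl fun y _ => ?_
    rw [← hex y, smul_eq_mul, ← Algebra.smul_def]
    rfl
  have hspan' : ⊤ ≤ Submodule.span (MvPolynomial (Fin t) K) (Set.range e) := by
    set T := Submodule.span (MvPolynomial (Fin t) K) (Set.range e) with hT
    have hC : ∀ (c : K) (r : MvPolynomial (Fin N) K), r ∈ T → c • r ∈ T := fun c r hr => by
      have := T.smul_mem (C c) hr
      rwa [hsmul, aeval_C, ← Algebra.smul_def] at this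
    have hTG : ∀ i r, r ∈ T → r * G i ∈ T := fun i r hr => by
      have := T.smul_mem (X i) hr
      rwa [hsmul, aeval_X, mul_comm] at this
    have hb' : b ⊆ (Submodule.span K (Set.range e)).map (Ideal.Quotient.mkₐ K I).toLinearMap :=
      fun y hy => ⟨e ⟨y, hy⟩, Submodule.subset_span ⟨_, rfl⟩, hex ⟨y, hy⟩⟩
    have hcomp : ∀ τ ∈ Submodule.span K (Set.range e), ∀ k, homogeneousComponent k τ ∈ T := by
      intro τ hτ k
      induction hτ using Submodule.span_induction with
      | mem x hx =>
        obtain ⟨y, rfl⟩ := hx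
        rw [homogeneousComponent_of_mem (isHomogeneous_monomial (1 : K) rfl)]
        split_ifs
        · exact Submodule.subset_span ⟨y, rfl⟩
        · exact zero_mem _
      | zero => rw [map_zero]; exact zero_mem _
      | add x y _ _ hx hy => rw [map_add]; exact add_mem hx hy
      | smul c x _ hx => rw [map_smul]; exact hC c _ hx
    have hmon : ∀ g : MvPolynomial (Fin N) K,
        ∃ τ, (∀ k, homogeneousComponent k τ ∈ T) ∧ g - τ ∈ I := by
      intro g
      have hg : Ideal.Quotient.mk I g ∈ Submodule.span K b := by
        rw [hspan, g.as_sum, map_sum]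
        refine sum_mem fun a _ => ?_
        have := Submodule.smul_mem (Submodule.span K _) (coeff a g)
          (Submodule.subset_span (Set.mem_range_self (f := fun a : Fin N →₀ ℕ =>
            Ideal.Quotient.mk I (monomial a (1 : K))) a))
        convert this using 1
        change _ = Ideal.Quotient.mk I (coeff a g • monomial a 1)
        rw [smul_monomial, smul_eq_mul, mul_one]
      obtain ⟨τ, hτ, hτg⟩ := Submodule.span_le.2 hb' hg
      exact ⟨τ, hcomp τ hτ, Ideal.Quotient.eq.1 hτg.symm⟩
    have hhom : ∀ n (f : MvPolynomial (Fin N) K), f.IsHomogeneous n → f ∈ T := by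
      intro n
      induction n using Nat.strong_induction_on with
      | _ n ih =>
      intro f hf
      obtain ⟨τ, hτ, hfτ⟩ := hmon f
      obtain ⟨r, hr⟩ := Ideal.mem_span_range_iff_exists_fun.1 hfτ
      have hf' : homogeneousComponent n f =
          homogeneousComponent n τ + ∑ i, homogeneousComponent n (r i * G i) := by
        rw [← map_sum, hr, ← map_add, add_sub_cancel]
      rw [homogeneousComponent_of_mem hf, if_pos rfl] at hf'
      rw [hf']
      refine add_mem (hτ n) (sum_mem fun i _ => ?_)
      rw [← sum_homogeneousComponent (r i), Finset.sum_mul, map_sum]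
      refine sum_mem fun j _ => ?_
      have hj := homogeneousComponent_isHomogeneous j (r i)
      rw [homogeneousComponent_of_mem (hj.mul (hG i))]
      split_ifs with h
      · exact hTG i _ (ih j (by have := hdG i; omega) _ hj)
      · exact zero_mem _
    intro f _
    rw [← sum_homogeneousComponent f]
    exact sum_mem fun n _ => hhom n _ (homogeneousComponent_isHomogeneous n f)
  have := Module.Free.of_basis (Module.Basis.mk hind hspan')
  infer_instance

end Flat

section Assembly

open MvPolynomial MonomialOrder RingTheory.Sequence

theorem flat_rename {R σ τ : Type*} [CommRing R] {f : σ → τ} (hf : Function.Injective f) :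
    (rename f : MvPolynomial σ R →ₐ[R] MvPolynomial τ R).toRingHom.Flat := by
  classical
  let e : ((Set.range f)ᶜ : Set τ) ⊕ σ ≃ τ :=
    ((Equiv.refl _).sumCongr (Equiv.ofInjective f hf)).trans
      ((Equiv.sumComm _ _).trans (Equiv.Set.sumCompl (Set.range f)))
  let g : MvPolynomial ((Set.range f)ᶜ : Set τ) (MvPolynomial σ R) ≃ₐ[R] MvPolynomial τ R :=
    (sumAlgEquiv R _ _).symm.trans (renameEquiv R e)
  have hg : (rename f : MvPolynomial σ R →ₐ[R] MvPolynomial τ R).toRingHom =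
      (g.toRingEquiv : _ ≃+* _).toRingHom.comp (algebraMap (MvPolynomial σ R) _) := by
    refine MvPolynomial.ringHom_ext (fun r => ?_) (fun i => ?_)
    · simp [g, algebraMap_eq]
    · simp [g, e, algebraMap_eq]
  rw [hg]
  refine RingHom.Flat.comp ?_ (RingHom.Flat.of_bijective g.bijective)
  rw [RingHom.flat_algebraMap_iff]
  infer_instance

theorem exists_resolution_bound : ∃ C : ℕ → ℕ, ∀ (K : Type u) [Field K] (t t' : ℕ), t' ≤ t →
    ∀ (w : Fin t' → ℕ), (∀ i, 1 ≤ w i ∧ w i ≤ 2) → ∀ J : Ideal (MvPolynomial (Fin t') K),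
      IsWeightedHomogeneousIdeal w J → J ≤ Ideal.span (homogeneousBelow w J 2) →
      HasRes (weightGrading K w) (C t) (t' + 1) J (inducedGrading (weightGrading K w) J) := by
  have h : ∀ (t' : ℕ) (w : Fin t' → ℕ), ∃ E : ℕ, (∀ i, 1 ≤ w i) →
      ∀ (K : Type u) [Field K] (J : Ideal (MvPolynomial (Fin t') K)),
        J ≤ Ideal.span (homogeneousBelow w J 2) → ExponentsLE J E := fun t' w => by
    by_cases hw : ∀ i, 1 ≤ w i
    · obtain ⟨E, hE⟩ := exists_exponent_bound lex w hw 2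
      exact ⟨E, fun _ K _ J hJ => hE K J hJ⟩
    · exact ⟨0, fun h => absurd h hw⟩
  choose E hE using h
  refine ⟨fun t => (Finset.range (t + 1)).sup fun t' =>
    (Fintype.piFinset fun _ : Fin t' => {1, 2}).sup fun w => (E t' w + 1) * ∑ i, w i, ?_⟩
  intro K _ t t' ht w hw J hJ hJ'
  refine (hasRes_of_exponentsLE w (E t' w) J hJ (hE t' w (fun i => (hw i).1) K J hJ')).mono ?_
  have hw' : w ∈ Fintype.piFinset fun _ : Fin t' => ({1, 2} : Finset ℕ) := by
    rw [Fintype.mem_piFinset]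
    intro i
    have := hw i
    simp only [Finset.mem_insert, Finset.mem_singleton]
    omega
  exact (Finset.le_sup (f := fun w : Fin t' → ℕ => (E t' w + 1) * ∑ i, w i) hw').trans
    (Finset.le_sup (f := fun t' => (Fintype.piFinset fun _ : Fin t' => ({1, 2} : Finset ℕ)).sup
      fun w => (E t' w + 1) * ∑ i, w i) (Finset.mem_range.2 (Nat.lt_succ_of_le ht)))

theorem isHomogeneous_aeval_monomial {K σ τ : Type*} [Field K] {G : τ → MvPolynomial σ K}
    {w : τ → ℕ} (hG : ∀ i, (G i).IsHomogeneous (w i)) (c : τ →₀ ℕ) (a : K) :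
    (aeval G (monomial c a)).IsHomogeneous (Finsupp.weight w c) := by
  rw [aeval_monomial, Finsupp.weight_apply, algebraMap_eq]
  refine IsHomogeneous.C_mul (IsHomogeneous.prod _ _ _ fun i _ => ?_) a
  change (G i ^ c i).IsHomogeneous (c i • w i)
  rw [smul_eq_mul, mul_comm]
  exact (hG i).pow _

theorem homogeneousComponent_aeval {K σ τ : Type*} [Field K] {G : τ → MvPolynomial σ K}
    {w : τ → ℕ} (hG : ∀ i, (G i).IsHomogeneous (w i)) (n : ℕ) (p : MvPolynomial τ K) :
    homogeneousComponent n (aeval G p) = aeval G (weightedHomogeneousComponent w n p) := by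
  induction p using MvPolynomial.induction_on' with
  | monomial c a =>
    rw [homogeneousComponent_of_mem (isHomogeneous_aeval_monomial hG c a),
      weightedHomogeneousComponent_of_mem (isWeightedHomogeneous_monomial w c a rfl)]
    split_ifs
    · rfl
    · rw [map_zero]
  | add p q hp hq => rw [map_add, map_add, hp, hq, map_add, map_add]

theorem isHomogeneous_aeval {K σ τ : Type*} [Field K] {G : τ → MvPolynomial σ K}
    {w : τ → ℕ} (hG : ∀ i, (G i).IsHomogeneous (w i)) {n : ℕ} {p : MvPolynomial τ K}
    (hp : IsWeightedHomogeneous w p n) : (aeval G p).IsHomogeneous n := by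
  rw [← weightedHomogeneousComponent_eq_self hp, ← homogeneousComponent_aeval hG]
  exact homogeneousComponent_isHomogeneous _ _

theorem IsWeightedHomogeneous.of_rename {K σ τ : Type*} [Field K] {f : σ → τ}
    (hf : Function.Injective f) {w : τ → ℕ} {n : ℕ} {p : MvPolynomial σ K}
    (h : IsWeightedHomogeneous w (rename f p) n) : IsWeightedHomogeneous (w ∘ f) p n := by
  intro c hc
  rw [← coeff_rename_mapDomain f hf] at hc
  rw [← h hc, Finsupp.weight_apply, Finsupp.weight_apply,
    Finsupp.sum_mapDomain_index (fun i => zero_smul ℕ (w i)) (fun i _ _ => add_smul _ _ (w i))]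
  rfl

theorem isWeightedHomogeneousIdeal_span {t : ℕ} {K : Type u} [Field K] {w : Fin t → ℕ} {ι : Type*}
    [Finite ι] (P : ι → MvPolynomial (Fin t) K) (hP : ∀ i, ∃ n, IsWeightedHomogeneous w (P i) n) :
    IsWeightedHomogeneousIdeal w (Ideal.span (Set.range P)) := by
  have := Fintype.ofFinite ι
  intro p hp n
  obtain ⟨r, rfl⟩ := Ideal.mem_span_range_iff_exists_fun.1 hp
  rw [map_sum]
  refine sum_mem fun i _ => ?_
  rw [(r i).as_sum, Finset.sum_mul, map_sum]
  refine sum_mem fun c _ => ?_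
  obtain ⟨k, hk⟩ := hP i
  rw [weightedHomogeneousComponent_of_mem ((isWeightedHomogeneous_monomial w c _ rfl).mul hk)]
  split_ifs
  · exact Ideal.mul_mem_left _ _ (Ideal.subset_span ⟨i, rfl⟩)
  · exact zero_mem _

theorem le_span_homogeneousBelow {σ K ι : Type*} [Field K] {w : σ → ℕ}
    {d : ℕ} (P : ι → MvPolynomial σ K) (hP : ∀ i, ∃ n ≤ d, IsWeightedHomogeneous w (P i) n) :
    Ideal.span (Set.range P) ≤
      Ideal.span (homogeneousBelow w (Ideal.span (Set.range P)) d) := by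
  rw [Ideal.span_le]
  rintro _ ⟨i, rfl⟩
  by_cases h : P i = 0
  · rw [h]; exact zero_mem _
  · exact Ideal.subset_span ⟨Ideal.subset_span ⟨i, rfl⟩, h, hP i⟩

/-- A form of degree `n` in the subalgebra generated by forms is a weighted homogeneous polynomial
in the generators of degree at most `n`. -/
theorem exists_aeval_eq_of_isHomogeneous {K σ τ ι : Type*} [Field K] {G : τ → MvPolynomial σ K}
    {w : τ → ℕ} (hG : ∀ i, (G i).IsHomogeneous (w i)) {n : ℕ} {f : ι → τ}
    (hf : Function.Injective f) (hfn : ∀ j, w j ≤ n → j ∈ Set.range f)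
    {F : MvPolynomial σ K} (hF : F.IsHomogeneous n) (hFG : F ∈ Algebra.adjoin K (Set.range G)) :
    ∃ P : MvPolynomial ι K, IsWeightedHomogeneous (w ∘ f) P n ∧ aeval (G ∘ f) P = F := by
  rw [Algebra.adjoin_range_eq_range_aeval] at hFG
  obtain ⟨Q, rfl⟩ := hFG
  have hQ := weightedHomogeneousComponent_isWeightedHomogeneous (w := w) n Q
  obtain ⟨P, hP⟩ := exists_rename_eq_of_vars_subset_range
    (weightedHomogeneousComponent w n Q) f hf fun j hj => by
      obtain ⟨c, hc, hj⟩ := (mem_vars_iff_mem_support _).1 hj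
      refine hfn j ?_
      rw [← hQ (mem_support_iff.1 hc)]
      exact Finsupp.le_weight_of_ne_zero' w (Finsupp.mem_support_iff.1 hj)
  refine ⟨P, IsWeightedHomogeneous.of_rename hf (hP ▸ hQ), ?_⟩
  rw [← aeval_rename, hP, ← homogeneousComponent_aeval hG]
  exact (homogeneousComponent_of_mem hF).trans (if_pos rfl)

/-- An ideal generated by linear and quadratic forms in the subalgebra generated by a regular
sequence of forms inherits resolution bounds from weighted polynomial rings. -/
theorem regLE_span_of_resolution_bound {K : Type u} [Field K] {N n t D : ℕ}
    (hC : ∀ t' ≤ t, ∀ w : Fin t' → ℕ, (∀ i, 1 ≤ w i ∧ w i ≤ 2) →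
      ∀ J : Ideal (MvPolynomial (Fin t') K), IsWeightedHomogeneousIdeal w J →
        J ≤ Ideal.span (homogeneousBelow w J 2) →
        HasRes (weightGrading K w) D (t' + 1) J (inducedGrading (weightGrading K w) J))
    (F : Fin n → MvPolynomial (Fin N) K) (G : Fin t → MvPolynomial (Fin N) K) (dG : Fin t → ℕ)
    (hF : ∀ i, (F i).IsHomogeneous 1 ∨ (F i).IsHomogeneous 2) (hdG : ∀ i, 0 < dG i)
    (hG : ∀ i, (G i).IsHomogeneous (dG i))
    (hreg : IsWeaklyRegular (MvPolynomial (Fin N) K) (List.ofFn G))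
    (hFG : ∀ i, F i ∈ Algebra.adjoin K (Set.range G)) :
    RegLE (Ideal.span (Set.range F)) D := by
  let e := Fintype.equivFin {j // dG j ≤ 2}
  let f : Fin (Fintype.card {j // dG j ≤ 2}) → Fin t := fun i => (e.symm i).1
  have hf : Function.Injective f := Subtype.val_injective.comp e.symm.injective
  have hf2 : ∀ i, dG (f i) ≤ 2 := fun i => (e.symm i).2
  have hfr : ∀ j, dG j ≤ 2 → j ∈ Set.range f := fun j hj => ⟨e ⟨j, hj⟩, by simp [f]⟩
  have hP : ∀ i, ∃ P : MvPolynomial (Fin (Fintype.card {j // dG j ≤ 2})) K,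
      (∃ n ≤ 2, IsWeightedHomogeneous (dG ∘ f) P n) ∧ aeval (G ∘ f) P = F i := fun i => by
    rcases hF i with h | h
    · obtain ⟨P, hP, hPF⟩ := exists_aeval_eq_of_isHomogeneous hG hf
        (fun j hj => hfr j (hj.trans one_le_two)) h (hFG i)
      exact ⟨P, ⟨1, one_le_two, hP⟩, hPF⟩
    · obtain ⟨P, hP, hPF⟩ := exists_aeval_eq_of_isHomogeneous hG hf hfr h (hFG i)
      exact ⟨P, ⟨2, le_rfl, hP⟩, hPF⟩
  choose P hPw hPF using hP
  have hres := hC _ ((Fintype.card_subtype_le _).trans_eq (Fintype.card_fin t)) (dG ∘ f)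
    (fun i => ⟨hdG _, hf2 i⟩) (Ideal.span (Set.range P))
    (isWeightedHomogeneousIdeal_span P fun i => (hPw i).imp fun _ h => h.2)
    (le_span_homogeneousBelow P hPw)
  have hflat : (aeval (R := K) (G ∘ f)).toRingHom.Flat := by
    have := (flat_rename (R := K) hf).comp (flat_aeval G dG hdG hG hreg)
    convert this using 1
    exact RingHom.ext fun p => (aeval_rename f G p).symm
  let _ : Algebra (MvPolynomial (Fin (Fintype.card {j // dG j ≤ 2})) K)
    (MvPolynomial (Fin N) K) := (aeval (R := K) (G ∘ f)).toRingHom.toAlgebra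
  have : Module.Flat (MvPolynomial (Fin (Fintype.card {j // dG j ≤ 2})) K)
    (MvPolynomial (Fin N) K) := hflat
  have hreg := regLE_map (K := K) (N := N) (weightGrading_one (dG ∘ f)) (fun k a ha => ?_) hres
  · rw [Ideal.map_span, ← Set.range_comp] at hreg
    convert hreg using 3
    exact funext fun i => (hPF i).symm
  · rcases eq_zero_or_exists_of_mem_weightGrading ha with rfl | ⟨k, rfl⟩
    · rw [map_zero]; exact zero_mem _
    · exact mem_weightGrading_natCast.2
        (isHomogeneous_aeval (fun i => hG (f i)) (mem_weightGrading_natCast.1 ha))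

end Assembly

end GradedResolution

/-- If an ideal `I` of `R = K[x_1,…,x_N]` is generated by `n ≥ 1` quadratic and linear forms
lying in a subalgebra `K[G_1,…,G_t]` generated by a regular sequence of forms, then the
Castelnuovo–Mumford regularity of `R/I` is bounded by a constant depending only on `t`
(and not on `N`). -/
theorem regularity_bounded_by_number_of_regular_forms
    (K : Type*) [Field K] :
    ∃ C : ℕ → ℕ, ∀ (N n t : ℕ), 1 ≤ n →
      ∀ (F : Fin n → MvPolynomial (Fin N) K) (G : Fin t → MvPolynomial (Fin N) K)
        (dG : Fin t → ℕ),
        (∀ i, (F i).IsHomogeneous 1 ∨ (F i).IsHomogeneous 2) →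
        (∀ i, 0 < dG i) → (∀ i, (G i).IsHomogeneous (dG i)) →
        RingTheory.Sequence.IsRegular (MvPolynomial (Fin N) K) (List.ofFn G) →
        (∀ i, F i ∈ Algebra.adjoin K (Set.range G)) →
        RegLE (Ideal.span (Set.range F)) (C t) := by
  obtain ⟨C, hC⟩ := GradedResolution.exists_resolution_bound
  exact ⟨C, fun _ _ t _ F G dG hF hdG hG hreg hFG =>
    GradedResolution.regLE_span_of_resolution_bound (hC K t) F G dG hF hdG hG
      hreg.toIsWeaklyRegular hFG⟩
end
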